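/- arXiv:2301.09481 — 2 statements merged into one kernel-verified Lean document; each statement's English description precedes it below -/
import Mathlib

section
/- Let 1 < p < ∞ with conjugate exponent p', let m : (0,∞) → ℂ be continuous, let (Ω,μ) be a σ-finite measure space, and let α ∈ L^∞(ℝ₊; L^p(Ω)) and β ∈ L^∞(ℝ₊; L^{p'}(Ω)) satisfy m(s+t) = ⟨α(s), β(t)⟩ for almost every (s,t) ∈ (0,∞)². Then there exists a bounded linear map w : B(L^p(ℝ₊)) → B(L^p(ℝ₊)) such that: ‖w(T)‖ ≤ ‖α‖_∞ ‖β‖_∞ ‖T‖ for all T; ⟨w(T) f, g⟩ = ⟨(T ⊗̄ I_{L^p(Ω)})(f·α), g·β⟩ for all T ∈ B(L^p(ℝ₊)), f ∈ L^p(ℝ₊), g ∈ L^{p'}(ℝ₊), where f·α ∈ L^p(ℝ₊×Ω) is (t,ω) ↦ f(t)(α(t))(ω) and g·β ∈ L^{p'}(ℝ₊×Ω) is (t,ω) ↦ g(t)(β(t))(ω); w(θ_u) = m(u) θ_u for every u > 0; and w maps Hankelian operators to Hankelian operators. In particular m is the symbol of a bounded multiplier on the space of Hankel operators on L^p(ℝ₊),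 with norm at most ‖α‖_∞‖β‖_∞. -/
open scoped ENNReal
open MeasureTheory

/-- Lebesgue measure on `ℝ₊ = (0,∞)`. -/
noncomputable def muplus : Measure ℝ := volume.restrict (Set.Ioi 0)

/-- The translate `τ_v f` of a function on `ℝ₊`. -/
noncomputable def shiftR (v : ℝ) (f : ℝ → ℂ) : ℝ → ℂ := fun t => if v < t then f (t - v) else 0

/-- `T ∈ B(L^p(ℝ₊))` is Hankelian: `⟨T(τ_v f), g⟩ = ⟨T f, τ_v g⟩` (`g` in `L^{p'}`). -/
def IsHankelianLp (p q : ℝ≥0∞) [Fact (1 ≤ p)] [Fact (1 ≤ q)]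
    (T : Lp ℂ p muplus →L[ℂ] Lp ℂ p muplus) : Prop :=
  ∀ v : ℝ, 0 < v → ∀ (f fv : Lp ℂ p muplus) (g : Lp ℂ q muplus) (gv : Lp ℂ q muplus),
    (fv : ℝ → ℂ) =ᵐ[muplus] shiftR v (f : ℝ → ℂ) →
    (gv : ℝ → ℂ) =ᵐ[muplus] shiftR v (g : ℝ → ℂ) →
    ∫ t, (T fv : ℝ → ℂ) t * (g : ℝ → ℂ) t ∂muplus
      = ∫ t, (T f : ℝ → ℂ) t * (gv : ℝ → ℂ) t ∂muplus

namespace HankMult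
open Filter Topology Set

section Ind
variable {X : Type*} [MeasurableSpace X] {μ : Measure X} {p : ℝ≥0∞}

/-- restriction of an `L^p` function to a measurable set -/
noncomputable def ind (S : Set X) (hS : MeasurableSet S) (g : Lp ℂ p μ) : Lp ℂ p μ :=
  ((Lp.memLp g).indicator hS).toLp _

lemma ind_coe (S : Set X) (hS : MeasurableSet S) (g : Lp ℂ p μ) :
    (ind S hS g : X → ℂ) =ᵐ[μ] S.indicator (g : X → ℂ) := MemLp.coeFn_toLp _

lemma ind_tendsto [Fact (1 ≤ p)] (hp : p ≠ ∞) {ι : Type*} {l : Filter ι} [l.IsCountablyGenerated]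
    {S : ι → Set X} {S' : Set X} (hS : ∀ i, MeasurableSet (S i)) (hS' : MeasurableSet S')
    (g : Lp ℂ p μ) (h : ∀ x, ∀ᶠ i in l, (x ∈ S i ↔ x ∈ S')) :
    Tendsto (fun i => ind (S i) (hS i) g) l (𝓝 (ind S' hS' g)) := by
  unfold ind
  rw [Lp.tendsto_Lp_iff_tendsto_eLpNorm'']
  have hp0 : p ≠ 0 := (one_pos.trans_le (Fact.out : 1 ≤ p)).ne'
  have hpr : 0 < p.toReal := ENNReal.toReal_pos hp0 hp
  simp_rw [eLpNorm_eq_lintegral_rpow_enorm_toReal hp0 hp]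
  have hfin : ∫⁻ a, ‖g a‖ₑ ^ p.toReal ∂μ ≠ ∞ := by
    have := (Lp.memLp g).2
    rw [eLpNorm_eq_lintegral_rpow_enorm_toReal hp0 hp] at this
    intro h
    rw [h, ENNReal.top_rpow_of_pos (by positivity)] at this
    exact lt_irrefl _ this
  have key : Tendsto (fun i => ∫⁻ a, ‖((S i).indicator (g : X → ℂ) - S'.indicator (g : X → ℂ)) a‖ₑ
      ^ p.toReal ∂μ) l (𝓝 (∫⁻ a, 0 ∂μ)) := by
    refine tendsto_lintegral_filter_of_dominated_convergence' (fun a => ‖g a‖ₑ ^ p.toReal)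
      ?_ ?_ hfin ?_
    · refine Eventually.of_forall fun i => ?_
      have h1 := ((Lp.memLp g).indicator (hS i)).1.sub ((Lp.memLp g).indicator hS').1
      exact h1.enorm.pow_const _
    · refine Eventually.of_forall fun i => Eventually.of_forall fun a => ?_
      gcongr
      by_cases h1 : a ∈ S i <;> by_cases h2 : a ∈ S' <;> simp [h1, h2]
    · refine Eventually.of_forall fun a => ?_
      refine tendsto_const_nhds.congr' ?_
      filter_upwards [h a] with i hi
      by_cases h2 : a ∈ S' <;> simp [h2, hi, hpr]
  simp only [lintegral_zero] at key
  have := (ENNReal.continuous_rpow_const (y := 1 / p.toReal)).tendsto 0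
  rw [ENNReal.zero_rpow_of_pos (by positivity)] at this
  exact this.comp key

lemma ind_sum (S : ℕ → Set X) (hS : ∀ i, MeasurableSet (S i)) (hd : Pairwise (Function.onFun Disjoint S))
    (g : Lp ℂ p μ) (s : Finset ℕ) :
    ∑ i ∈ s, ind (S i) (hS i) g
      = ind (⋃ i ∈ s, S i) (s.measurableSet_biUnion fun i _ => hS i) g := by
  apply Lp.ext
  have h1 : ∀ᵐ x ∂μ, ∀ i, (ind (S i) (hS i) g : X → ℂ) x = (S i).indicator (g : X → ℂ) x :=
    ae_all_iff.2 fun i => ind_coe _ _ _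
  have h2 := Lp.coeFn_finsetSum s (fun i => ind (S i) (hS i) g)
  filter_upwards [h1, h2, ind_coe (⋃ i ∈ s, S i) (s.measurableSet_biUnion fun i _ => hS i) g]
    with x h1 h2 h3
  rw [h2, h3, Finset.indicator_biUnion_apply _ _ (fun i _ j _ hij => hd hij)]
  simp [h1]

lemma ind_hasSum [Fact (1 ≤ p)] (hp : p ≠ ∞) (S : ℕ → Set X) (hS : ∀ i, MeasurableSet (S i))
    (hd : Pairwise (Function.onFun Disjoint S)) (g : Lp ℂ p μ) :
    HasSum (fun i => ind (S i) (hS i) g) (ind (⋃ i, S i) (.iUnion hS) g) := by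
  rw [HasSum]
  simp only [SummationFilter.unconditional_filter]
  simp_rw [ind_sum S hS hd g]
  refine ind_tendsto hp _ _ g fun x => ?_
  by_cases hx : ∃ i, x ∈ S i
  · obtain ⟨i, hi⟩ := hx
    filter_upwards [eventually_ge_atTop {i}] with s hs
    simp only [mem_iUnion]
    refine ⟨fun ⟨j, _, hj⟩ => ⟨j, hj⟩, fun _ => ⟨i, hs (by simp), hi⟩⟩
  · push Not at hx
    exact Eventually.of_forall fun s => by simp [hx]

lemma dense_lemma [Fact (1 ≤ p)] (hp : p ≠ ∞) (C : Set (Set X))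
    (hC : ‹MeasurableSpace X› = MeasurableSpace.generateFrom C) (hpi : IsPiSystem C)
    (Y : ℕ → Set X) (hYm : ∀ k, MeasurableSet (Y k)) (hmono : Monotone Y) (hU : ⋃ k, Y k = univ)
    (hfin : ∀ k, μ (Y k) ≠ ∞) (M : Submodule ℂ (Lp ℂ p μ)) (hM : IsClosed (M : Set (Lp ℂ p μ)))
    (h0 : ∀ k, ∀ u : Lp ℂ p μ, (u : X → ℂ) =ᵐ[μ] (Y k).indicator (fun _ => 1) → u ∈ M)
    (h1 : ∀ s ∈ C, ∀ k, ∀ u : Lp ℂ p μ, (u : X → ℂ) =ᵐ[μ] (s ∩ Y k).indicator (fun _ => 1) → u ∈ M)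
    (f : Lp ℂ p μ) : f ∈ M := by
  have step : ∀ k, ∀ E (hE : MeasurableSet E), ind E hE (indicatorConstLp p (hYm k) (hfin k) (1:ℂ)) ∈ M := by
    intro k
    refine MeasurableSpace.induction_on_inter hC hpi ?_ ?_ ?_ ?_
    · have : ind ∅ .empty (indicatorConstLp p (hYm k) (hfin k) (1:ℂ)) = 0 := by
        apply Lp.ext
        filter_upwards [ind_coe ∅ .empty (indicatorConstLp p (hYm k) (hfin k) (1:ℂ)),
          Lp.coeFn_zero ℂ p μ] with x h1 h2
        rw [h1, h2]; simp
      rw [this]; exact M.zero_mem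
    · intro t ht
      apply h1 t ht k
      filter_upwards [ind_coe t (hC ▸ .basic t ht) (indicatorConstLp p (hYm k) (hfin k) (1:ℂ)),
        indicatorConstLp_coeFn (p := p) (hs := hYm k) (hμs := hfin k) (c := (1:ℂ))] with x h2 h3
      rw [h2]
      by_cases hx : x ∈ t <;> by_cases hy : x ∈ Y k <;> simp [hx, hy, h3]
    · intro t ht hh
      have : ind tᶜ ht.compl (indicatorConstLp p (hYm k) (hfin k) (1:ℂ)) =
          indicatorConstLp p (hYm k) (hfin k) (1:ℂ) - ind t ht (indicatorConstLp p (hYm k) (hfin k) (1:ℂ)) := by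
        apply Lp.ext
        filter_upwards [ind_coe t ht (indicatorConstLp p (hYm k) (hfin k) (1:ℂ)),
          ind_coe tᶜ ht.compl (indicatorConstLp p (hYm k) (hfin k) (1:ℂ)),
          Lp.coeFn_sub (indicatorConstLp p (hYm k) (hfin k) (1:ℂ)) (ind t ht (indicatorConstLp p (hYm k) (hfin k) (1:ℂ)))]
          with x h1 h2 h3
        rw [h2, h3, Pi.sub_apply, h1]
        by_cases hx : x ∈ t <;> simp [hx]
      rw [this]
      exact M.sub_mem (h0 k _ indicatorConstLp_coeFn) hh
    · intro s hd hs hh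
      exact hM.mem_of_tendsto (ind_hasSum hp s hs hd _) (Eventually.of_forall fun _ => M.sum_mem fun i _ => hh i)
  refine Lp.induction hp (fun f => f ∈ M) ?_ ?_ hM f
  · intro c s hs hμs
    have e1 : ((Lp.simpleFunc.indicatorConst p hs hμs.ne c : Lp.simpleFunc ℂ p μ) : Lp ℂ p μ) = c • indicatorConstLp p hs hμs.ne (1:ℂ) := by
      rw [Lp.simpleFunc.coe_indicatorConst]
      apply Lp.ext
      filter_upwards [indicatorConstLp_coeFn (p := p) (hs := hs) (hμs := hμs.ne) (c := (1:ℂ)),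
        indicatorConstLp_coeFn (p := p) (hs := hs) (hμs := hμs.ne) (c := c),
        Lp.coeFn_smul c (indicatorConstLp p hs hμs.ne (1:ℂ))] with x h1 h2 h3
      rw [h2, h3, Pi.smul_apply, h1]
      by_cases hx : x ∈ s <;> simp [hx]
    rw [e1]
    refine M.smul_mem c ?_
    have ht := ind_tendsto hp (l := atTop) hYm MeasurableSet.univ (indicatorConstLp p hs hμs.ne (1:ℂ)) (by
      intro x
      have : x ∈ ⋃ k, Y k := by rw [hU]; trivial
      obtain ⟨k, hk⟩ := mem_iUnion.1 this
      filter_upwards [eventually_ge_atTop k] with j hj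
      simp [hmono hj hk])
    have e2 : ind univ MeasurableSet.univ (indicatorConstLp p hs hμs.ne (1:ℂ)) = indicatorConstLp p hs hμs.ne (1:ℂ) := by
      apply Lp.ext
      filter_upwards [ind_coe univ MeasurableSet.univ (indicatorConstLp p hs hμs.ne (1:ℂ))] with x h1
      simp [h1]
    rw [e2] at ht
    refine hM.mem_of_tendsto ht (Eventually.of_forall fun k => ?_)
    have : ind (Y k) (hYm k) (indicatorConstLp p hs hμs.ne (1:ℂ)) = ind s hs (indicatorConstLp p (hYm k) (hfin k) (1:ℂ)) := by
      apply Lp.ext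
      filter_upwards [ind_coe (Y k) (hYm k) (indicatorConstLp p hs hμs.ne (1:ℂ)),
        ind_coe s hs (indicatorConstLp p (hYm k) (hfin k) (1:ℂ)),
        indicatorConstLp_coeFn (p := p) (hs := hs) (hμs := hμs.ne) (c := (1:ℂ)),
        indicatorConstLp_coeFn (p := p) (hs := hYm k) (hμs := hfin k) (c := (1:ℂ))] with x h1 h2 h3 h4
      rw [h1, h2]
      by_cases hx : x ∈ s <;> by_cases hy : x ∈ Y k <;> simp [hx, hy, h3, h4]
    simp only [this]
    exact step k s hs
  · intro f g hf hg _ h1 h2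
    exact M.add_mem h1 h2

end Ind

section Pair
variable {X : Type*} [MeasurableSpace X] (μ : Measure X) (p q : ℝ≥0∞) [Fact (1 ≤ p)] [Fact (1 ≤ q)]
  [ENNReal.HolderConjugate p q]

/-- the bilinear duality pairing -/
noncomputable def pr : Lp ℂ p μ →L[ℂ] Lp ℂ q μ →L[ℂ] ℂ :=
  (ContinuousLinearMap.mul ℂ ℂ).lpPairing μ p q

lemma pr_eq (f : Lp ℂ p μ) (g : Lp ℂ q μ) : pr μ p q f g = ∫ x, f x * g x ∂μ := by
  simp [pr, ContinuousLinearMap.lpPairing_eq_integral]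

lemma pr_int (f : Lp ℂ p μ) (g : Lp ℂ q μ) : Integrable (fun x => f x * g x) μ :=
  memLp_one_iff_integrable.1 ((ContinuousLinearMap.mul ℂ ℂ).memLp_of_bilin 1 (Lp.memLp f) (Lp.memLp g))

lemma pr_le (f : Lp ℂ p μ) (g : Lp ℂ q μ) : ‖pr μ p q f g‖ ≤ ‖f‖ * ‖g‖ := by
  have h1 : pr μ p q f g = ∫ x, ((ContinuousLinearMap.mul ℂ ℂ).holder 1 f g : X → ℂ) x ∂μ := by
    rw [pr_eq]
    exact integral_congr_ae ((ContinuousLinearMap.mul ℂ ℂ).coeFn_holder f g).symm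
  rw [h1, ← L1.integral_eq_integral]
  refine (L1.norm_integral_le _).trans ?_
  have := (ContinuousLinearMap.mul ℂ ℂ).norm_holder_apply_apply_le (r := 1) f g
  simpa using this

lemma pr_sep [SigmaFinite μ] (f : Lp ℂ p μ) (h : ∀ g, pr μ p q f g = 0) : f = 0 := by
  rw [Lp.eq_zero_iff_ae_eq_zero]
  have hp0 : p ≠ 0 := (one_pos.trans_le (Fact.out : 1 ≤ p)).ne'
  refine ae_eq_zero_of_forall_setIntegral_eq_of_sigmaFinite ?_ ?_
  · intro s hs hμs
    have : IsFiniteMeasure (μ.restrict s) := ⟨by simpa using hμs⟩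
    exact ((Lp.memLp f).restrict s).integrable Fact.out
  · intro s hs hμs
    have := h (indicatorConstLp q hs hμs.ne 1)
    rw [pr_eq] at this
    rw [← integral_indicator hs, ← this]
    apply integral_congr_ae
    filter_upwards [indicatorConstLp_coeFn (p := q) (hs := hs) (hμs := hμs.ne) (c := (1:ℂ))] with x hx
    by_cases h : x ∈ s <;> simp [hx, h]
end Pair
end HankMult

namespace HankMult
open Filter Topology Set

section Dual
variable {X : Type*} [MeasurableSpace X] {μ : Measure X} {p : ℝ≥0∞}

lemma ind_univ (g : Lp ℂ p μ) : ind univ MeasurableSet.univ g = g := by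
  apply Lp.ext
  filter_upwards [ind_coe univ MeasurableSet.univ g] with x h1
  simp [h1]

/-- dominated convergence in `L^p` -/
lemma lp_dct [Fact (1 ≤ p)] (hp : p ≠ ∞) {F : ℕ → Lp ℂ p μ} {f W : Lp ℂ p μ} (c : ℝ)
    (hb : ∀ n, ∀ᵐ x ∂μ, ‖F n x‖ ≤ c * ‖W x‖) 
    (h : ∀ᵐ x ∂μ, Tendsto (fun n => F n x) atTop (𝓝 (f x))) :
    Tendsto F atTop (𝓝 f) := by
  rw [Lp.tendsto_Lp_iff_tendsto_eLpNorm']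
  have hp0 : p ≠ 0 := (one_pos.trans_le (Fact.out : 1 ≤ p)).ne'
  have hpr : 0 < p.toReal := ENNReal.toReal_pos hp0 hp
  simp_rw [eLpNorm_eq_lintegral_rpow_enorm_toReal hp0 hp]
  have hW : MemLp (fun x => (2 * c : ℂ) * W x) p μ := (Lp.memLp W).const_mul _
  have hfin : ∫⁻ a, ‖(2 * c : ℂ) * W a‖ₑ ^ p.toReal ∂μ ≠ ∞ := by
    have := hW.2
    rw [eLpNorm_eq_lintegral_rpow_enorm_toReal hp0 hp] at this
    intro h
    rw [h, ENNReal.top_rpow_of_pos (by positivity)] at this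
    exact lt_irrefl _ this
  have key : Tendsto (fun i => ∫⁻ a, ‖((F i : X → ℂ) - (f : X → ℂ)) a‖ₑ
      ^ p.toReal ∂μ) atTop (𝓝 (∫⁻ a, 0 ∂μ)) := by
    refine tendsto_lintegral_of_dominated_convergence' (fun a => ‖(2 * c : ℂ) * W a‖ₑ ^ p.toReal)
      ?_ ?_ hfin ?_
    · intro i
      exact ((Lp.aestronglyMeasurable (F i)).sub (Lp.aestronglyMeasurable f)).enorm.pow_const _
    · intro i
      filter_upwards [ae_all_iff.2 hb, h] with a ha h'
      gcongr
      rw [enorm_le_iff_norm_le]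
      have h1 : ‖f a‖ ≤ c * ‖W a‖ := le_of_tendsto h'.norm (Eventually.of_forall fun n => ha n)
      have h2 := ha i
      have h3 : ‖(2 * c : ℂ) * W a‖ = 2 * (|c| * ‖W a‖) := by simp [mul_assoc]
      rw [h3, Pi.sub_apply]
      have h4 : c * ‖W a‖ ≤ |c| * ‖W a‖ := by gcongr; exact le_abs_self c
      have := norm_sub_le (F i a) (f a)
      linarith
    · filter_upwards [h] with a h'
      have h1 : Tendsto (fun n => ‖F n a - f a‖ₑ) atTop (𝓝 0) := by
        have := (h'.sub_const (f a)).enorm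
        simpa using this
      have := ((ENNReal.continuous_rpow_const (y := p.toReal)).tendsto 0).comp h1
      rw [ENNReal.zero_rpow_of_pos hpr] at this
      exact this
  simp only [lintegral_zero] at key
  have := (ENNReal.continuous_rpow_const (y := 1 / p.toReal)).tendsto 0
  rw [ENNReal.zero_rpow_of_pos (by positivity)] at this
  exact this.comp key

lemma rn_real [SigmaFinite μ] [Fact (1 ≤ p)] (hp : p ≠ ∞) (W : Lp ℂ p μ) (ℓ : Lp ℂ p μ →L[ℝ] ℝ) :
    ∃ k : X → ℝ, Measurable k ∧ Integrable k μ ∧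
      ∀ E (hE : MeasurableSet E), ℓ (ind E hE W) = ∫ x in E, k x ∂μ := by
  classical
  have hzero : ∀ E (hE : MeasurableSet E), μ E = 0 → ind E hE W = 0 := by
    intro E hE h0
    apply Lp.ext
    filter_upwards [ind_coe E hE W, Lp.coeFn_zero ℂ p μ, measure_eq_zero_iff_ae_notMem.1 h0] with x h1 h2 h3
    rw [h1, h2]; simp [h3]
  let s : SignedMeasure X :=
    { measureOf' := fun E => if h : MeasurableSet E then ℓ (ind E h W) else 0
      empty' := by simp [hzero ∅ .empty]
      not_measurable' := fun E hE => by simp [hE]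
      m_iUnion' := fun f hf hd => by
        have := (ind_hasSum hp f hf hd W).mapL ℓ
        simpa [hf, MeasurableSet.iUnion hf] using this }
  have hs : ∀ E (hE : MeasurableSet E), s E = ℓ (ind E hE W) := fun E hE => by
    change (if h : MeasurableSet E then ℓ (ind E h W) else 0) = _
    simp [hE]
  have hac : s ≪ᵥ μ.toENNRealVectorMeasure := by
    refine VectorMeasure.AbsolutelyContinuous.mk fun E hE h0 => ?_
    rw [Measure.toENNRealVectorMeasure_apply_measurable hE] at h0
    rw [hs E hE, hzero E hE h0, map_zero]
  refine ⟨s.rnDeriv μ, s.measurable_rnDeriv μ, s.integrable_rnDeriv μ, fun E hE => ?_⟩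
  rw [← withDensityᵥ_apply (s.integrable_rnDeriv μ) hE,
    (SignedMeasure.absolutelyContinuous_iff_withDensityᵥ_rnDeriv_eq s μ).1 hac, hs]

lemma rn_complex [SigmaFinite μ] [Fact (1 ≤ p)] (hp : p ≠ ∞) (W : Lp ℂ p μ) (ℓ : Lp ℂ p μ →L[ℂ] ℂ) :
    ∃ k : X → ℂ, Measurable k ∧ Integrable k μ ∧
      ∀ E (hE : MeasurableSet E), ℓ (ind E hE W) = ∫ x in E, k x ∂μ := by
  obtain ⟨k1, m1, i1, h1⟩ := rn_real hp W (Complex.reCLM ∘L ℓ.restrictScalars ℝ)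
  obtain ⟨k2, m2, i2, h2⟩ := rn_real hp W (Complex.imCLM ∘L ℓ.restrictScalars ℝ)
  have i1' : Integrable (fun x => (k1 x : ℂ)) μ := i1.ofReal
  have i2' : Integrable (fun x => (k2 x : ℂ)) μ := i2.ofReal
  refine ⟨fun x => k1 x + k2 x * Complex.I, by fun_prop, i1'.add (i2'.mul_const _), fun E hE => ?_⟩
  rw [integral_add i1'.integrableOn (i2'.mul_const _).integrableOn, integral_mul_const]
  have e1 := integral_ofReal (μ := μ.restrict E) (𝕜 := ℂ) (f := k1)
  have e2 := integral_ofReal (μ := μ.restrict E) (𝕜 := ℂ) (f := k2)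
  simp only [Complex.coe_algebraMap] at e1 e2
  rw [e1, e2, ← h1 E hE, ← h2 E hE]
  simp [Complex.re_add_im]

lemma rn_bdd [SigmaFinite μ] [Fact (1 ≤ p)] (hp : p ≠ ∞) (W : Lp ℂ p μ) (ℓ : Lp ℂ p μ →L[ℂ] ℂ) :
    ∃ k : X → ℂ, Measurable k ∧ Integrable k μ ∧
      ∀ φ : X → ℂ, Measurable φ → (∃ c, ∀ x, ‖φ x‖ ≤ c) → ∀ u : Lp ℂ p μ,
        (u : X → ℂ) =ᵐ[μ] (fun x => φ x * W x) → ℓ u = ∫ x, φ x * k x ∂μ := by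
  obtain ⟨k, km, ki, hk⟩ := rn_complex hp W ℓ
  refine ⟨k, km, ki, ?_⟩
  have mem : ∀ φ : X → ℂ, Measurable φ → (∃ c, ∀ x, ‖φ x‖ ≤ c) → MemLp (fun x => φ x * W x) p μ := by
    rintro φ hφ ⟨c, hc⟩
    refine MemLp.of_le_mul (c := c) (Lp.memLp W) (hφ.aestronglyMeasurable.mul (Lp.aestronglyMeasurable W)) ?_
    refine Eventually.of_forall fun x => ?_
    rw [norm_mul]; gcongr; exact hc x
  have kint : ∀ φ : X → ℂ, Measurable φ → (∃ c, ∀ x, ‖φ x‖ ≤ c) → Integrable (fun x => φ x * k x) μ := by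
    rintro φ hφ ⟨c, hc⟩
    exact ki.bdd_mul hφ.aestronglyMeasurable (Eventually.of_forall hc)
  have hs : ∀ φ : SimpleFunc X ℂ, ∀ u : Lp ℂ p μ, (u : X → ℂ) =ᵐ[μ] (fun x => φ x * W x) →
      ℓ u = ∫ x, φ x * k x ∂μ := by
    intro φ
    induction φ using SimpleFunc.induction with
    | const c hs =>
      rename_i s
      intro u hu
      have : u = c • ind s hs W := by
        apply Lp.ext
        filter_upwards [hu, Lp.coeFn_smul c (ind s hs W), ind_coe s hs W] with x h1 h2 h3
        rw [h1, h2, Pi.smul_apply, h3]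
        by_cases hx : x ∈ s <;> simp [hx]
      rw [this, map_smul, hk, smul_eq_mul, ← integral_const_mul, ← integral_indicator hs]
      congr 1
      ext x
      by_cases hx : x ∈ s <;> simp [hx]
    | add hd h1 h2 =>
      rename_i f g
      intro u hu
      have hf := mem f f.measurable f.exists_forall_norm_le
      have hg := mem g g.measurable g.exists_forall_norm_le
      have : u = hf.toLp _ + hg.toLp _ := by
        apply Lp.ext
        filter_upwards [hu, Lp.coeFn_add (hf.toLp _) (hg.toLp _), hf.coeFn_toLp, hg.coeFn_toLp] with x h1 h2 h3 h4
        rw [h1, h2, Pi.add_apply, h3, h4]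
        simp [add_mul]
      rw [this, map_add, h1 _ hf.coeFn_toLp, h2 _ hg.coeFn_toLp, ← integral_add
        (kint f f.measurable f.exists_forall_norm_le) (kint g g.measurable g.exists_forall_norm_le)]
      simp [add_mul]
  rintro φ hφ ⟨c', hc'⟩ u hu
  obtain ⟨c, hc0, hc⟩ : ∃ c : ℝ, 0 ≤ c ∧ ∀ x, ‖φ x‖ ≤ c :=
    ⟨max c' 0, le_max_right _ _, fun x => (hc' x).trans (le_max_left _ _)⟩
  have hφs := hφ.stronglyMeasurable
  let φn := hφs.approxBounded c
  have hφn : ∀ n x, ‖φn n x‖ ≤ c := hφs.norm_approxBounded_le hc0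
  have hm := fun n => mem (φn n) (φn n).measurable ⟨c, hφn n⟩
  have t1 : Tendsto (fun n => (hm n).toLp _) atTop (𝓝 u) := by
    refine lp_dct hp (W := W) c ?_ ?_
    · intro n
      filter_upwards [(hm n).coeFn_toLp] with x h
      rw [h, norm_mul]; gcongr; exact hφn n x
    · filter_upwards [ae_all_iff.2 fun n => (hm n).coeFn_toLp, hu] with x h h'
      simp_rw [h, h']
      exact (hφs.tendsto_approxBounded_of_norm_le (hc x)).mul_const _
  have t2 : Tendsto (fun n => ∫ x, φn n x * k x ∂μ) atTop (𝓝 (∫ x, φ x * k x ∂μ)) := by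
    refine tendsto_integral_of_dominated_convergence (fun x => c * ‖k x‖) ?_ (ki.norm.const_mul c) ?_ ?_
    · intro n; exact (kint (φn n) (φn n).measurable ⟨c, hφn n⟩).1
    · intro n; refine Eventually.of_forall fun x => ?_
      rw [norm_mul]; gcongr; exact hφn n x
    · exact Eventually.of_forall fun x => (hφs.tendsto_approxBounded_of_norm_le (hc x)).mul_const _
  refine tendsto_nhds_unique ((ℓ.continuous.tendsto u).comp t1) ?_
  refine t2.congr fun n => ?_
  exact (hs (φn n) _ (hm n).coeFn_toLp).symm

lemma duality [SigmaFinite μ] {q : ℝ≥0∞} [Fact (1 ≤ p)] [Fact (1 ≤ q)] [ENNReal.HolderConjugate p q]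
    (hp1 : 1 < p) (hp : p ≠ ∞) (hq : q ≠ ∞) (w : X → ℝ) (hw : Measurable w) (hw0 : ∀ x, 0 < w x)
    (hwq : MemLp (fun x => (w x : ℂ)) q μ) (ℓ : Lp ℂ q μ →L[ℂ] ℂ) :
    ∃ f : Lp ℂ p μ, (∀ g, pr μ p q f g = ℓ g) ∧ ‖f‖ ≤ ‖ℓ‖ := by
  have hc : p.toReal.HolderConjugate q.toReal := ENNReal.HolderConjugate.toReal (by
    rw [← ENNReal.toReal_one]; exact (ENNReal.toReal_lt_toReal (by simp) hp).2 hp1)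
  have hp0 : p ≠ 0 := (one_pos.trans_le (Fact.out : 1 ≤ p)).ne'
  have hq0 : q ≠ 0 := (one_pos.trans_le (Fact.out : 1 ≤ q)).ne'
  set P := p.toReal with hP
  set Q := q.toReal with hQ
  have hP0 : 0 < P := hc.pos
  have hQ0 : 0 < Q := hc.symm.pos
  obtain ⟨k, km, ki, hk⟩ := rn_bdd hq (hwq.toLp _) ℓ
  let f : X → ℂ := fun x => k x / w x
  have fm : Measurable f := by fun_prop
  let S : ℕ → Set X := fun n => {x | ‖f x‖ ≤ n} ∩ {x | 1 ≤ n * w x}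
  have hS : ∀ n, MeasurableSet (S n) := fun n =>
    (measurableSet_le fm.norm measurable_const).inter (measurableSet_le measurable_const (by fun_prop))
  have hSev : ∀ x, ∀ᶠ n in atTop, x ∈ S n := by
    intro x
    obtain ⟨N, hN⟩ := exists_nat_ge (max ‖f x‖ (1 / w x))
    filter_upwards [eventually_ge_atTop N] with n hn
    have h1 : (N:ℝ) ≤ n := by exact_mod_cast hn
    refine ⟨(le_max_left _ _).trans (hN.trans h1), ?_⟩
    have := (le_max_right _ _).trans (hN.trans h1)
    rwa [div_le_iff₀ (hw0 x)] at this
  have key : ∀ g : X → ℂ, Measurable g → ∀ n : ℕ, (∃ c, ∀ x ∈ S n, ‖g x‖ ≤ c) → ∀ u : Lp ℂ q μ,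
      (u : X → ℂ) =ᵐ[μ] (S n).indicator g → ℓ u = ∫ x in S n, f x * g x ∂μ := by
    rintro g hg n ⟨c, hc⟩ u hu
    have := hk ((S n).indicator (fun x => g x / w x)) ((by fun_prop : Measurable fun x => g x / (w x : ℂ)).indicator (hS n)) ?_ u ?_
    · rw [this, ← integral_indicator (hS n)]
      congr 1
      ext x
      by_cases hx : x ∈ S n <;> simp [hx, f]
      ring
    · refine ⟨n * |c|, fun x => ?_⟩
      by_cases hx : x ∈ S n
      · have h1 := hc x hx
        have h2 := hx.2
        have h3 := hw0 x
        simp only [hx, indicator_of_mem, norm_div, Complex.norm_real, Real.norm_eq_abs, abs_of_pos h3]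
        rw [div_le_iff₀ h3]
        have h4 := le_abs_self c
        simp only [mem_ofPred_eq] at h2
        nlinarith [abs_nonneg c]
      · simp only [hx, not_false_eq_true, indicator_of_notMem, norm_zero]; positivity
    · filter_upwards [hu, hwq.coeFn_toLp] with x h1 h2
      rw [h1, h2]
      have : (w x : ℂ) ≠ 0 := by exact_mod_cast (hw0 x).ne'
      by_cases hx : x ∈ S n <;> simp [hx]
      field_simp
  have bound : ∀ n, eLpNorm ((S n).indicator f) p μ ≤ ‖ℓ‖ₑ := by
    intro n
    let g : X → ℂ := fun x => (starRingEnd ℂ) (f x) * ((‖f x‖ ^ (P - 2) : ℝ) : ℂ)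
    have gm : Measurable g := by fun_prop
    have gn : ∀ x, ‖g x‖ = ‖f x‖ ^ (P - 1) := by
      intro x
      simp only [g, norm_mul, RCLike.norm_conj, Complex.norm_real, Real.norm_eq_abs]
      rw [abs_of_nonneg (by positivity)]
      by_cases h : ‖f x‖ = 0
      · rw [h]; simp [Real.zero_rpow (sub_pos.2 hc.lt).ne']
      · rw [← Real.rpow_one_add' (norm_nonneg _) (by have := hc.lt; linarith)]
        congr 1; ring
    have fg : ∀ x, f x * g x = ((‖f x‖ ^ P : ℝ) : ℂ) := by
      intro x
      simp only [g]
      rw [← mul_assoc, Complex.mul_conj, Complex.normSq_eq_norm_sq, ← Complex.ofReal_mul]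
      congr 1
      by_cases h : ‖f x‖ = 0
      · rw [h]; simp [Real.zero_rpow hP0.ne']
      · rw [← Real.rpow_natCast, ← Real.rpow_add (by positivity)]
        congr 1; norm_num
    let I : ℝ≥0∞ := ∫⁻ x in S n, ‖f x‖ₑ ^ P ∂μ
    have gq : ∀ x, ‖g x‖ₑ ^ Q = ‖f x‖ₑ ^ P := by
      intro x
      rw [← ofReal_norm, ← ofReal_norm, gn, ENNReal.ofReal_rpow_of_nonneg (by positivity) hQ0.le,
        ENNReal.ofReal_rpow_of_nonneg (by positivity) hP0.le, ← Real.rpow_mul (norm_nonneg _)]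
      rw [hc.sub_one_mul_conj]
    have hIfin : I ≠ ∞ := by
      have : I ≤ ∫⁻ x, ‖((n:ℝ)^(P-1) * n : ℝ)‖ₑ * ‖k x‖ₑ ∂μ := by
        rw [show I = _ from (lintegral_indicator (hS n) _).symm]
        refine lintegral_mono fun x => ?_
        by_cases hx : x ∈ S n
        · simp only [hx, indicator_of_mem]
          rw [← enorm_norm (k x), ← enorm_mul, ← enorm_norm (f x), ← Real.enorm_rpow_of_nonneg (norm_nonneg _) hP0.le, enorm_le_iff_norm_le]
          rw [Real.norm_of_nonneg (by positivity), Real.norm_of_nonneg (by positivity)]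
          have h1 := hx.1
          have h2 := hx.2
          simp only [mem_ofPred_eq] at h1 h2
          have h3 : ‖f x‖ ^ P = ‖f x‖ ^ (P - 1) * ‖f x‖ := by
            conv_rhs => rw [← Real.rpow_add_one' (norm_nonneg _) (by linarith)]
            congr 1; ring
          rw [h3, mul_assoc]
          gcongr
          · exact (sub_pos.2 hc.lt).le
          · simp only [f, norm_div, Complex.norm_real, Real.norm_eq_abs, abs_of_pos (hw0 x)]
            rw [div_le_iff₀ (hw0 x)]
            nlinarith [norm_nonneg (k x)]
        · simp [hx]
      refine ne_top_of_le_ne_top ?_ this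
      rw [lintegral_const_mul _ (by fun_prop)]
      exact ENNReal.mul_ne_top enorm_ne_top ki.2.ne
    have e1 : eLpNorm ((S n).indicator g) q μ = I ^ (1 / Q) := by
      rw [eLpNorm_indicator_eq_eLpNorm_restrict (hS n), eLpNorm_eq_lintegral_rpow_enorm_toReal hq0 hq]
      simp_rw [← hQ, gq]; rfl
    have e2 : eLpNorm ((S n).indicator f) p μ = I ^ (1 / P) := by
      rw [eLpNorm_indicator_eq_eLpNorm_restrict (hS n), eLpNorm_eq_lintegral_rpow_enorm_toReal hp0 hp]
    have gmem : MemLp ((S n).indicator g) q μ := ⟨(gm.indicator (hS n)).aestronglyMeasurable, by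
      rw [e1]; exact ENNReal.rpow_lt_top_of_nonneg (by positivity) hIfin⟩
    have e3 : ℓ (gmem.toLp _) = ∫ x in S n, f x * g x ∂μ := by
      refine key g gm n ⟨(n:ℝ)^(P-1), fun x hx => ?_⟩ _ gmem.coeFn_toLp
      rw [gn]
      have h1 := hx.1
      have := (sub_pos.2 hc.lt).le
      gcongr
      exact h1
    have e4 : ‖∫ x in S n, f x * g x ∂μ‖ₑ = I := by
      simp_rw [fg]
      have := integral_ofReal (μ := μ.restrict (S n)) (𝕜 := ℂ) (f := fun x => ‖f x‖ ^ P)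
      simp only [Complex.coe_algebraMap] at this
      rw [this, ← enorm_norm, Complex.norm_real, enorm_norm, integral_eq_lintegral_of_nonneg_ae
        (Eventually.of_forall fun x => by positivity) (fm.norm.pow_const P).aestronglyMeasurable]
      have h5 : ∫⁻ x in S n, ENNReal.ofReal (‖f x‖ ^ P) ∂μ = I := by
        refine lintegral_congr fun x => ?_
        rw [← ofReal_norm, ENNReal.ofReal_rpow_of_nonneg (by positivity) hP0.le]
      rw [h5, Real.enorm_of_nonneg (by positivity), ENNReal.ofReal_toReal hIfin]
    have e5 : I ≤ ‖ℓ‖ₑ * I ^ (1 / Q) := by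
      rw [← e4, ← e3]
      refine (ℓ.le_opENorm _).trans ?_
      rw [e4.symm.trans (by rw [← e3])] at e1
      rw [Lp.enorm_toLp, e1]
    rw [e2]
    by_cases hI0 : I = 0
    · rw [hI0, ENNReal.zero_rpow_of_pos (by positivity)]; positivity
    · have hne : I ^ (1 / Q) ≠ 0 := by
        simp [hI0, hIfin]
      have hnt : I ^ (1 / Q) ≠ ∞ := ENNReal.rpow_ne_top_of_nonneg (by positivity) hIfin
      rw [← ENNReal.mul_le_mul_iff_left hne hnt]
      refine le_trans (le_of_eq ?_) e5
      rw [← ENNReal.rpow_add _ _ hI0 hIfin]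
      have : 1 / P + 1 / Q = 1 := by simpa using hc.inv_add_inv_eq_one
      rw [this, ENNReal.rpow_one]
  have fb : eLpNorm f p μ ≤ ‖ℓ‖ₑ := by
    refine (Lp.eLpNorm_lim_le_liminf_eLpNorm (f := fun n => (S n).indicator f)
      (fun n => (fm.indicator (hS n)).aestronglyMeasurable) f ?_).trans ?_
    · refine Eventually.of_forall fun x => ?_
      refine tendsto_const_nhds.congr' ?_
      filter_upwards [hSev x] with n hn
      simp [hn]
    · refine liminf_le_of_frequently_le' (Frequently.of_forall bound)
  have fmem : MemLp f p μ := ⟨fm.aestronglyMeasurable, fb.trans_lt (by simp)⟩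
  refine ⟨fmem.toLp _, ?_, ?_⟩
  · intro g
    have gm : Measurable (g : X → ℂ) := (Lp.stronglyMeasurable g).measurable
    have hD : ∀ n : ℕ, MeasurableSet {x | ‖g x‖ ≤ n} := fun n => measurableSet_le gm.norm measurable_const
    have ht := ind_tendsto (l := atTop) hq (fun n : ℕ => (hS n).inter (hD n)) MeasurableSet.univ g (by
      intro x
      obtain ⟨N, hN⟩ := exists_nat_ge ‖g x‖
      filter_upwards [hSev x, eventually_ge_atTop N] with n hn hn'
      have h1 : (N:ℝ) ≤ n := by exact_mod_cast hn'
      simp only [mem_univ, iff_true]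
      exact ⟨hn, hN.trans h1⟩)
    rw [ind_univ] at ht
    refine tendsto_nhds_unique (((pr μ p q (fmem.toLp _)).continuous.tendsto g).comp ht) ?_
    refine ((ℓ.continuous.tendsto g).comp ht).congr fun n => ?_
    simp only [Function.comp]
    rw [key ({x | ‖g x‖ ≤ n}.indicator g) (gm.indicator (hD n)) n ⟨n, fun x _ => ?_⟩ _ ?_, pr_eq, ← integral_indicator (hS n)]
    · apply integral_congr_ae
      filter_upwards [ind_coe _ ((hS n).inter (hD n)) g, fmem.coeFn_toLp] with x h1 h2
      rw [h1, h2, ← indicator_indicator (S n)]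
      by_cases hx : x ∈ S n
      · rw [indicator_of_mem hx, indicator_of_mem hx]
      · rw [indicator_of_notMem hx, indicator_of_notMem hx, mul_zero]
    · filter_upwards [ind_coe _ ((hS n).inter (hD n)) g] with x h1
      rw [h1, ← indicator_indicator (S n)]
    · by_cases hx : x ∈ {x | ‖g x‖ ≤ n}
      · simp only [hx, indicator_of_mem]; exact hx
      · simp only [hx, not_false_eq_true, indicator_of_notMem, norm_zero]; positivity
  · rw [← enorm_le_iff_norm_le, Lp.enorm_toLp]
    exact fb

end Dual
end HankMult

namespace HankMult
open Filter Topology Set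

section Basic

instance : SigmaFinite muplus := by unfold muplus; infer_instance
instance : SFinite muplus := by unfold muplus; infer_instance

lemma muplus_Ioc_le (a b : ℝ) : muplus (Ioc a b) ≤ ENNReal.ofReal (b - a) := by
  refine (Measure.restrict_apply_le _ _).trans ?_
  simp

lemma muplus_Iic (x : ℝ) : muplus (Iic x) ≠ ∞ := by
  unfold muplus
  rw [Measure.restrict_apply measurableSet_Iic, inter_comm, Ioi_inter_Iic]
  simp

lemma muplus_ae_pos : ∀ᵐ x ∂muplus, 0 < x := by
  unfold muplus
  exact ae_restrict_mem measurableSet_Ioi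

variable (p : ℝ≥0∞) [Fact (1 ≤ p)]

/-- indicator of `(0,x]` -/
noncomputable def E (x : ℝ) : Lp ℂ p muplus :=
  indicatorConstLp p (measurableSet_Iic (a := x)) (muplus_Iic x) (1:ℂ)

lemma E_coe (x : ℝ) : (E p x : ℝ → ℂ) =ᵐ[muplus] (Iic x).indicator fun _ => 1 :=
  indicatorConstLp_coeFn

lemma E_nonpos {x : ℝ} (hx : x ≤ 0) : E p x = 0 := by
  apply Lp.ext
  filter_upwards [E_coe p x, Lp.coeFn_zero ℂ p muplus, muplus_ae_pos] with t h1 h2 h3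
  rw [h1, h2]
  simp [hx.trans_lt h3]

lemma E_cont (hp : p ≠ ∞) : Continuous (E p) := by
  refine continuous_indicatorConstLp_set hp fun x => ?_
  have h : Tendsto (fun y : ℝ => ENNReal.ofReal |y - x|) (𝓝 x) (𝓝 0) := by
    have : Continuous fun y : ℝ => ENNReal.ofReal |y - x| := ENNReal.continuous_ofReal.comp (by fun_prop)
    have := this.tendsto x
    simpa using this
  refine tendsto_of_tendsto_of_tendsto_of_le_of_le tendsto_const_nhds h (fun _ => zero_le) fun y => ?_
  rcases le_total x y with hxy | hxy
  · refine (measure_mono (t := Ioc x y) ?_).trans ((muplus_Ioc_le _ _).trans (ENNReal.ofReal_le_ofReal (le_abs_self _)))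
    rintro t (⟨h1, h2⟩ | ⟨h1, h2⟩)
    · exact ⟨not_le.1 h2, h1⟩
    · exact absurd (le_trans h1 hxy) h2
  · refine (measure_mono (t := Ioc y x) ?_).trans ((muplus_Ioc_le _ _).trans (ENNReal.ofReal_le_ofReal (abs_sub_comm y x ▸ le_abs_self _)))
    rintro t (⟨h1, h2⟩ | ⟨h1, h2⟩)
    · exact absurd (le_trans h1 hxy) h2
    · exact ⟨not_le.1 h2, h1⟩

/-- indicator of `(s,s+h]` -/
noncomputable def e (h s : ℝ) : Lp ℂ p muplus := E p (s + h) - E p s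

lemma e_coe {h : ℝ} (hh : 0 ≤ h) (s : ℝ) :
    (e p h s : ℝ → ℂ) =ᵐ[muplus] (Ioc s (s + h)).indicator fun _ => 1 := by
  filter_upwards [Lp.coeFn_sub (E p (s + h)) (E p s), E_coe p (s + h), E_coe p s] with t h1 h2 h3
  rw [e, h1, Pi.sub_apply, h2, h3]
  by_cases h4 : t ≤ s
  · have : t ≤ s + h := by linarith
    simp [h4, this]
  · by_cases h5 : t ≤ s + h
    · simp [h4, h5, not_le.1 h4]
    · simp [h4, h5]

lemma e_cont (hp : p ≠ ∞) (h : ℝ) : Continuous (e p h) := by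
  have := E_cont p hp
  unfold e; fun_prop

lemma norm_sum_e (hp : p ≠ ∞) {h : ℝ} (hh : 0 ≤ h) (σ : ℝ) (M : ℕ) (c : ℕ → ℂ) :
    ‖∑ i ∈ Finset.range M, c i • e p h (σ + i * h)‖ₑ ≤
      (ENNReal.ofReal h * ∑ i ∈ Finset.range M, ‖c i‖ₑ ^ p.toReal) ^ (1 / p.toReal) := by
  have hp0 : p ≠ 0 := (one_pos.trans_le (Fact.out : 1 ≤ p)).ne'
  have hpr : 0 < p.toReal := ENNReal.toReal_pos hp0 hp
  rw [Lp.enorm_def, eLpNorm_eq_lintegral_rpow_enorm_toReal hp0 hp]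
  refine ENNReal.rpow_le_rpow ?_ (by positivity)
  have h1 : ∀ᵐ t ∂muplus, ∀ i : ℕ, (c i • e p h (σ + i * h) : Lp ℂ p muplus) t =
      c i * (Ioc (σ + i * h) (σ + i * h + h)).indicator (fun _ => 1) t := by
    refine ae_all_iff.2 fun i => ?_
    filter_upwards [Lp.coeFn_smul (c i) (e p h (σ + i * h)), e_coe p hh (σ + i * h)] with t h1 h2
    rw [h1, Pi.smul_apply, h2, smul_eq_mul]
  calc _ ≤ ∫⁻ t, ∑ i ∈ Finset.range M, (Ioc (σ + i * h) (σ + i * h + h)).indicator (fun _ => ‖c i‖ₑ ^ p.toReal) t ∂muplus := by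
        refine lintegral_mono_ae ?_
        filter_upwards [h1, Lp.coeFn_finsetSum (Finset.range M) (fun i => c i • e p h (σ + i * h))] with t h1 h2
        rw [h2]
        simp only [Finset.sum_apply, h1]
        by_cases hex : ∃ i ∈ Finset.range M, t ∈ Ioc (σ + i * h) (σ + i * h + h)
        · obtain ⟨i, hi, ht⟩ := hex
          have hd : ∀ j : ℕ, j ≠ i → t ∉ Ioc (σ + j * h) (σ + j * h + h) := by
            intro j hji htj
            rcases lt_or_gt_of_ne hji with hl | hl
            · have : (j:ℝ) + 1 ≤ i := by exact_mod_cast hl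
              have := htj.2; have := ht.1
              nlinarith
            · have : (i:ℝ) + 1 ≤ j := by exact_mod_cast hl
              have := ht.2; have := htj.1
              nlinarith
          rw [Finset.sum_eq_single i (fun j _ hj => by simp only [indicator_of_notMem (hd j hj), mul_zero]) (fun h => absurd hi h),
            Finset.sum_eq_single i (fun j _ hj => by simp only [indicator_of_notMem (hd j hj)]) (fun h => absurd hi h)]
          simp only [indicator_of_mem ht, mul_one, le_refl]
        · push Not at hex
          rw [Finset.sum_eq_zero (fun i hi => by simp only [indicator_of_notMem (hex i hi), mul_zero])]
          simp [hpr]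
    _ = ∑ i ∈ Finset.range M, ‖c i‖ₑ ^ p.toReal * muplus (Ioc (σ + i * h) (σ + i * h + h)) := by
        rw [lintegral_finsetSum _ (fun i _ => measurable_const.indicator measurableSet_Ioc)]
        refine Finset.sum_congr rfl fun i _ => ?_
        rw [lintegral_indicator_const measurableSet_Ioc]
    _ ≤ _ := by
        rw [Finset.mul_sum]
        refine Finset.sum_le_sum fun i _ => ?_
        rw [mul_comm]
        gcongr
        refine (muplus_Ioc_le _ _).trans (by simp)

end Basic

section Schur
variable {p q : ℝ≥0∞} [Fact (1 ≤ p)] [Fact (1 ≤ q)] [ENNReal.HolderConjugate p q]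

/-- matrix entries of `T` -/
noncomputable def K (q : ℝ≥0∞) [Fact (1 ≤ q)] [ENNReal.HolderConjugate p q]
    (h : ℝ) (T : Lp ℂ p muplus →L[ℂ] Lp ℂ p muplus) (s t : ℝ) : ℂ :=
  pr muplus p q (T (e p h s)) (e q h t)

lemma K_cont (hp : p ≠ ∞) (hq : q ≠ ∞) (h : ℝ) (T : Lp ℂ p muplus →L[ℂ] Lp ℂ p muplus) :
    Continuous fun z : ℝ × ℝ => K q h T z.1 z.2 := by
  unfold K
  have := e_cont p hp h
  have := e_cont q hq h
  fun_prop

lemma K_bdd (hp : p ≠ ∞) (hq : q ≠ ∞) {h : ℝ} (hh : 0 ≤ h) (T : Lp ℂ p muplus →L[ℂ] Lp ℂ p muplus) :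
    ∃ C, ∀ s t, ‖K q h T s t‖ ≤ C := by
  have h1 := fun s => norm_sum_e p hp hh s 1 (fun _ => 1)
  have h2 := fun s => norm_sum_e q hq hh s 1 (fun _ => 1)
  have hp0 : p ≠ 0 := (one_pos.trans_le (Fact.out : 1 ≤ p)).ne'
  have hpr : 0 < p.toReal := ENNReal.toReal_pos hp0 hp
  have hq0 : q ≠ 0 := (one_pos.trans_le (Fact.out : 1 ≤ q)).ne'
  have hqr : 0 < q.toReal := ENNReal.toReal_pos hq0 hq
  simp only [Finset.range_one, Finset.sum_singleton, one_smul, Nat.cast_zero, zero_mul, add_zero, enorm_one, ENNReal.one_rpow, mul_one] at h1 h2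
  rw [ENNReal.ofReal_rpow_of_nonneg hh (by positivity)] at h1 h2
  refine ⟨‖T‖ * h ^ (1 / p.toReal) * h ^ (1 / q.toReal), fun s t => ?_⟩
  have h1' : ‖e p h s‖ ≤ h ^ (1 / p.toReal) := by
    have := h1 s
    rwa [← ofReal_norm, ENNReal.ofReal_le_ofReal_iff (by positivity)] at this
  have h2' : ‖e q h t‖ ≤ h ^ (1 / q.toReal) := by
    have := h2 t
    rwa [← ofReal_norm, ENNReal.ofReal_le_ofReal_iff (by positivity)] at this
  refine (pr_le _ _ _ _ _).trans ?_
  have := T.le_opNorm (e p h s)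
  calc _ ≤ (‖T‖ * ‖e p h s‖) * ‖e q h t‖ := by gcongr
    _ ≤ _ := by gcongr

lemma schur {Ω : Type*} [MeasurableSpace Ω] {μ : Measure Ω} (hp1 : 1 < p) (hp : p ≠ ∞) (hq : q ≠ ∞) {h : ℝ} (hh : 0 ≤ h)
    (T : Lp ℂ p muplus →L[ℂ] Lp ℂ p muplus) (σ ρ : ℝ) (M : ℕ) (a : ℕ → Lp ℂ p μ) (b : ℕ → Lp ℂ q μ) :
    ‖∑ i ∈ Finset.range M, ∑ j ∈ Finset.range M,
      K q h T (σ + i * h) (ρ + j * h) * ∫ ω, a i ω * b j ω ∂μ‖ₑ ≤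
    ‖T‖ₑ * ENNReal.ofReal h * (∑ i ∈ Finset.range M, ‖a i‖ₑ ^ p.toReal) ^ (1 / p.toReal)
      * (∑ i ∈ Finset.range M, ‖b i‖ₑ ^ q.toReal) ^ (1 / q.toReal) := by
  have hc : p.toReal.HolderConjugate q.toReal := ENNReal.HolderConjugate.toReal (by
    rw [← ENNReal.toReal_one]; exact (ENNReal.toReal_lt_toReal (by simp) hp).2 hp1)
  have hp0 : p ≠ 0 := (one_pos.trans_le (Fact.out : 1 ≤ p)).ne'
  have hq0 : q ≠ 0 := (one_pos.trans_le (Fact.out : 1 ≤ q)).ne'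
  set P := p.toReal with hP
  set Q := q.toReal with hQ
  have hP0 : 0 < P := hc.pos
  have hQ0 : 0 < Q := hc.symm.pos
  have e1 : ∑ i ∈ Finset.range M, ∑ j ∈ Finset.range M,
      K q h T (σ + i * h) (ρ + j * h) * ∫ ω, a i ω * b j ω ∂μ =
      ∫ ω, pr muplus p q (T (∑ i ∈ Finset.range M, a i ω • e p h (σ + i * h)))
        (∑ j ∈ Finset.range M, b j ω • e q h (ρ + j * h)) ∂μ := by
    have : ∀ ω, pr muplus p q (T (∑ i ∈ Finset.range M, a i ω • e p h (σ + i * h)))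
        (∑ j ∈ Finset.range M, b j ω • e q h (ρ + j * h)) =
        ∑ i ∈ Finset.range M, ∑ j ∈ Finset.range M, K q h T (σ + i * h) (ρ + j * h) * (a i ω * b j ω) := by
      intro ω
      simp only [map_sum, map_smul, FunLike.coe_sum, Finset.sum_apply, FunLike.coe_smul, Pi.smul_apply, smul_eq_mul, K]
      simp only [Finset.mul_sum]
      rw [Finset.sum_comm]
      refine Finset.sum_congr rfl fun i _ => ?_
      refine Finset.sum_congr rfl fun j _ => ?_
      ring
    simp_rw [this]
    have hint : ∀ i j : ℕ, Integrable (fun ω => K q h T (σ + i * h) (ρ + j * h) * (a i ω * b j ω)) μ :=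
      fun i j => (pr_int μ p q (a i) (b j)).const_mul _
    rw [integral_finsetSum _ (fun i _ => integrable_finsetSum _ fun j _ => hint i j)]
    refine Finset.sum_congr rfl fun i _ => ?_
    rw [integral_finsetSum _ fun j _ => hint i j]
    refine Finset.sum_congr rfl fun j _ => ?_
    rw [integral_const_mul]
  rw [e1]
  refine (enorm_integral_le_lintegral_enorm _).trans ?_
  have ma : ∀ i, AEMeasurable (fun ω => ‖a i ω‖ₑ) μ := fun i => (Lp.aestronglyMeasurable (a i)).enorm
  have mb : ∀ i, AEMeasurable (fun ω => ‖b i ω‖ₑ) μ := fun i => (Lp.aestronglyMeasurable (b i)).enorm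
  have na : ∀ i, ∫⁻ ω, ‖a i ω‖ₑ ^ P ∂μ = ‖a i‖ₑ ^ P := fun i => by
    rw [Lp.enorm_def, eLpNorm_eq_lintegral_rpow_enorm_toReal hp0 hp, ← ENNReal.rpow_mul]
    rw [← hP, one_div_mul_cancel hP0.ne', ENNReal.rpow_one]
  have nb : ∀ i, ∫⁻ ω, ‖b i ω‖ₑ ^ Q ∂μ = ‖b i‖ₑ ^ Q := fun i => by
    rw [Lp.enorm_def, eLpNorm_eq_lintegral_rpow_enorm_toReal hq0 hq, ← ENNReal.rpow_mul]
    rw [← hQ, one_div_mul_cancel hQ0.ne', ENNReal.rpow_one]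
  let u : Ω → ℝ≥0∞ := fun ω => (∑ i ∈ Finset.range M, ‖a i ω‖ₑ ^ P) ^ (1 / P)
  let v : Ω → ℝ≥0∞ := fun ω => (∑ i ∈ Finset.range M, ‖b i ω‖ₑ ^ Q) ^ (1 / Q)
  have mu : AEMeasurable u μ := (Finset.aemeasurable_fun_sum _ fun i _ => (ma i).pow_const _).pow_const _
  have mv : AEMeasurable v μ := (Finset.aemeasurable_fun_sum _ fun i _ => (mb i).pow_const _).pow_const _
  have hPQ : 1 / P + 1 / Q = 1 := by simpa using hc.inv_add_inv_eq_one
  calc _ ≤ ∫⁻ ω, (‖T‖ₑ * ENNReal.ofReal h) * (u * v) ω ∂μ := by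
        refine lintegral_mono fun ω => ?_
        have h1 := norm_sum_e p hp hh σ M (fun i => a i ω)
        have h2 := norm_sum_e q hq hh ρ M (fun i => b i ω)
        rw [ENNReal.mul_rpow_of_nonneg _ _ (by positivity)] at h1 h2
        have h3 := pr_le muplus p q (T (∑ i ∈ Finset.range M, a i ω • e p h (σ + i * h)))
          (∑ j ∈ Finset.range M, b j ω • e q h (ρ + j * h))
        have h3' : ‖pr muplus p q (T (∑ i ∈ Finset.range M, a i ω • e p h (σ + i * h)))
          (∑ j ∈ Finset.range M, b j ω • e q h (ρ + j * h))‖ₑ ≤ ‖T (∑ i ∈ Finset.range M, a i ω • e p h (σ + i * h))‖ₑ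
          * ‖∑ j ∈ Finset.range M, b j ω • e q h (ρ + j * h)‖ₑ := by
          rw [← ofReal_norm, ← ofReal_norm, ← ofReal_norm, ← ENNReal.ofReal_mul (norm_nonneg _)]
          exact ENNReal.ofReal_le_ofReal h3
        refine h3'.trans ?_
        calc _ ≤ (‖T‖ₑ * (ENNReal.ofReal h ^ (1 / P) * u ω)) * (ENNReal.ofReal h ^ (1 / Q) * v ω) := by
              gcongr
              exact (T.le_opENorm _).trans (by gcongr)
          _ = ‖T‖ₑ * (ENNReal.ofReal h ^ (1 / P) * ENNReal.ofReal h ^ (1 / Q)) * (u ω * v ω) := by ring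
          _ = _ := by
              rw [← ENNReal.rpow_add_of_nonneg _ _ (by positivity) (by positivity), hPQ, ENNReal.rpow_one]; rfl
    _ = (‖T‖ₑ * ENNReal.ofReal h) * ∫⁻ ω, (u * v) ω ∂μ := by
        rw [lintegral_const_mul'' _ (mu.mul mv)]
    _ ≤ (‖T‖ₑ * ENNReal.ofReal h) * ((∫⁻ ω, u ω ^ P ∂μ) ^ (1 / P) * (∫⁻ ω, v ω ^ Q ∂μ) ^ (1 / Q)) := by
        gcongr
        exact ENNReal.lintegral_mul_le_Lp_mul_Lq μ hc mu mv
    _ = _ := by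
        have e3 : ∫⁻ ω, u ω ^ P ∂μ = ∑ i ∈ Finset.range M, ‖a i‖ₑ ^ P := by
          simp_rw [← na]
          rw [← lintegral_finsetSum' _ fun i _ => (ma i).pow_const _]
          refine lintegral_congr fun ω => ?_
          simp only [u]
          rw [← ENNReal.rpow_mul, one_div_mul_cancel hP0.ne', ENNReal.rpow_one]
        have e4 : ∫⁻ ω, v ω ^ Q ∂μ = ∑ i ∈ Finset.range M, ‖b i‖ₑ ^ Q := by
          simp_rw [← nb]
          rw [← lintegral_finsetSum' _ fun i _ => (mb i).pow_const _]
          refine lintegral_congr fun ω => ?_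
          simp only [v]
          rw [← ENNReal.rpow_mul, one_div_mul_cancel hQ0.ne', ENNReal.rpow_one]
        rw [e3, e4]; ring
end Schur
end HankMult

namespace HankMult
open Filter Topology Set

section Grid

lemma muplus_prod : muplus.prod muplus = (volume : Measure (ℝ × ℝ)).restrict (Ioi 0 ×ˢ Ioi 0) := by
  unfold muplus
  rw [Measure.prod_restrict]; rfl

/-- the square -/
def sq (h : ℝ) (M : ℕ) : Set (ℝ × ℝ) := Ioc (0:ℝ) (M * h) ×ˢ Ioc (0:ℝ) (M * h)

lemma sq_meas (h : ℝ) (M : ℕ) : MeasurableSet (sq h M) := measurableSet_Ioc.prod measurableSet_Ioc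

/-- interval cells -/
def cell (h : ℝ) (i : ℕ) : Set ℝ := Ioc (i * h) (i * h + h)

lemma cell_disj {h : ℝ} (hh : 0 < h) {i j : ℕ} (hij : i ≠ j) : Disjoint (cell h i) (cell h j) := by
  rw [Set.disjoint_left]
  intro t hti htj
  rcases lt_or_gt_of_ne hij with hl | hl
  · have : (i:ℝ) + 1 ≤ j := by exact_mod_cast hl
    have := hti.2; have := htj.1
    nlinarith
  · have : (j:ℝ) + 1 ≤ i := by exact_mod_cast hl
    have := htj.2; have := hti.1
    nlinarith

lemma cell_union {h : ℝ} (hh : 0 < h) (M : ℕ) : Ioc (0:ℝ) (M * h) = ⋃ i ∈ Finset.range M, cell h i := by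
  induction M with
  | zero => simp
  | succ n ih =>
    rw [Finset.range_add_one, Finset.set_biUnion_insert, ← ih, cell, union_comm, Ioc_union_Ioc_eq_Ioc (by positivity) (by linarith)]
    congr 1; push_cast; ring

lemma cell_pre (h : ℝ) (i : ℕ) : (fun x : ℝ => x + i * h) ⁻¹' (cell h i) = Ioc 0 h := by
  ext x; simp [cell, add_comm]

lemma lint_grid {h : ℝ} (hh : 0 < h) (M : ℕ) (g : ℝ → ℝ≥0∞) (hg : Measurable g) :
    ∫⁻ σ in Ioc 0 h, ∑ i ∈ Finset.range M, g (σ + i * h) ≤ ∫⁻ s, g s ∂muplus := by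
  rw [lintegral_finsetSum _ (fun i _ => by fun_prop)]
  have : ∀ i : ℕ, ∫⁻ σ in Ioc 0 h, g (σ + i * h) = ∫⁻ s in cell h i, g s := by
    intro i
    rw [← cell_pre h i]
    exact (measurePreserving_add_right volume (i * h : ℝ)).setLIntegral_comp_preimage measurableSet_Ioc hg
  simp_rw [this]
  rw [← lintegral_biUnion_finset (fun i _ j _ hij => cell_disj hh hij) (fun _ _ => measurableSet_Ioc), ← cell_union hh]
  unfold muplus
  exact lintegral_mono_set Ioc_subset_Ioi_self

lemma int_grid {h : ℝ} (hh : 0 < h) (M : ℕ) (F : ℝ × ℝ → ℂ) (hF : IntegrableOn F (sq h M)) :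
    ∫ z in sq h M, F z = ∫ z in Ioc (0:ℝ) h ×ˢ Ioc (0:ℝ) h,
      ∑ i ∈ Finset.range M, ∑ j ∈ Finset.range M, F (z.1 + i * h, z.2 + j * h) := by
  have hu : sq h M = ⋃ k ∈ Finset.range M ×ˢ Finset.range M, cell h k.1 ×ˢ cell h k.2 := by
    ext ⟨x, y⟩
    simp only [sq, cell_union hh, mem_prod, mem_iUnion, Finset.mem_product, exists_prop, Prod.exists]
    constructor
    · rintro ⟨⟨i, hi, hx⟩, ⟨j, hj, hy⟩⟩; exact ⟨i, j, ⟨hi, hj⟩, hx, hy⟩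
    · rintro ⟨i, j, ⟨hi, hj⟩, hx, hy⟩; exact ⟨⟨i, hi, hx⟩, ⟨j, hj, hy⟩⟩
  have hm : ∀ k : ℕ × ℕ, MeasurableSet (cell h k.1 ×ˢ cell h k.2) := fun k => measurableSet_Ioc.prod measurableSet_Ioc
  have hsub : ∀ k ∈ Finset.range M ×ˢ Finset.range M, cell h k.1 ×ˢ cell h k.2 ⊆ sq h M := by
    intro k hk
    rw [hu]
    exact subset_biUnion_of_mem (u := fun k : ℕ × ℕ => cell h k.1 ×ˢ cell h k.2) hk
  have hpre : ∀ k : ℕ × ℕ, (fun z : ℝ × ℝ => z + (k.1 * h, k.2 * h)) ⁻¹' (cell h k.1 ×ˢ cell h k.2) = Ioc 0 h ×ˢ Ioc 0 h := by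
    intro k
    ext ⟨x, y⟩; simp [cell, add_comm]
  have hmp : ∀ k : ℕ × ℕ, MeasurePreserving (fun z : ℝ × ℝ => z + (k.1 * h, k.2 * h)) volume volume :=
    fun k => measurePreserving_add_right volume _
  have hme : ∀ k : ℕ × ℕ, MeasurableEmbedding (fun z : ℝ × ℝ => z + ((k.1 * h : ℝ), (k.2 * h : ℝ))) :=
    fun k => (MeasurableEquiv.addRight ((k.1 * h : ℝ), (k.2 * h : ℝ))).measurableEmbedding
  have hi : ∀ k ∈ Finset.range M ×ˢ Finset.range M,
      IntegrableOn (fun z : ℝ × ℝ => F (z + (k.1 * h, k.2 * h))) (Ioc (0:ℝ) h ×ˢ Ioc (0:ℝ) h) := by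
    intro k hk
    rw [← hpre k]
    exact ((hmp k).integrableOn_comp_preimage (hme k)).2 (hF.mono_set (hsub k hk))
  have hi' : ∀ i ∈ Finset.range M, ∀ j ∈ Finset.range M,
      IntegrableOn (fun z : ℝ × ℝ => F (z.1 + i * h, z.2 + j * h)) (Ioc (0:ℝ) h ×ˢ Ioc (0:ℝ) h) := by
    intro i hi1 j hj1
    exact hi (i, j) (Finset.mem_product.2 ⟨hi1, hj1⟩)
  rw [hu, integral_biUnion_finset _ (fun k _ => hm k) ?_ (fun k hk => hF.mono_set (hsub k hk)), Finset.sum_product,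
    integral_finsetSum _ (fun i hi => integrable_finsetSum _ fun j hj => hi' i hi j hj)]
  · refine Finset.sum_congr rfl fun i hi => ?_
    rw [integral_finsetSum _ fun j hj => hi' i hi j hj]
    refine Finset.sum_congr rfl fun j hj => ?_
    rw [← (hmp (i, j)).setIntegral_preimage_emb (hme (i, j)), hpre]
    rfl
  · rintro ⟨i, j⟩ _ ⟨i', j'⟩ _ hne
    simp only [Function.onFun]
    rw [Set.disjoint_prod]
    by_cases h1 : i = i'
    · right; exact cell_disj hh (fun h2 => hne (by simp [h1, h2]))
    · left; exact cell_disj hh h1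

end Grid

section JJ
variable {p q : ℝ≥0∞} [Fact (1 ≤ p)] [Fact (1 ≤ q)] [ENNReal.HolderConjugate p q]

/-- discretized form -/
noncomputable def J (q : ℝ≥0∞) [Fact (1 ≤ q)] [ENNReal.HolderConjugate p q]
    (h : ℝ) (M : ℕ) (T : Lp ℂ p muplus →L[ℂ] Lp ℂ p muplus) (κ : ℝ × ℝ → ℂ) : ℂ :=
  ((h:ℂ)⁻¹) ^ 2 * ∫ z in sq h M, K q h T z.1 z.2 * κ z

lemma Kint (hp : p ≠ ∞) (hq : q ≠ ∞) {h : ℝ} (hh : 0 ≤ h) (M : ℕ) (T : Lp ℂ p muplus →L[ℂ] Lp ℂ p muplus)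
    {κ : ℝ × ℝ → ℂ} (hκ : IntegrableOn κ (sq h M)) :
    IntegrableOn (fun z => K q h T z.1 z.2 * κ z) (sq h M) := by
  obtain ⟨C, hC⟩ := K_bdd hp hq hh T
  exact hκ.bdd_mul (K_cont hp hq h T).aestronglyMeasurable (Eventually.of_forall fun z => hC z.1 z.2)

lemma J_bound {Ω : Type*} [MeasurableSpace Ω] {μ : Measure Ω} (hp1 : 1 < p) (hp : p ≠ ∞) (hq : q ≠ ∞) {h : ℝ} (hh : 0 < h)
    (M : ℕ) (T : Lp ℂ p muplus →L[ℂ] Lp ℂ p muplus) (κ : ℝ × ℝ → ℂ) (hκ : IntegrableOn κ (sq h M))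
    (a : ℝ → Lp ℂ p μ) (b : ℝ → Lp ℂ q μ) (φ ψ : ℝ → ℝ≥0∞) (mφ : Measurable φ) (mψ : Measurable ψ)
    (ha : ∀ᵐ s ∂muplus, ‖a s‖ₑ ≤ φ s) (hb : ∀ᵐ s ∂muplus, ‖b s‖ₑ ≤ ψ s)
    (hab : ∀ᵐ z ∂(muplus.prod muplus), κ z = ∫ ω, a z.1 ω * b z.2 ω ∂μ) :
    ‖J q h M T κ‖ₑ ≤ ‖T‖ₑ * (∫⁻ s, φ s ^ p.toReal ∂muplus) ^ (1 / p.toReal)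
      * (∫⁻ s, ψ s ^ q.toReal ∂muplus) ^ (1 / q.toReal) := by
  have hc : p.toReal.HolderConjugate q.toReal := ENNReal.HolderConjugate.toReal (by
    rw [← ENNReal.toReal_one]; exact (ENNReal.toReal_lt_toReal (by simp) hp).2 hp1)
  set P := p.toReal with hP
  set Q := q.toReal with hQ
  have hP0 : 0 < P := hc.pos
  have hQ0 : 0 < Q := hc.symm.pos
  have hPQ : 1 / P + 1 / Q = 1 := by simpa using hc.inv_add_inv_eq_one
  have hQP : 1 / Q + 1 / P = 1 := by rw [add_comm]; exact hPQ
  let u : ℝ → ℝ≥0∞ := fun σ => (∑ i ∈ Finset.range M, φ (σ + i * h) ^ P) ^ (1 / P)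
  let v : ℝ → ℝ≥0∞ := fun σ => (∑ i ∈ Finset.range M, ψ (σ + i * h) ^ Q) ^ (1 / Q)
  have mu : Measurable u := by fun_prop
  have mv : Measurable v := by fun_prop
  have one_dim : ∀ (P Q : ℝ) (hc : P.HolderConjugate Q) (φ : ℝ → ℝ≥0∞) (mφ : Measurable φ),
      ∫⁻ σ in Ioc 0 h, (∑ i ∈ Finset.range M, φ (σ + i * h) ^ P) ^ (1 / P) ≤
        (∫⁻ s, φ s ^ P ∂muplus) ^ (1 / P) * ENNReal.ofReal h ^ (1 / Q) := by
    intro P Q hc φ mφ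
    have hP0 : 0 < P := hc.pos
    have h1 := ENNReal.lintegral_mul_le_Lp_mul_Lq (volume.restrict (Ioc 0 h)) hc
      (f := fun σ => (∑ i ∈ Finset.range M, φ (σ + i * h) ^ P) ^ (1 / P)) (g := fun _ => 1)
      (by fun_prop) (by fun_prop)
    simp only [Pi.mul_apply, mul_one, ENNReal.one_rpow, lintegral_const, Measure.restrict_apply_univ, Real.volume_Ioc, sub_zero, one_mul] at h1
    refine h1.trans ?_
    refine mul_le_mul' (ENNReal.rpow_le_rpow ?_ (by positivity)) le_rfl
    refine le_trans (le_of_eq ?_) (lint_grid hh M (fun s => φ s ^ P) (by fun_prop))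
    refine lintegral_congr fun σ => ?_
    rw [← ENNReal.rpow_mul, one_div_mul_cancel hP0.ne', ENNReal.rpow_one]
  have key : ‖∫ z in sq h M, K q h T z.1 z.2 * κ z‖ₑ ≤ ENNReal.ofReal h ^ 2 * (‖T‖ₑ * (∫⁻ s, φ s ^ P ∂muplus) ^ (1 / P)
      * (∫⁻ s, ψ s ^ Q ∂muplus) ^ (1 / Q)) := by
    rw [int_grid hh M _ (Kint hp hq hh.le M T hκ)]
    refine (enorm_integral_le_lintegral_enorm _).trans ?_
    have hae1 : ∀ᵐ z ∂(volume : Measure (ℝ × ℝ)), ∀ i j : ℕ, 0 < z.1 + i * h → 0 < z.2 + j * h →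
        κ (z.1 + i * h, z.2 + j * h) = ∫ ω, a (z.1 + i * h) ω * b (z.2 + j * h) ω ∂μ := by
      rw [muplus_prod, ae_restrict_iff' (measurableSet_Ioi.prod measurableSet_Ioi)] at hab
      refine ae_all_iff.2 fun i => ae_all_iff.2 fun j => ?_
      have := (measurePreserving_add_right (volume : Measure (ℝ × ℝ)) ((i * h : ℝ), (j * h : ℝ))).quasiMeasurePreserving.ae hab
      filter_upwards [this] with z hz h1 h2
      exact hz ⟨h1, h2⟩
    have hae2 : ∀ᵐ s : ℝ, ∀ i : ℕ, 0 < s + i * h → ‖a (s + i * h)‖ₑ ≤ φ (s + i * h) := by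
      unfold muplus at ha
      rw [ae_restrict_iff' measurableSet_Ioi] at ha
      refine ae_all_iff.2 fun i => ?_
      filter_upwards [(measurePreserving_add_right (volume : Measure ℝ) (i * h : ℝ)).quasiMeasurePreserving.ae ha] with z hz
      exact hz
    have hae3 : ∀ᵐ s : ℝ, ∀ i : ℕ, 0 < s + i * h → ‖b (s + i * h)‖ₑ ≤ ψ (s + i * h) := by
      unfold muplus at hb
      rw [ae_restrict_iff' measurableSet_Ioi] at hb
      refine ae_all_iff.2 fun i => ?_
      filter_upwards [(measurePreserving_add_right (volume : Measure ℝ) (i * h : ℝ)).quasiMeasurePreserving.ae hb] with z hz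
      exact hz
    have hae2' : ∀ᵐ z ∂(volume : Measure (ℝ × ℝ)), ∀ i : ℕ, 0 < z.1 + i * h → ‖a (z.1 + i * h)‖ₑ ≤ φ (z.1 + i * h) :=
      (Measure.quasiMeasurePreserving_fst (μ := (volume : Measure ℝ)) (ν := (volume : Measure ℝ))).ae hae2
    have hae3' : ∀ᵐ z ∂(volume : Measure (ℝ × ℝ)), ∀ i : ℕ, 0 < z.2 + i * h → ‖b (z.2 + i * h)‖ₑ ≤ ψ (z.2 + i * h) :=
      (Measure.quasiMeasurePreserving_snd (μ := (volume : Measure ℝ)) (ν := (volume : Measure ℝ))).ae hae3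
    calc _ ≤ ∫⁻ z in Ioc (0:ℝ) h ×ˢ Ioc (0:ℝ) h, (‖T‖ₑ * ENNReal.ofReal h) * (u z.1 * v z.2) := by
          refine lintegral_mono_ae ?_
          filter_upwards [ae_restrict_of_ae hae1, ae_restrict_of_ae hae2', ae_restrict_of_ae hae3',
            ae_restrict_mem (measurableSet_Ioc.prod measurableSet_Ioc)] with z h1 h2 h3 hz
          have p1 : ∀ i : ℕ, 0 < z.1 + i * h := fun i => by have := hz.1.1; positivity
          have p2 : ∀ i : ℕ, 0 < z.2 + i * h := fun i => by have := hz.2.1; positivity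
          simp only [h1 _ _ (p1 _) (p2 _)]
          refine (schur hp1 hp hq hh.le T z.1 z.2 M (fun i => a (z.1 + i * h)) (fun i => b (z.2 + i * h))).trans ?_
          rw [mul_assoc]
          simp only [u, v]
          gcongr with i _ i _
          · exact h2 i (p1 i)
          · exact h3 i (p2 i)
      _ = (‖T‖ₑ * ENNReal.ofReal h) * ((∫⁻ σ in Ioc 0 h, u σ) * ∫⁻ σ in Ioc 0 h, v σ) := by
          rw [lintegral_const_mul _ (by fun_prop)]
          congr 1
          rw [← lintegral_prod_mul mu.aemeasurable mv.aemeasurable, Measure.prod_restrict]; rfl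
      _ ≤ (‖T‖ₑ * ENNReal.ofReal h) * (((∫⁻ s, φ s ^ P ∂muplus) ^ (1 / P) * ENNReal.ofReal h ^ (1 / Q)) *
          ((∫⁻ s, ψ s ^ Q ∂muplus) ^ (1 / Q) * ENNReal.ofReal h ^ (1 / P))) := by
          gcongr
          · exact one_dim P Q hc φ mφ
          · exact one_dim Q P hc.symm ψ mψ
      _ = (ENNReal.ofReal h * (ENNReal.ofReal h ^ (1 / P) * ENNReal.ofReal h ^ (1 / Q))) * (‖T‖ₑ * (∫⁻ s, φ s ^ P ∂muplus) ^ (1 / P)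
      * (∫⁻ s, ψ s ^ Q ∂muplus) ^ (1 / Q)) := by ring
      _ = _ := by
          rw [← ENNReal.rpow_add_of_nonneg _ _ (by positivity) (by positivity), hPQ, ENNReal.rpow_one, pow_two]
  unfold J
  rw [enorm_mul, enorm_pow]
  calc _ ≤ ‖((h:ℂ)⁻¹)‖ₑ ^ 2 * (ENNReal.ofReal h ^ 2 * (‖T‖ₑ * (∫⁻ s, φ s ^ P ∂muplus) ^ (1 / P)
      * (∫⁻ s, ψ s ^ Q ∂muplus) ^ (1 / Q))) := by gcongr
    _ = _ := by
      have : ‖((h:ℂ)⁻¹)‖ₑ = (ENNReal.ofReal h)⁻¹ := by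
        rw [← ofReal_norm, norm_inv, Complex.norm_real, Real.norm_of_nonneg hh.le, ENNReal.ofReal_inv_of_pos hh]
      rw [this, ← mul_assoc, ← mul_pow, ENNReal.inv_mul_cancel (by simpa using hh) (by simp), one_pow, one_mul]
end JJ
end HankMult

namespace HankMult
open Filter Topology Set

section Lim
variable {p q : ℝ≥0∞} [Fact (1 ≤ p)] [Fact (1 ≤ q)] [ENNReal.HolderConjugate p q]

/-- step size -/
noncomputable def hn (n : ℕ) : ℝ := 1 / ((n:ℝ) + 1)
/-- number of cells -/
def Mn (n : ℕ) : ℕ := (n + 1) ^ 2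

lemma hn_pos (n : ℕ) : 0 < hn n := by unfold hn; positivity

lemma MnN (n : ℕ) : (Mn n : ℝ) * hn n = (n:ℝ) + 1 := by
  unfold Mn hn; push_cast; field_simp

lemma hn_tendsto : Tendsto hn atTop (𝓝[>] 0) := by
  refine tendsto_nhdsWithin_iff.2 ⟨?_, Eventually.of_forall fun n => hn_pos n⟩
  exact tendsto_one_div_add_atTop_nhds_zero_nat

lemma sq_n (n : ℕ) : sq (hn n) (Mn n) = Ioc (0:ℝ) (n + 1) ×ˢ Ioc (0:ℝ) (n + 1) := by
  rw [sq, MnN]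

/-- averaged approximations of `E` -/
noncomputable def av (p : ℝ≥0∞) [Fact (1 ≤ p)] (n : ℕ) (x : ℝ) : Lp ℂ p muplus :=
  ((hn n : ℂ)⁻¹) • ∫ s in Ioc (0:ℝ) (min (n + 1) x), e p (hn n) s

lemma av_tendsto (hp : p ≠ ∞) (x : ℝ) : Tendsto (fun n => av p n x) atTop (𝓝 (E p x)) := by
  rcases le_or_gt x 0 with hx | hx
  · rw [E_nonpos p hx]
    have : ∀ n, av p n x = 0 := by
      intro n
      rw [av, Ioc_eq_empty (by simp [hx]), setIntegral_empty, smul_zero]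
    simp [this]
  · have hc := E_cont p hp
    let Φ : ℝ → Lp ℂ p muplus := fun x => ∫ s in (0:ℝ)..x, E p s
    have hi : ∀ a b, IntervalIntegrable (E p) volume a b := fun a b => hc.intervalIntegrable a b
    have hΦ : ∀ y, Tendsto (fun n => (hn n)⁻¹ • (Φ (y + hn n) - Φ y)) atTop (𝓝 (E p y)) := by
      intro y
      have : HasDerivAt Φ (E p y) y := intervalIntegral.integral_hasDerivAt_right (hi 0 y)
        (hc.stronglyMeasurableAtFilter _ _) hc.continuousAt
      exact (this.tendsto_slope_zero_right).comp hn_tendsto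
    have h1 := (hΦ x).sub (hΦ 0)
    rw [E_nonpos p le_rfl, sub_zero] at h1
    refine h1.congr' ?_
    filter_upwards [eventually_ge_atTop ⌈x⌉₊] with n hn1
    have : x ≤ (n:ℝ) + 1 := (Nat.ceil_le.1 hn1).trans (by linarith)
    rw [av, min_eq_right this, ← intervalIntegral.integral_of_le hx.le]
    unfold e
    have hi2 : IntervalIntegrable (fun s => E p (s + hn n)) volume 0 x :=
      (hc.comp (continuous_add_const _)).intervalIntegrable _ _
    rw [intervalIntegral.integral_sub hi2 (hi _ _),
      intervalIntegral.integral_comp_add_right (fun s => E p s)]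
    have e1 : ∫ s in (0 + hn n)..(x + hn n), E p s = Φ (x + hn n) - Φ (0 + hn n) := by
      rw [eq_sub_iff_add_eq, add_comm]
      exact intervalIntegral.integral_add_adjacent_intervals (hi _ _) (hi _ _)
    have e2 : Φ 0 = 0 := intervalIntegral.integral_same
    rw [e1, e2, sub_zero, ← smul_sub, ← Complex.ofReal_inv, Complex.coe_smul]
    congr 1
    simp only [Φ]
    abel

lemma J_rect (hp : p ≠ ∞) (hq : q ≠ ∞) (n : ℕ) (T : Lp ℂ p muplus →L[ℂ] Lp ℂ p muplus) (x y : ℝ) :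
    J q (hn n) (Mn n) T ((Iic x ×ˢ Iic y).indicator fun _ => 1) = pr muplus p q (T (av p n x)) (av q n y) := by
  unfold J
  have h1 : ∀ z : ℝ × ℝ, K q (hn n) T z.1 z.2 * (Iic x ×ˢ Iic y).indicator (fun _ => 1) z =
      (Iic x ×ˢ Iic y).indicator (fun z => K q (hn n) T z.1 z.2) z := by
    intro z; by_cases h : z ∈ Iic x ×ˢ Iic y <;> simp only [h, indicator_of_mem, indicator_of_notMem, mul_one, mul_zero, not_false_eq_true]
  simp_rw [h1]
  rw [setIntegral_indicator (measurableSet_Iic.prod measurableSet_Iic), sq_n, prod_inter_prod, Ioc_inter_Iic, Ioc_inter_Iic]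
  have hb := K_bdd hp hq (hn_pos n).le T
  obtain ⟨C, hC⟩ := hb
  have ip : ∀ a b, IntegrableOn (e p (hn n)) (Ioc a b) := fun a b => (e_cont p hp _).integrableOn_Ioc
  have iq : ∀ a b, IntegrableOn (e q (hn n)) (Ioc a b) := fun a b => (e_cont q hq _).integrableOn_Ioc
  rw [Measure.volume_eq_prod, setIntegral_prod]
  · simp only [K]
    have e1 : ∀ s, ∫ t in Ioc (0:ℝ) (min (n + 1) y), pr muplus p q (T (e p (hn n) s)) (e q (hn n) t) =
      (((pr muplus p q).flip (∫ t in Ioc (0:ℝ) (min (n + 1) y), e q (hn n) t)).comp T) (e p (hn n) s) := by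
      intro s
      rw [ContinuousLinearMap.integral_comp_comm _ (iq _ _)]; simp
    simp_rw [e1]
    rw [ContinuousLinearMap.integral_comp_comm _ (ip _ _)]
    simp only [av, map_smul, FunLike.coe_smul, Pi.smul_apply, ContinuousLinearMap.comp_apply, ContinuousLinearMap.flip_apply, smul_eq_mul]
    ring
  · refine Measure.integrableOn_of_bounded (M := C) ?_ (K_cont hp hq _ T).aestronglyMeasurable (Eventually.of_forall fun z => hC z.1 z.2)
    rw [Measure.prod_prod]
    exact ENNReal.mul_ne_top (by simp) (by simp)

lemma J_rect_tendsto (hp : p ≠ ∞) (hq : q ≠ ∞) (T : Lp ℂ p muplus →L[ℂ] Lp ℂ p muplus) (x y : ℝ) :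
    Tendsto (fun n => J q (hn n) (Mn n) T ((Iic x ×ˢ Iic y).indicator fun _ => 1)) atTop
      (𝓝 (pr muplus p q (T (E p x)) (E q y))) := by
  simp_rw [J_rect hp hq]
  have h1 := av_tendsto (p := p) hp x
  have h2 := av_tendsto (p := q) hq y
  have h3 : Tendsto (fun n => pr muplus p q (T (av p n x))) atTop (𝓝 (pr muplus p q (T (E p x)))) := (((pr muplus p q).comp T).continuous.tendsto (E p x)).comp h1
  exact (isBoundedBilinearMap_apply (𝕜 := ℂ) (E := Lp ℂ q muplus) (F := ℂ)).continuous.tendsto (pr muplus p q (T (E p x)), E q y) |>.comp (h3.prodMk_nhds h2)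

end Lim
end HankMult

namespace HankMult
open Filter Topology Set
set_option linter.unusedSectionVars false

section JLin
variable {p q : ℝ≥0∞} [Fact (1 ≤ p)] [Fact (1 ≤ q)] [ENNReal.HolderConjugate p q]

lemma bil_tendsto {V W ι : Type*} [NormedAddCommGroup V] [NormedSpace ℂ V] [NormedAddCommGroup W] [NormedSpace ℂ W]
    {l : Filter ι} (B : V →L[ℂ] W →L[ℂ] ℂ) {f : ι → V} {g : ι → W}
    {a : V} {b : W} (hf : Tendsto f l (𝓝 a)) (hg : Tendsto g l (𝓝 b)) :
    Tendsto (fun i => B (f i) (g i)) l (𝓝 (B a b)) := by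
  have h1 : Continuous fun z : V × W => B z.1 z.2 := by fun_prop
  exact (h1.tendsto (a, b)).comp (hf.prodMk_nhds hg)

lemma pr_tendsto {X ι : Type*} [MeasurableSpace X] {μ : Measure X} {l : Filter ι} {f : ι → Lp ℂ p μ} {g : ι → Lp ℂ q μ}
    {a : Lp ℂ p μ} {b : Lp ℂ q μ} (hf : Tendsto f l (𝓝 a)) (hg : Tendsto g l (𝓝 b)) :
    Tendsto (fun i => pr μ p q (f i) (g i)) l (𝓝 (pr μ p q a b)) := bil_tendsto _ hf hg

lemma sq_ae {h : ℝ} {M : ℕ} {P : ℝ × ℝ → Prop} (hP : ∀ᵐ z ∂(muplus.prod muplus), P z) :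
    ∀ᵐ z ∂(volume.restrict (sq h M)), P z := by
  rw [muplus_prod] at hP
  refine ae_restrict_of_ae_restrict_of_subset ?_ hP
  exact Set.prod_mono Ioc_subset_Ioi_self Ioc_subset_Ioi_self

lemma J_congr {h : ℝ} {M : ℕ} {T : Lp ℂ p muplus →L[ℂ] Lp ℂ p muplus} {κ κ' : ℝ × ℝ → ℂ}
    (hk : κ =ᵐ[muplus.prod muplus] κ') : J q h M T κ = J q h M T κ' := by
  unfold J
  congr 1
  refine integral_congr_ae ?_
  filter_upwards [sq_ae hk] with z hz
  rw [hz]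

lemma J_add (hp : p ≠ ∞) (hq : q ≠ ∞) {h : ℝ} (hh : 0 ≤ h) {M : ℕ} {T : Lp ℂ p muplus →L[ℂ] Lp ℂ p muplus} {κ κ' : ℝ × ℝ → ℂ}
    (i1 : IntegrableOn κ (sq h M)) (i2 : IntegrableOn κ' (sq h M)) :
    J q h M T (fun z => κ z + κ' z) = J q h M T κ + J q h M T κ' := by
  unfold J
  rw [← mul_add, ← integral_add (Kint hp hq hh M T i1) (Kint hp hq hh M T i2)]
  simp_rw [mul_add]

lemma J_smul {h : ℝ} {M : ℕ} {T : Lp ℂ p muplus →L[ℂ] Lp ℂ p muplus} {κ : ℝ × ℝ → ℂ} (c : ℂ) :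
    J q h M T (fun z => c * κ z) = c * J q h M T κ := by
  unfold J
  rw [mul_left_comm c, ← integral_const_mul c]
  congr 1
  refine integral_congr_ae (Eventually.of_forall fun z => ?_)
  show K q h T z.1 z.2 * (c * κ z) = c * (K q h T z.1 z.2 * κ z)
  ring

lemma J_addT (hp : p ≠ ∞) (hq : q ≠ ∞) {h : ℝ} (hh : 0 ≤ h) {M : ℕ} {T T' : Lp ℂ p muplus →L[ℂ] Lp ℂ p muplus} {κ : ℝ × ℝ → ℂ}
    (i1 : IntegrableOn κ (sq h M)) :
    J q h M (T + T') κ = J q h M T κ + J q h M T' κ := by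
  unfold J
  rw [← mul_add, ← integral_add (Kint hp hq hh M T i1) (Kint hp hq hh M T' i1)]
  simp [K, add_mul]

lemma J_smulT {h : ℝ} {M : ℕ} {T : Lp ℂ p muplus →L[ℂ] Lp ℂ p muplus} {κ : ℝ × ℝ → ℂ} (c : ℂ) :
    J q h M (c • T) κ = c * J q h M T κ := by
  unfold J
  rw [mul_left_comm c, ← integral_const_mul c]
  congr 1
  refine integral_congr_ae (Eventually.of_forall fun z => ?_)
  show K q h (c • T) z.1 z.2 * κ z = c * (K q h T z.1 z.2 * κ z)
  simp [K]; ring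

lemma lint_Ioc {P : ℝ} (hP : 1 ≤ P) {φ : ℝ → ℝ≥0∞} (hφ : ∫⁻ s, φ s ^ P ∂muplus ≠ ∞) (N : ℝ) :
    ∫⁻ s in Ioc 0 N, φ s ≠ ∞ := by
  refine ne_top_of_le_ne_top (b := ∫⁻ s in Ioc 0 N, 1 + φ s ^ P) ?_ (lintegral_mono fun s => ?_)
  · rw [lintegral_add_left measurable_const]
    refine ENNReal.add_ne_top.2 ⟨by simp, ne_top_of_le_ne_top hφ ?_⟩
    unfold muplus
    exact lintegral_mono_set Ioc_subset_Ioi_self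
  · rcases le_total (φ s) 1 with h1 | h1
    · exact h1.trans le_self_add
    · refine le_trans ?_ le_add_self
      calc φ s = φ s ^ (1:ℝ) := (ENNReal.rpow_one _).symm
        _ ≤ _ := ENNReal.rpow_le_rpow_of_exponent_le h1 hP

lemma kint {P Q : ℝ} (hP : 1 ≤ P) (hQ : 1 ≤ Q) {φ ψ : ℝ → ℝ≥0∞} (mφ : AEMeasurable φ) (mψ : AEMeasurable ψ)
    (hφ : ∫⁻ s, φ s ^ P ∂muplus ≠ ∞) (hψ : ∫⁻ s, ψ s ^ Q ∂muplus ≠ ∞) (h : ℝ) (M : ℕ) {κ : ℝ × ℝ → ℂ}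
    (mκ : AEStronglyMeasurable κ (muplus.prod muplus))
    (hκ : ∀ᵐ z ∂(muplus.prod muplus), ‖κ z‖ₑ ≤ φ z.1 * ψ z.2) : IntegrableOn κ (sq h M) := by
  refine ⟨?_, ?_⟩
  · rw [muplus_prod] at mκ
    exact mκ.mono_measure (Measure.restrict_mono (Set.prod_mono Ioc_subset_Ioi_self Ioc_subset_Ioi_self) le_rfl)
  · rw [HasFiniteIntegral]
    refine lt_of_le_of_lt (lintegral_mono_ae (sq_ae hκ)) ?_
    have : (volume : Measure (ℝ × ℝ)).restrict (sq h M) = (volume.restrict (Ioc (0:ℝ) (M * h))).prod (volume.restrict (Ioc (0:ℝ) (M * h))) := by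
      rw [Measure.prod_restrict]; rfl
    rw [this, lintegral_prod_mul mφ.restrict mψ.restrict]
    exact ENNReal.mul_lt_top (lint_Ioc hP hφ _).lt_top (lint_Ioc hQ hψ _).lt_top

end JLin

section Kap
variable {p q : ℝ≥0∞} [Fact (1 ≤ p)] [Fact (1 ≤ q)] [ENNReal.HolderConjugate p q]
variable {Ω : Type*} [MeasurableSpace Ω] {μ : Measure Ω} [SigmaFinite μ]

/-- norm of sections -/
noncomputable def ph (p : ℝ≥0∞) (μ : Measure Ω) (F : ℝ × Ω → ℂ) (s : ℝ) : ℝ≥0∞ := eLpNorm (fun ω => F (s, ω)) p μ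

lemma p_ne0 (p : ℝ≥0∞) [Fact (1 ≤ p)] : p ≠ 0 := (one_pos.trans_le (Fact.out : 1 ≤ p)).ne'

lemma p_real_pos (hp : p ≠ ∞) : 0 < p.toReal := ENNReal.toReal_pos (p_ne0 p) hp

lemma one_le_real (hp : p ≠ ∞) : 1 ≤ p.toReal := by
  rw [← ENNReal.toReal_one]; exact (ENNReal.toReal_le_toReal (by simp) hp).2 Fact.out

lemma ph_eq (hp : p ≠ ∞) (F : ℝ × Ω → ℂ) (s : ℝ) : ph p μ F s ^ p.toReal = ∫⁻ ω, ‖F (s, ω)‖ₑ ^ p.toReal ∂μ := by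
  rw [ph, eLpNorm_eq_lintegral_rpow_enorm_toReal (p_ne0 p) hp, ← ENNReal.rpow_mul, one_div_mul_cancel (p_real_pos hp).ne', ENNReal.rpow_one]

lemma ph_meas (hp : p ≠ ∞) (F : Lp ℂ p (muplus.prod μ)) : Measurable (ph p μ F) := by
  have : ph p μ F = fun s => (∫⁻ ω, ‖F (s, ω)‖ₑ ^ p.toReal ∂μ) ^ (1 / p.toReal) := by
    ext s
    rw [ph, eLpNorm_eq_lintegral_rpow_enorm_toReal (p_ne0 p) hp]
  rw [this]
  have h1 : Measurable fun z : ℝ × Ω => ‖F z‖ₑ ^ p.toReal := (Lp.stronglyMeasurable F).measurable.enorm.pow_const _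
  exact (Measurable.lintegral_prod_right' h1).pow_const _

lemma ph_int (hp : p ≠ ∞) (F : Lp ℂ p (muplus.prod μ)) : (∫⁻ s, ph p μ F s ^ p.toReal ∂muplus) ^ (1 / p.toReal) = ‖F‖ₑ := by
  simp_rw [ph_eq hp]
  have h1 : Measurable fun z : ℝ × Ω => ‖F z‖ₑ ^ p.toReal := (Lp.stronglyMeasurable F).measurable.enorm.pow_const _
  rw [← lintegral_prod _ h1.aemeasurable, Lp.enorm_def, eLpNorm_eq_lintegral_rpow_enorm_toReal (p_ne0 p) hp]

lemma ph_fin' (hp : p ≠ ∞) (F : Lp ℂ p (muplus.prod μ)) : ∫⁻ s, ph p μ F s ^ p.toReal ∂muplus ≠ ∞ := by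
  intro h
  have := ph_int hp F
  rw [h, ENNReal.top_rpow_of_pos (by have := p_real_pos hp; positivity)] at this
  exact enorm_ne_top this.symm

lemma ph_fin (hp : p ≠ ∞) (F : Lp ℂ p (muplus.prod μ)) : ∀ᵐ s ∂muplus, MemLp (fun ω => F (s, ω)) p μ := by
  filter_upwards [ae_lt_top ((ph_meas hp F).pow_const p.toReal) (ph_fin' hp F)] with s hs
  refine ⟨((Lp.stronglyMeasurable F).comp_measurable measurable_prodMk_left).aestronglyMeasurable, ?_⟩
  exact (ENNReal.rpow_lt_top_iff_of_pos (p_real_pos hp)).1 hs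

open Classical in
/-- sections as `Lp` elements -/
noncomputable def sec (p : ℝ≥0∞) (μ : Measure Ω) (F : ℝ × Ω → ℂ) (s : ℝ) : Lp ℂ p μ :=
  if h : MemLp (fun ω => F (s, ω)) p μ then h.toLp _ else 0

lemma sec_le (F : ℝ × Ω → ℂ) (s : ℝ) : ‖sec p μ F s‖ₑ ≤ ph p μ F s := by
  unfold sec
  split_ifs with h
  · rw [Lp.enorm_toLp]; rfl
  · simp

lemma sec_coe {F : ℝ × Ω → ℂ} {s : ℝ} (h : MemLp (fun ω => F (s, ω)) p μ) : sec p μ F s =ᵐ[μ] fun ω => F (s, ω) := by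
  rw [sec, dif_pos h]; exact h.coeFn_toLp

/-- the kernel -/
noncomputable def kap (μ : Measure Ω) (F G : ℝ × Ω → ℂ) (z : ℝ × ℝ) : ℂ := ∫ ω, F (z.1, ω) * G (z.2, ω) ∂μ

lemma ae_fst {P : ℝ → Prop} (h : ∀ᵐ s ∂muplus, P s) : ∀ᵐ z ∂(muplus.prod muplus), P z.1 :=
  Measure.quasiMeasurePreserving_fst.ae h
lemma ae_snd {P : ℝ → Prop} (h : ∀ᵐ s ∂muplus, P s) : ∀ᵐ z ∂(muplus.prod muplus), P z.2 :=
  Measure.quasiMeasurePreserving_snd.ae h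

lemma kap_sec (hp : p ≠ ∞) (hq : q ≠ ∞) (F : Lp ℂ p (muplus.prod μ)) (G : Lp ℂ q (muplus.prod μ)) :
    ∀ᵐ z ∂(muplus.prod muplus), kap μ F G z = ∫ ω, sec p μ F z.1 ω * sec q μ G z.2 ω ∂μ := by
  filter_upwards [ae_fst (ph_fin hp F), ae_snd (ph_fin hq G)] with z h1 h2
  refine integral_congr_ae ?_
  filter_upwards [sec_coe h1, sec_coe h2] with ω h3 h4
  rw [h3, h4]

lemma enorm_pr_le {X : Type*} [MeasurableSpace X] (μ : Measure X) (a : Lp ℂ p μ) (b : Lp ℂ q μ) :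
    ‖∫ ω, a ω * b ω ∂μ‖ₑ ≤ ‖a‖ₑ * ‖b‖ₑ := by
  rw [← pr_eq, ← ofReal_norm, ← ofReal_norm, ← ofReal_norm, ← ENNReal.ofReal_mul (norm_nonneg _)]
  exact ENNReal.ofReal_le_ofReal (pr_le _ _ _ _ _)

lemma kap_int (hp : p ≠ ∞) (hq : q ≠ ∞) (F : Lp ℂ p (muplus.prod μ)) (G : Lp ℂ q (muplus.prod μ)) (h : ℝ) (M : ℕ) :
    IntegrableOn (kap μ F G) (sq h M) := by
  refine kint (one_le_real hp) (one_le_real hq) (ph_meas hp F).aemeasurable (ph_meas hq G).aemeasurable (ph_fin' hp F) (ph_fin' hq G) h M ?_ ?_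
  · have hF := Lp.stronglyMeasurable F
    have hG := Lp.stronglyMeasurable G
    have : StronglyMeasurable fun y : (ℝ × ℝ) × Ω => F (y.1.1, y.2) * G (y.1.2, y.2) :=
      (hF.comp_measurable (by fun_prop)).mul (hG.comp_measurable (by fun_prop))
    exact (this.integral_prod_right').aestronglyMeasurable
  · filter_upwards [kap_sec hp hq F G] with z hz
    rw [hz]
    refine (enorm_pr_le _ _ _).trans ?_
    gcongr <;> exact sec_le _ _

lemma Jkap_le (hp1 : 1 < p) (hp : p ≠ ∞) (hq : q ≠ ∞) {h : ℝ} (hh : 0 < h) (M : ℕ) (T : Lp ℂ p muplus →L[ℂ] Lp ℂ p muplus)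
    (F : Lp ℂ p (muplus.prod μ)) (G : Lp ℂ q (muplus.prod μ)) :
    ‖J q h M T (kap μ F G)‖ ≤ ‖T‖ * ‖F‖ * ‖G‖ := by
  have := J_bound hp1 hp hq hh M T (kap μ F G) (kap_int hp hq F G h M) (sec p μ F) (sec q μ G) (ph p μ F) (ph q μ G)
    (ph_meas hp F) (ph_meas hq G) (Eventually.of_forall fun s => sec_le _ _) (Eventually.of_forall fun s => sec_le _ _) (kap_sec hp hq F G)
  rw [ph_int hp, ph_int hq] at this
  rw [← ofReal_norm, ← ofReal_norm, ← ofReal_norm, ← ofReal_norm, ← ENNReal.ofReal_mul (norm_nonneg _), ← ENNReal.ofReal_mul (by positivity)] at this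
  exact (ENNReal.ofReal_le_ofReal_iff (by positivity)).1 this

lemma kap_congr {F F' G G' : ℝ × Ω → ℂ} (hF : F =ᵐ[muplus.prod μ] F') (hG : G =ᵐ[muplus.prod μ] G') :
    kap μ F G =ᵐ[muplus.prod muplus] kap μ F' G' := by
  filter_upwards [ae_fst (Measure.ae_ae_of_ae_prod hF), ae_snd (Measure.ae_ae_of_ae_prod hG)] with z h1 h2
  refine integral_congr_ae ?_
  filter_upwards [h1, h2] with ω h3 h4
  rw [h3, h4]

lemma kap_add_left (hp : p ≠ ∞) (hq : q ≠ ∞) (F F' : Lp ℂ p (muplus.prod μ)) (G : Lp ℂ q (muplus.prod μ)) :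
    kap μ (F + F' : Lp ℂ p (muplus.prod μ)) G =ᵐ[muplus.prod muplus] fun z => kap μ F G z + kap μ F' G z := by
  refine (kap_congr (Lp.coeFn_add F F') (ae_eq_refl _)).trans ?_
  filter_upwards [ae_fst (ph_fin hp F), ae_fst (ph_fin hp F'), ae_snd (ph_fin hq G)] with z h1 h2 h3
  unfold kap
  simp only [Pi.add_apply, add_mul]
  exact integral_add (h1.integrable_mul h3) (h2.integrable_mul h3)

lemma kap_add_right (hp : p ≠ ∞) (hq : q ≠ ∞) (F : Lp ℂ p (muplus.prod μ)) (G G' : Lp ℂ q (muplus.prod μ)) :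
    kap μ F (G + G' : Lp ℂ q (muplus.prod μ)) =ᵐ[muplus.prod muplus] fun z => kap μ F G z + kap μ F G' z := by
  refine (kap_congr (ae_eq_refl _) (Lp.coeFn_add G G')).trans ?_
  filter_upwards [ae_fst (ph_fin hp F), ae_snd (ph_fin hq G'), ae_snd (ph_fin hq G)] with z h1 h2 h3
  unfold kap
  simp only [Pi.add_apply, mul_add]
  exact integral_add (h1.integrable_mul h3) (h1.integrable_mul h2)

lemma kap_smul_left (c : ℂ) (F : Lp ℂ p (muplus.prod μ)) (G : Lp ℂ q (muplus.prod μ)) :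
    kap μ (c • F : Lp ℂ p (muplus.prod μ)) G =ᵐ[muplus.prod muplus] fun z => c * kap μ F G z := by
  refine (kap_congr (Lp.coeFn_smul c F) (ae_eq_refl _)).trans ?_
  refine Eventually.of_forall fun z => ?_
  simp only [kap, Pi.smul_apply, smul_eq_mul, mul_assoc, integral_const_mul]

lemma kap_smul_right (c : ℂ) (F : Lp ℂ p (muplus.prod μ)) (G : Lp ℂ q (muplus.prod μ)) :
    kap μ F (c • G : Lp ℂ q (muplus.prod μ)) =ᵐ[muplus.prod muplus] fun z => c * kap μ F G z := by
  refine (kap_congr (ae_eq_refl _) (Lp.coeFn_smul c G)).trans ?_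
  refine Eventually.of_forall fun z => ?_
  simp only [kap, Pi.smul_apply, smul_eq_mul, mul_left_comm, integral_const_mul]

/-- `C_n` -/
noncomputable def Cn (hp : p ≠ ∞) (hq : q ≠ ∞) (T : Lp ℂ p muplus →L[ℂ] Lp ℂ p muplus) (μ : Measure Ω) [SigmaFinite μ] (n : ℕ) :
    Lp ℂ p (muplus.prod μ) →ₗ[ℂ] Lp ℂ q (muplus.prod μ) →ₗ[ℂ] ℂ :=
  LinearMap.mk₂ ℂ (fun F G => J q (hn n) (Mn n) T (kap μ F G))
    (fun F F' G => by
      rw [J_congr (kap_add_left hp hq F F' G), J_add hp hq (hn_pos n).le (kap_int hp hq _ _ _ _) (kap_int hp hq _ _ _ _)])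
    (fun c F G => by rw [J_congr (kap_smul_left c F G), J_smul, smul_eq_mul])
    (fun F G G' => by
      rw [J_congr (kap_add_right hp hq F G G'), J_add hp hq (hn_pos n).le (kap_int hp hq _ _ _ _) (kap_int hp hq _ _ _ _)])
    (fun c F G => by rw [J_congr (kap_smul_right c F G), J_smul, smul_eq_mul])

/-- closed submodule of convergence -/
lemma conv_sub {V : Type*} [NormedAddCommGroup V] [NormedSpace ℂ V] (l : Filter ℕ) (L : ℕ → V →ₗ[ℂ] ℂ) (L0 : V →L[ℂ] ℂ) (c : ℝ)
    (hL : ∀ n v, ‖L n v‖ ≤ c * ‖v‖) : ∃ M : Submodule ℂ V, IsClosed (M : Set V) ∧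
      ∀ v, v ∈ M ↔ Tendsto (fun n => L n v) l (𝓝 (L0 v)) := by
  let M : Submodule ℂ V :=
    { carrier := {v | Tendsto (fun n => L n v) l (𝓝 (L0 v))}
      add_mem' := by
        intro a b ha hb
        have := Tendsto.add (f := fun n => L n a) (g := fun n => L n b) ha hb
        show Tendsto _ _ _
        simpa only [map_add] using this
      zero_mem' := by
        show Tendsto _ _ _
        simp only [map_zero]; exact tendsto_const_nhds
      smul_mem' := by
        intro a v hv
        have := Tendsto.const_smul (f := fun n => L n v) hv a
        show Tendsto _ _ _
        simpa only [map_smul] using this }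
  refine ⟨M, ?_, fun v => Iff.rfl⟩
  rw [← closure_subset_iff_isClosed]
  intro v hv
  show Tendsto _ _ _
  rw [Metric.tendsto_nhds]
  intro ε hε
  obtain ⟨w, hw, hd⟩ := Metric.mem_closure_iff.1 hv (ε / (2 * (|c| + ‖L0‖ + 1))) (by positivity)
  have hw' : Tendsto (fun n => L n w) l (𝓝 (L0 w)) := hw
  filter_upwards [Metric.tendsto_nhds.1 hw' (ε / 2) (by positivity)] with n hn
  rw [dist_eq_norm] at hn hd ⊢
  have e1 : L n v - L0 v = L n (v - w) + (L n w - L0 w) - L0 (v - w) := by simp only [map_sub]; ring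
  rw [e1]
  have b1 : ‖L n (v - w)‖ ≤ |c| * ‖v - w‖ := (hL n _).trans (by gcongr; exact le_abs_self c)
  have b2 := L0.le_opNorm (v - w)
  have b3 : (|c| + ‖L0‖) * ‖v - w‖ ≤ ε / 2 := by
    rw [lt_div_iff₀ (by positivity)] at hd
    nlinarith [norm_nonneg (v - w)]
  calc _ ≤ ‖L n (v - w)‖ + ‖L n w - L0 w‖ + ‖L0 (v - w)‖ := (norm_sub_le _ _).trans (by gcongr; exact norm_add_le _ _)
    _ < ε := by linarith

end Kap
end HankMult

namespace HankMult
open Filter Topology Set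

section Dense
variable {p q : ℝ≥0∞} [Fact (1 ≤ p)] [Fact (1 ≤ q)] [ENNReal.HolderConjugate p q]
variable {Ω : Type*} [MeasurableSpace Ω] {μ : Measure Ω} [SigmaFinite μ]

lemma gen_Iic : (inferInstance : MeasurableSpace ℝ) = MeasurableSpace.generateFrom (range Iic) := by
  rw [← borel_eq_generateFrom_Iic]
  exact BorelSpace.measurable_eq

lemma iUnion_Iic_nat' : ⋃ k : ℕ, Iic (k:ℝ) = univ := by
  refine eq_univ_of_forall fun x => ?_
  obtain ⟨k, hk⟩ := exists_nat_ge x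
  exact mem_iUnion.2 ⟨k, hk⟩

lemma dense1 (hp : p ≠ ∞) (M : Submodule ℂ (Lp ℂ p muplus)) (hM : IsClosed (M : Set (Lp ℂ p muplus)))
    (h : ∀ x, E p x ∈ M) (f : Lp ℂ p muplus) : f ∈ M := by
  have key : ∀ x, ∀ u : Lp ℂ p muplus, (u : ℝ → ℂ) =ᵐ[muplus] (Iic x).indicator (fun _ => 1) → u ∈ M := by
    intro x u hu
    have : u = E p x := Lp.ext (hu.trans (E_coe p x).symm)
    rw [this]; exact h x
  refine dense_lemma hp (range Iic) gen_Iic isPiSystem_Iic (fun k : ℕ => Iic (k:ℝ)) (fun _ => measurableSet_Iic)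
    (fun a b hab => Iic_subset_Iic.2 (by exact_mod_cast hab)) iUnion_Iic_nat' (fun _ => muplus_Iic _) M hM (fun k u => key k u) ?_ f
  rintro _ ⟨x, rfl⟩ k u
  rw [Iic_inter_Iic]
  exact key _ u

lemma dense2 (hp : p ≠ ∞) (M : Submodule ℂ (Lp ℂ p (muplus.prod μ))) (hM : IsClosed (M : Set (Lp ℂ p (muplus.prod μ))))
    (h : ∀ x D, MeasurableSet D → μ D ≠ ∞ → ∀ u : Lp ℂ p (muplus.prod μ),
      (u : ℝ × Ω → ℂ) =ᵐ[muplus.prod μ] (Iic x ×ˢ D).indicator (fun _ => 1) → u ∈ M) (f : Lp ℂ p (muplus.prod μ)) : f ∈ M := by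
  have hsp : ∀ k, μ (spanningSets μ k) ≠ ∞ := fun k => (measure_spanningSets_lt_top μ k).ne
  refine dense_lemma hp (image2 (· ×ˢ ·) (range Iic) {D | MeasurableSet D}) ?_ (isPiSystem_Iic.prod MeasurableSpace.isPiSystem_measurableSet)
    (fun k : ℕ => Iic (k:ℝ) ×ˢ spanningSets μ k) (fun k => measurableSet_Iic.prod (measurableSet_spanningSets μ k))
    (fun a b hab => Set.prod_mono (Iic_subset_Iic.2 (by exact_mod_cast hab)) (monotone_spanningSets μ hab)) ?_ ?_ M hM
    (fun k u => h k _ (measurableSet_spanningSets μ k) (hsp k) u) ?_ f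
  · symm
    refine generateFrom_eq_prod gen_Iic.symm MeasurableSpace.generateFrom_measurableSet ?_ isCountablySpanning_measurableSet
    exact ⟨fun k : ℕ => Iic (k:ℝ), fun k => ⟨_, rfl⟩, iUnion_Iic_nat'⟩
  · refine eq_univ_of_forall fun ⟨x, ω⟩ => ?_
    obtain ⟨k, hk⟩ := exists_nat_ge x
    have : ω ∈ ⋃ k, spanningSets μ k := by rw [iUnion_spanningSets]; trivial
    obtain ⟨j, hj⟩ := mem_iUnion.1 this
    refine mem_iUnion.2 ⟨max k j, ?_, monotone_spanningSets μ (le_max_right k j) hj⟩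
    exact hk.trans (by exact_mod_cast le_max_left k j)
  · intro k
    rw [Measure.prod_prod]
    exact ENNReal.mul_ne_top (muplus_Iic _) (hsp k)
  · rintro _ ⟨_, ⟨x, rfl⟩, D, hD, rfl⟩ k u
    rw [prod_inter_prod, Iic_inter_Iic]
    exact h _ _ (hD.inter (measurableSet_spanningSets μ k)) (ne_top_of_le_ne_top (hsp k) (measure_mono inter_subset_right)) u

lemma ind_prod (x : ℝ) (D : Set Ω) (s : ℝ) (ω : Ω) : (Iic x ×ˢ D).indicator (fun _ => (1:ℂ)) (s, ω) =
    (Iic x).indicator (fun _ => 1) s * D.indicator (fun _ => 1) ω := by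
  by_cases h1 : s ∈ Iic x <;> by_cases h2 : ω ∈ D <;> simp_all [indicator]

lemma Cn_tendsto (hp1 : 1 < p) (hp : p ≠ ∞) (hq : q ≠ ∞) (T : Lp ℂ p muplus →L[ℂ] Lp ℂ p muplus)
    (S : Lp ℂ p (muplus.prod μ) →L[ℂ] Lp ℂ p (muplus.prod μ))
    (hS : ∀ (f' : Lp ℂ p muplus) (g' : Lp ℂ p μ) (h : Lp ℂ p (muplus.prod μ)),
          ((h : ℝ × Ω → ℂ) =ᵐ[muplus.prod μ] fun z => (f' : ℝ → ℂ) z.1 * (g' : Ω → ℂ) z.2) →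
          ((S h : ℝ × Ω → ℂ) =ᵐ[muplus.prod μ] fun z => (T f' : ℝ → ℂ) z.1 * (g' : Ω → ℂ) z.2))
    (F : Lp ℂ p (muplus.prod μ)) (G : Lp ℂ q (muplus.prod μ)) :
    Tendsto (fun n => J q (hn n) (Mn n) T (kap μ F G)) atTop (𝓝 (pr (muplus.prod μ) p q (S F) G)) := by
  have base : ∀ x D, MeasurableSet D → μ D ≠ ∞ → ∀ F : Lp ℂ p (muplus.prod μ),
      (F : ℝ × Ω → ℂ) =ᵐ[muplus.prod μ] (Iic x ×ˢ D).indicator (fun _ => 1) →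
      ∀ y D', MeasurableSet D' → μ D' ≠ ∞ → ∀ G : Lp ℂ q (muplus.prod μ),
      (G : ℝ × Ω → ℂ) =ᵐ[muplus.prod μ] (Iic y ×ˢ D').indicator (fun _ => 1) →
      Tendsto (fun n => J q (hn n) (Mn n) T (kap μ F G)) atTop (𝓝 (pr (muplus.prod μ) p q (S F) G)) := by
    intro x D hD hDf F hF y D' hD' hDf' G hG
    let cc : ℂ := ∫ ω, D.indicator (fun _ => 1) ω * D'.indicator (fun _ => 1) ω ∂μ
    have h1 : kap μ F G =ᵐ[muplus.prod muplus] fun z => cc * (Iic x ×ˢ Iic y).indicator (fun _ => 1) z := by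
      refine (kap_congr hF hG).trans (Eventually.of_forall fun z => ?_)
      simp only [kap, ind_prod, cc]
      rw [show z = (z.1, z.2) from rfl, ind_prod, ← integral_mul_const]
      refine integral_congr_ae (Eventually.of_forall fun ω => ?_)
      simp only; ring
    simp_rw [J_congr h1, J_smul]
    have h2 : (S F : ℝ × Ω → ℂ) =ᵐ[muplus.prod μ] fun z => T (E p x) z.1 * (indicatorConstLp p hD hDf (1:ℂ)) z.2 := by
      refine hS _ _ _ ?_
      have a1 := Measure.quasiMeasurePreserving_fst (μ := muplus) (ν := μ) |>.ae (E_coe p x)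
      have a2 := Measure.quasiMeasurePreserving_snd (μ := muplus) (ν := μ) |>.ae (indicatorConstLp_coeFn (p := p) (hs := hD) (hμs := hDf) (c := (1:ℂ)))
      filter_upwards [hF, a1, a2] with z h1 h2 h3
      rw [h1, h2, h3, show z = (z.1, z.2) from rfl, ind_prod]
    have h3 : pr (muplus.prod μ) p q (S F) G = cc * pr muplus p q (T (E p x)) (E q y) := by
      rw [pr_eq, pr_eq]
      have : ∫ t, T (E p x) t * E q y t ∂muplus = ∫ t, T (E p x) t * (Iic y).indicator (fun _ => 1) t ∂muplus := by
        refine integral_congr_ae ?_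
        filter_upwards [E_coe q y] with t ht
        rw [ht]
      rw [this, mul_comm, ← integral_prod_mul]
      refine integral_congr_ae ?_
      have a2 := Measure.quasiMeasurePreserving_snd (μ := muplus) (ν := μ) |>.ae (indicatorConstLp_coeFn (p := p) (hs := hD) (hμs := hDf) (c := (1:ℂ)))
      filter_upwards [hG, h2, a2] with z h1 h2 h3
      rw [h1, h2, h3, show z = (z.1, z.2) from rfl, ind_prod]
      ring
    rw [h3]
    exact (J_rect_tendsto hp hq T x y).const_mul cc
  have step1 : ∀ x D, MeasurableSet D → μ D ≠ ∞ → ∀ F : Lp ℂ p (muplus.prod μ),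
      (F : ℝ × Ω → ℂ) =ᵐ[muplus.prod μ] (Iic x ×ˢ D).indicator (fun _ => 1) → ∀ G : Lp ℂ q (muplus.prod μ),
      Tendsto (fun n => J q (hn n) (Mn n) T (kap μ F G)) atTop (𝓝 (pr (muplus.prod μ) p q (S F) G)) := by
    intro x D hD hDf F hF G
    obtain ⟨M, hM, hM'⟩ := conv_sub atTop (fun n => Cn hp hq T μ n F) (pr (muplus.prod μ) p q (S F)) (‖T‖ * ‖F‖)
      (fun n G => Jkap_le hp1 hp hq (hn_pos n) (Mn n) T F G)
    refine (hM' G).1 (dense2 hq M hM ?_ G)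
    intro y D' hD' hDf' G hG
    exact (hM' G).2 (base x D hD hDf F hF y D' hD' hDf' G hG)
  obtain ⟨M, hM, hM'⟩ := conv_sub atTop (fun n => (Cn hp hq T μ n).flip G) (((pr (muplus.prod μ) p q).flip G).comp S) (‖T‖ * ‖G‖)
    (fun n F => (Jkap_le hp1 hp hq (hn_pos n) (Mn n) T F G).trans (le_of_eq (by ring)))
  refine (hM' F).1 (dense2 hp M hM ?_ F)
  intro x D hD hDf F hF
  exact (hM' F).2 (step1 x D hD hDf F hF G)

end Dense
end HankMult

namespace HankMult
open Filter Topology Set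
set_option linter.unusedSectionVars false

section W
variable {p q : ℝ≥0∞} [Fact (1 ≤ p)] [Fact (1 ≤ q)] [ENNReal.HolderConjugate p q]

lemma exists_lim {X : Type*} (b : ℕ → X → ℂ) (hb : ∀ x, ∃ C, ∀ n, ‖b n x‖ ≤ C) :
    ∃ L : X → ℂ, ∀ x, Tendsto (fun n => b n x) (hyperfilter ℕ : Filter ℕ) (𝓝 (L x)) := by
  suffices h : ∀ x, ∃ l, Tendsto (fun n => b n x) (hyperfilter ℕ : Filter ℕ) (𝓝 l) by
    choose L hL using h
    exact ⟨L, hL⟩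
  intro x
  obtain ⟨C, hC⟩ := hb x
  have h1 : IsCompact (Metric.closedBall (0:ℂ) C) := isCompact_closedBall _ _
  obtain ⟨l, -, hl⟩ := h1.ultrafilter_le_nhds ((hyperfilter ℕ).map fun n => b n x) (by
    rw [le_principal_iff]
    exact Filter.mem_map.2 (Eventually.of_forall fun n => by simpa using hC n))
  exact ⟨l, hl⟩

lemma pr_ext {f f' : Lp ℂ p muplus} (h : ∀ g, pr muplus p q f g = pr muplus p q f' g) : f = f' := by
  rw [← sub_eq_zero]
  refine pr_sep muplus p q _ fun g => ?_
  rw [map_sub, FunLike.coe_sub, Pi.sub_apply, h g, sub_self]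

lemma dual_muplus (hp1 : 1 < p) (hp : p ≠ ∞) (hq : q ≠ ∞) (ℓ : Lp ℂ q muplus →L[ℂ] ℂ) :
    ∃ f : Lp ℂ p muplus, (∀ g, pr muplus p q f g = ℓ g) ∧ ‖f‖ ≤ ‖ℓ‖ := by
  refine duality hp1 hp hq (fun x => Real.exp (-x)) (by fun_prop) (fun x => Real.exp_pos _) ?_ ℓ
  have hq0 := p_real_pos hq
  rw [← memLp_norm_iff (by fun_prop)]
  refine ⟨by fun_prop, ?_⟩
  rw [eLpNorm_lt_top_iff_lintegral_rpow_enorm_lt_top (p_ne0 q) hq]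
  have h1 : IntegrableOn (fun x => Real.exp (-q.toReal * x)) (Ioi 0) := exp_neg_integrableOn_Ioi 0 hq0
  have h2 := h1.hasFiniteIntegral
  rw [HasFiniteIntegral] at h2
  refine lt_of_eq_of_lt ?_ h2
  unfold muplus
  refine lintegral_congr fun x => ?_
  rw [enorm_norm, ← ofReal_norm, ← ofReal_norm, Complex.norm_real, Real.norm_of_nonneg (Real.exp_pos _).le, Real.norm_of_nonneg (Real.exp_pos _).le,
    ENNReal.ofReal_rpow_of_pos (Real.exp_pos _), ← Real.exp_mul]
  congr 2; ring

lemma exists_w (hp1 : 1 < p) (hp : p ≠ ∞) (hq : q ≠ ∞)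
    (L : (Lp ℂ p muplus →L[ℂ] Lp ℂ p muplus) → Lp ℂ p muplus → Lp ℂ q muplus → ℂ) (c : ℝ) (hc : 0 ≤ c)
    (l1 : ∀ T T' f g, L (T + T') f g = L T f g + L T' f g) (l2 : ∀ (a : ℂ) T f g, L (a • T) f g = a * L T f g)
    (l3 : ∀ T f f' g, L T (f + f') g = L T f g + L T f' g) (l4 : ∀ (a : ℂ) T f g, L T (a • f) g = a * L T f g)
    (l5 : ∀ T f g g', L T f (g + g') = L T f g + L T f g') (l6 : ∀ (a : ℂ) T f g, L T f (a • g) = a * L T f g)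
    (hL : ∀ T f g, ‖L T f g‖ ≤ c * ‖T‖ * ‖f‖ * ‖g‖) :
    ∃ w : (Lp ℂ p muplus →L[ℂ] Lp ℂ p muplus) →ₗ[ℂ] (Lp ℂ p muplus →L[ℂ] Lp ℂ p muplus),
      (∀ T, ‖w T‖ ≤ c * ‖T‖) ∧ ∀ T f g, pr muplus p q (w T f) g = L T f g := by
  have h1 : ∀ T f, ∃ k : Lp ℂ p muplus, (∀ g, pr muplus p q k g = L T f g) ∧ ‖k‖ ≤ c * ‖T‖ * ‖f‖ := by
    intro T f
    let ℓ : Lp ℂ q muplus →ₗ[ℂ] ℂ := { toFun := L T f, map_add' := l5 T f, map_smul' := fun a g => l6 a T f g }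
    obtain ⟨k, hk1, hk2⟩ := dual_muplus (p := p) hp1 hp hq (ℓ.mkContinuous (c * ‖T‖ * ‖f‖) (fun g => hL T f g))
    exact ⟨k, hk1, hk2.trans (ℓ.mkContinuous_norm_le (by positivity) _)⟩
  choose W hW1 hW2 using h1
  let w1 : (Lp ℂ p muplus →L[ℂ] Lp ℂ p muplus) → (Lp ℂ p muplus →L[ℂ] Lp ℂ p muplus) := fun T =>
    LinearMap.mkContinuous { toFun := W T
                             map_add' := fun f f' => pr_ext (q := q) fun g => by simp [hW1, l3]
                             map_smul' := fun a f => pr_ext (q := q) fun g => by simp [hW1, l4] } (c * ‖T‖) (fun f => hW2 T f)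
  have hw1 : ∀ T f, w1 T f = W T f := fun T f => rfl
  refine ⟨{ toFun := w1
            map_add' := fun T T' => ?_
            map_smul' := fun a T => ?_ }, fun T => ?_, fun T f g => hW1 T f g⟩
  · ext1 f
    refine pr_ext (q := q) fun g => ?_
    simp [hw1, hW1, l1]
  · ext1 f
    refine pr_ext (q := q) fun g => ?_
    simp [hw1, hW1, l2]
  · exact ContinuousLinearMap.opNorm_le_bound _ (by positivity) fun f => hW2 T f

/-- the multiplier kernel -/
def kb (m : ℝ → ℂ) (f g : ℝ → ℂ) (z : ℝ × ℝ) : ℂ := m (z.1 + z.2) * (f z.1 * g z.2)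

lemma kb_congr (m : ℝ → ℂ) {f f' g g' : ℝ → ℂ} (hf : f =ᵐ[muplus] f') (hg : g =ᵐ[muplus] g') :
    kb m f g =ᵐ[muplus.prod muplus] kb m f' g' := by
  filter_upwards [ae_fst hf, ae_snd hg] with z h1 h2
  rw [kb, kb, h1, h2]

variable {Ω : Type*} [MeasurableSpace Ω] {μ : Measure Ω} [SigmaFinite μ]
  {m : ℝ → ℂ} {α : ℝ → Lp ℂ p μ} {β : ℝ → Lp ℂ q μ} {A B : ℝ}

lemma kb_ab (hm' : ∀ᵐ z ∂(muplus.prod muplus), m (z.1 + z.2) = ∫ ω, α z.1 ω * β z.2 ω ∂μ) (f g : ℝ → ℂ) :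
    ∀ᵐ z ∂(muplus.prod muplus), kb m f g z = ∫ ω, (f z.1 • α z.1) ω * (g z.2 • β z.2) ω ∂μ := by
  filter_upwards [hm'] with z hz
  rw [kb, hz, mul_comm, ← integral_const_mul]
  refine integral_congr_ae ?_
  filter_upwards [Lp.coeFn_smul (f z.1) (α z.1), Lp.coeFn_smul (g z.2) (β z.2)] with ω h1 h2
  rw [h1, h2]
  simp only [Pi.smul_apply, smul_eq_mul]; ring

lemma muplus_ne : muplus ≠ 0 := by
  intro h
  have : muplus univ = 0 := by rw [h]; rfl
  simp [muplus] at this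

instance : NeZero muplus := ⟨muplus_ne⟩

lemma nonneg_of_ae {V : Type*} [NormedAddCommGroup V] {a : ℝ → V} {A : ℝ} (h : ∀ᵐ s ∂muplus, ‖a s‖ ≤ A) : 0 ≤ A := by
  obtain ⟨s, hs⟩ := h.exists
  exact (norm_nonneg _).trans hs

lemma smul_bd {a : ℝ → Lp ℂ p μ} (h : ∀ᵐ s ∂muplus, ‖a s‖ ≤ A) (f : ℝ → ℂ) :
    ∀ᵐ s ∂muplus, ‖f s • a s‖ₑ ≤ ENNReal.ofReal A * ‖f s‖ₑ := by
  filter_upwards [h] with s hs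
  rw [enorm_smul, mul_comm]
  gcongr
  rw [← ofReal_norm]
  exact ENNReal.ofReal_le_ofReal hs

lemma phf_int (hp : p ≠ ∞) (A : ℝ) (f : Lp ℂ p muplus) :
    (∫⁻ s, (ENNReal.ofReal A * ‖f s‖ₑ) ^ p.toReal ∂muplus) ^ (1 / p.toReal) = ENNReal.ofReal A * ‖f‖ₑ := by
  have h0 := p_real_pos hp
  simp_rw [ENNReal.mul_rpow_of_nonneg _ _ h0.le]
  rw [lintegral_const_mul _ ((Lp.stronglyMeasurable f).measurable.enorm.pow_const _), ENNReal.mul_rpow_of_nonneg _ _ (by positivity),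
    ← ENNReal.rpow_mul, mul_one_div_cancel h0.ne', ENNReal.rpow_one, Lp.enorm_def, eLpNorm_eq_lintegral_rpow_enorm_toReal (p_ne0 p) hp]

lemma phf_meas (A : ℝ) (f : Lp ℂ p muplus) : Measurable fun s => ENNReal.ofReal A * ‖f s‖ₑ :=
  (Lp.stronglyMeasurable f).measurable.enorm.const_mul _

lemma phf_fin (hp : p ≠ ∞) (A : ℝ) (f : Lp ℂ p muplus) :
    ∫⁻ s, (ENNReal.ofReal A * ‖f s‖ₑ) ^ p.toReal ∂muplus ≠ ∞ := by
  intro h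
  have := phf_int hp A f
  rw [h, ENNReal.top_rpow_of_pos (by have := p_real_pos hp; positivity)] at this
  exact ENNReal.mul_ne_top (by simp) enorm_ne_top this.symm

lemma kb_int (hp : p ≠ ∞) (hq : q ≠ ∞) (hm : ContinuousOn m (Ioi 0))
    (hA : ∀ᵐ s ∂muplus, ‖α s‖ ≤ A) (hB : ∀ᵐ t ∂muplus, ‖β t‖ ≤ B)
    (hm' : ∀ᵐ z ∂(muplus.prod muplus), m (z.1 + z.2) = ∫ ω, α z.1 ω * β z.2 ω ∂μ)
    (f : Lp ℂ p muplus) (g : Lp ℂ q muplus) (h : ℝ) (M : ℕ) : IntegrableOn (kb m f g) (sq h M) := by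
  refine kint (one_le_real hp) (one_le_real hq) (phf_meas A f).aemeasurable (phf_meas B g).aemeasurable (phf_fin hp A f) (phf_fin hq B g) h M ?_ ?_
  · have hF := Lp.stronglyMeasurable f
    have hG := Lp.stronglyMeasurable g
    have h1 : AEStronglyMeasurable (fun z : ℝ × ℝ => m (z.1 + z.2)) (muplus.prod muplus) := by
      rw [muplus_prod]
      refine ContinuousOn.aestronglyMeasurable (hm.comp (by fun_prop) ?_) (measurableSet_Ioi.prod measurableSet_Ioi)
      intro z hz
      have h1 : 0 < z.1 := hz.1
      have h2 : 0 < z.2 := hz.2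
      exact add_pos h1 h2
    exact h1.mul ((hF.comp_measurable measurable_fst).mul (hG.comp_measurable measurable_snd)).aestronglyMeasurable
  · filter_upwards [kb_ab hm' f g, ae_fst (smul_bd hA f), ae_snd (smul_bd hB g)] with z hz h1 h2
    rw [hz]
    refine (enorm_pr_le _ _ _).trans ?_
    gcongr

lemma Jkb_le (hp1 : 1 < p) (hp : p ≠ ∞) (hq : q ≠ ∞) (hm : ContinuousOn m (Ioi 0))
    (hA : ∀ᵐ s ∂muplus, ‖α s‖ ≤ A) (hB : ∀ᵐ t ∂muplus, ‖β t‖ ≤ B)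
    (hm' : ∀ᵐ z ∂(muplus.prod muplus), m (z.1 + z.2) = ∫ ω, α z.1 ω * β z.2 ω ∂μ)
    (T : Lp ℂ p muplus →L[ℂ] Lp ℂ p muplus)
    (f : Lp ℂ p muplus) (g : Lp ℂ q muplus) {h : ℝ} (hh : 0 < h) (M : ℕ) :
    ‖J q h M T (kb m f g)‖ ≤ A * B * ‖T‖ * ‖f‖ * ‖g‖ := by
  have hA0 := nonneg_of_ae hA
  have hB0 := nonneg_of_ae hB
  have := J_bound hp1 hp hq hh M T (kb m f g) (kb_int hp hq hm hA hB hm' f g h M) (fun s => f s • α s) (fun s => g s • β s) _ _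
    (phf_meas A f) (phf_meas B g) (smul_bd hA f) (smul_bd hB g) (kb_ab hm' f g)
  rw [phf_int hp, phf_int hq] at this
  rw [← ofReal_norm, ← ofReal_norm, ← ofReal_norm, ← ofReal_norm, ← ENNReal.ofReal_mul (by positivity), ← ENNReal.ofReal_mul (by positivity),
    ← ENNReal.ofReal_mul (by positivity), ← ENNReal.ofReal_mul (by positivity)] at this
  refine ((ENNReal.ofReal_le_ofReal_iff (by positivity)).1 this).trans (le_of_eq (by ring))

lemma kb_add_left (f f' : Lp ℂ p muplus) (g : Lp ℂ q muplus) :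
    kb m (f + f' : Lp ℂ p muplus) g =ᵐ[muplus.prod muplus] fun z => kb m f g z + kb m f' g z := by
  refine (kb_congr m (Lp.coeFn_add f f') (ae_eq_refl _)).trans (Eventually.of_forall fun z => ?_)
  simp only [kb, Pi.add_apply]; ring
lemma kb_add_right (f : Lp ℂ p muplus) (g g' : Lp ℂ q muplus) :
    kb m f (g + g' : Lp ℂ q muplus) =ᵐ[muplus.prod muplus] fun z => kb m f g z + kb m f g' z := by
  refine (kb_congr m (ae_eq_refl _) (Lp.coeFn_add g g')).trans (Eventually.of_forall fun z => ?_)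
  simp only [kb, Pi.add_apply]; ring
lemma kb_smul_left (c : ℂ) (f : Lp ℂ p muplus) (g : Lp ℂ q muplus) :
    kb m (c • f : Lp ℂ p muplus) g =ᵐ[muplus.prod muplus] fun z => c * kb m f g z := by
  refine (kb_congr m (Lp.coeFn_smul c f) (ae_eq_refl _)).trans (Eventually.of_forall fun z => ?_)
  simp only [kb, Pi.smul_apply, smul_eq_mul]; ring
lemma kb_smul_right (c : ℂ) (f : Lp ℂ p muplus) (g : Lp ℂ q muplus) :
    kb m f (c • g : Lp ℂ q muplus) =ᵐ[muplus.prod muplus] fun z => c * kb m f g z := by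
  refine (kb_congr m (ae_eq_refl _) (Lp.coeFn_smul c g)).trans (Eventually.of_forall fun z => ?_)
  simp only [kb, Pi.smul_apply, smul_eq_mul]; ring

theorem main_w (hp1 : 1 < p) (hp : p ≠ ∞) (hq : q ≠ ∞) (hm : ContinuousOn m (Ioi 0))
    (hA : ∀ᵐ s ∂muplus, ‖α s‖ ≤ A) (hB : ∀ᵐ t ∂muplus, ‖β t‖ ≤ B)
    (hm' : ∀ᵐ z ∂(muplus.prod muplus), m (z.1 + z.2) = ∫ ω, α z.1 ω * β z.2 ω ∂μ) :
    ∃ w : (Lp ℂ p muplus →L[ℂ] Lp ℂ p muplus) →ₗ[ℂ] (Lp ℂ p muplus →L[ℂ] Lp ℂ p muplus),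
      (∀ T, ‖w T‖ ≤ A * B * ‖T‖) ∧ ∀ (T : Lp ℂ p muplus →L[ℂ] Lp ℂ p muplus) (f : Lp ℂ p muplus) (g : Lp ℂ q muplus), Tendsto (fun n => J q (hn n) (Mn n) T (kb m f g)) (hyperfilter ℕ : Filter ℕ)
        (𝓝 (pr muplus p q (w T f) g)) := by
  have hA0 := nonneg_of_ae hA
  have hB0 := nonneg_of_ae hB
  have hint := fun f g n => kb_int hp hq hm hA hB hm' f g (hn n) (Mn n)
  have hbd := fun T f g n => Jkb_le hp1 hp hq hm hA hB hm' T f g (hn_pos n) (Mn n)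
  obtain ⟨L, hL⟩ := exists_lim (X := (Lp ℂ p muplus →L[ℂ] Lp ℂ p muplus) × Lp ℂ p muplus × Lp ℂ q muplus)
    (fun n x => J q (hn n) (Mn n) x.1 (kb m x.2.1 x.2.2)) (fun x => ⟨_, fun n => hbd x.1 x.2.1 x.2.2 n⟩)
  have hL' : ∀ (T : Lp ℂ p muplus →L[ℂ] Lp ℂ p muplus) (f : Lp ℂ p muplus) (g : Lp ℂ q muplus), Tendsto (fun n => J q (hn n) (Mn n) T (kb m f g)) (hyperfilter ℕ : Filter ℕ) (𝓝 (L (T, f, g))) :=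
    fun T f g => hL (T, f, g)
  obtain ⟨w, hw1, hw2⟩ := exists_w hp1 hp hq (fun T f g => L (T, f, g)) (A * B) (by positivity)
    (fun T T' f g => tendsto_nhds_unique (hL' _ _ _) (((hL' T f g).add (hL' T' f g)).congr fun n => by
      rw [J_addT hp hq (hn_pos n).le (hint _ _ _)]))
    (fun a T f g => tendsto_nhds_unique (hL' _ _ _) (((hL' T f g).const_mul a).congr fun n => by rw [J_smulT]))
    (fun T f f' g => tendsto_nhds_unique (hL' _ _ _) (((hL' T f g).add (hL' T f' g)).congr fun n => by
      rw [J_congr (kb_add_left f f' g), J_add hp hq (hn_pos n).le (hint _ _ _) (hint _ _ _)]))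
    (fun a T f g => tendsto_nhds_unique (hL' _ _ _) (((hL' T f g).const_mul a).congr fun n => by
      rw [J_congr (kb_smul_left a f g), J_smul]))
    (fun T f g g' => tendsto_nhds_unique (hL' _ _ _) (((hL' T f g).add (hL' T f g')).congr fun n => by
      rw [J_congr (kb_add_right f g g'), J_add hp hq (hn_pos n).le (hint _ _ _) (hint _ _ _)]))
    (fun a T f g => tendsto_nhds_unique (hL' _ _ _) (((hL' T f g).const_mul a).congr fun n => by
      rw [J_congr (kb_smul_right a f g), J_smul]))
    (fun T f g => le_of_tendsto (hL' T f g).norm (Eventually.of_forall fun n => hbd T f g n))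
  refine ⟨w, hw1, fun T f g => ?_⟩
  rw [hw2]; exact hL' T f g

/-- clause 2 -/
theorem clause2 (hp1 : 1 < p) (hp : p ≠ ∞) (hq : q ≠ ∞)
    (hm' : ∀ᵐ z ∂(muplus.prod muplus), m (z.1 + z.2) = ∫ ω, α z.1 ω * β z.2 ω ∂μ)
    (T : Lp ℂ p muplus →L[ℂ] Lp ℂ p muplus)
    (S : Lp ℂ p (muplus.prod μ) →L[ℂ] Lp ℂ p (muplus.prod μ))
    (hS : ∀ (f' : Lp ℂ p muplus) (g' : Lp ℂ p μ) (h : Lp ℂ p (muplus.prod μ)),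
          ((h : ℝ × Ω → ℂ) =ᵐ[muplus.prod μ] fun z => (f' : ℝ → ℂ) z.1 * (g' : Ω → ℂ) z.2) →
          ((S h : ℝ × Ω → ℂ) =ᵐ[muplus.prod μ] fun z => (T f' : ℝ → ℂ) z.1 * (g' : Ω → ℂ) z.2))
    (f : Lp ℂ p muplus) (g : Lp ℂ q muplus) (F : Lp ℂ p (muplus.prod μ)) (G : Lp ℂ q (muplus.prod μ))
    (hF : (F : ℝ × Ω → ℂ) =ᵐ[muplus.prod μ] fun z => (f : ℝ → ℂ) z.1 * (α z.1 : Ω → ℂ) z.2)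
    (hG : (G : ℝ × Ω → ℂ) =ᵐ[muplus.prod μ] fun z => (g : ℝ → ℂ) z.1 * (β z.1 : Ω → ℂ) z.2) :
    Tendsto (fun n => J q (hn n) (Mn n) T (kb m f g)) atTop (𝓝 (pr (muplus.prod μ) p q (S F) G)) := by
  refine (Cn_tendsto hp1 hp hq T S hS F G).congr fun n => J_congr ?_
  refine (kap_congr hF hG).trans ?_
  filter_upwards [hm'] with z hz
  rw [kb, hz, kap, mul_comm, ← integral_const_mul]
  refine integral_congr_ae (Eventually.of_forall fun ω => ?_)
  simp only; ring

end W
end HankMult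

namespace HankMult
open Filter Topology Set
set_option linter.unusedSectionVars false

section C3
variable {p q : ℝ≥0∞} [Fact (1 ≤ p)] [Fact (1 ≤ q)] [ENNReal.HolderConjugate p q]

lemma refl_ae {P : ℝ → Prop} (h : ∀ᵐ x ∂muplus, P x) (u : ℝ) : ∀ᵐ t ∂muplus, t < u → P (u - t) := by
  unfold muplus at h ⊢
  rw [ae_restrict_iff' measurableSet_Ioi] at h
  have h1 := (Measure.measurePreserving_sub_left volume u).quasiMeasurePreserving.ae h
  filter_upwards [ae_restrict_of_ae h1] with t ht htu
  exact ht (sub_pos.2 htu)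

lemma shift_ae {P : ℝ → Prop} (h : ∀ᵐ x ∂muplus, P x) (v : ℝ) : ∀ᵐ t ∂muplus, v < t → P (t - v) := by
  unfold muplus at h ⊢
  rw [ae_restrict_iff' measurableSet_Ioi] at h
  have h1 := (measurePreserving_sub_right volume v).quasiMeasurePreserving.ae h
  filter_upwards [ae_restrict_of_ae h1] with t ht htu
  exact ht (sub_pos.2 htu)

lemma K_theta {u : ℝ} {Θ : Lp ℂ p muplus →L[ℂ] Lp ℂ p muplus}
    (hΘ : ∀ f : Lp ℂ p muplus, (Θ f : ℝ → ℂ) =ᵐ[muplus] fun t => if t < u then (f : ℝ → ℂ) (u - t) else 0)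
    {h : ℝ} (hh : 0 ≤ h) (s t : ℝ) :
    ∃ r : ℝ, 0 ≤ r ∧ K q h Θ s t = r ∧ (r ≠ 0 → |s + t - u| ≤ 2 * h) := by
  let S : Set ℝ := {x | x < u ∧ u - x ∈ Ioc s (s + h) ∧ x ∈ Ioc t (t + h)}
  refine ⟨∫ x, S.indicator (fun _ => (1:ℝ)) x ∂muplus, ?_, ?_, ?_⟩
  · exact integral_nonneg fun x => indicator_nonneg (fun _ _ => zero_le_one) _
  · rw [K, pr_eq, ← integral_complex_ofReal]
    refine integral_congr_ae ?_
    filter_upwards [hΘ (e p h s), refl_ae (e_coe p hh s) u, e_coe q hh t] with x h1 h2 h3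
    rw [h1, h3]
    by_cases hx : x < u
    · rw [if_pos hx, h2 hx]
      by_cases h4 : u - x ∈ Ioc s (s + h) <;> by_cases h5 : x ∈ Ioc t (t + h)
      · rw [indicator_of_mem h4, indicator_of_mem h5, indicator_of_mem (show x ∈ S from ⟨hx, h4, h5⟩)]; simp
      · rw [indicator_of_notMem h5, indicator_of_notMem (fun hS : x ∈ S => h5 hS.2.2)]; simp
      · rw [indicator_of_notMem h4, indicator_of_notMem (fun hS : x ∈ S => h4 hS.2.1)]; simp
      · rw [indicator_of_notMem h4, indicator_of_notMem (fun hS : x ∈ S => h4 hS.2.1)]; simp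
    · rw [if_neg hx, indicator_of_notMem (fun hS : x ∈ S => hx hS.1)]; simp
  · intro hr
    have : S.Nonempty := by
      by_contra hS
      rw [not_nonempty_iff_eq_empty] at hS
      apply hr
      rw [hS]; simp
    obtain ⟨x, hx, ⟨h1, h2⟩, h3, h4⟩ := this
    rw [abs_le]; constructor <;> linarith

variable {Ω : Type*} [MeasurableSpace Ω] {μ : Measure Ω} [SigmaFinite μ]
  {m : ℝ → ℂ} {α : ℝ → Lp ℂ p μ} {β : ℝ → Lp ℂ q μ} {A B : ℝ}

lemma J_sub_le (hp : p ≠ ∞) (hq : q ≠ ∞) (hm : ContinuousOn m (Ioi 0))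
    (hA : ∀ᵐ s ∂muplus, ‖α s‖ ≤ A) (hB : ∀ᵐ t ∂muplus, ‖β t‖ ≤ B)
    (hm' : ∀ᵐ z ∂(muplus.prod muplus), m (z.1 + z.2) = ∫ ω, α z.1 ω * β z.2 ω ∂μ)
    {u : ℝ} {Θ : Lp ℂ p muplus →L[ℂ] Lp ℂ p muplus}
    (hΘ : ∀ f : Lp ℂ p muplus, (Θ f : ℝ → ℂ) =ᵐ[muplus] fun t => if t < u then (f : ℝ → ℂ) (u - t) else 0)
    {h : ℝ} (hh : 0 < h) (M : ℕ) (x y : ℝ) {ε : ℝ} (hε : 0 ≤ ε) (hmε : ∀ r, |r - u| ≤ 2 * h → ‖m r - m u‖ ≤ ε) :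
    ‖J q h M Θ (kb m (E p x) (E q y)) - m u * J q h M Θ ((Iic x ×ˢ Iic y).indicator fun _ => 1)‖ ≤
      ε * ‖J q h M Θ ((Iic x ×ˢ Iic y).indicator fun _ => 1)‖ := by
  set R : ℝ × ℝ → ℂ := (Iic x ×ˢ Iic y).indicator fun _ => 1 with hR
  have hsf : volume (sq h M) ≠ ∞ := by
    rw [sq, Measure.volume_eq_prod, Measure.prod_prod]
    exact ENNReal.mul_ne_top measure_Ioc_lt_top.ne measure_Ioc_lt_top.ne
  have iR : IntegrableOn R (sq h M) :=
    (integrableOn_const (C := (1:ℂ)) hsf).indicator (measurableSet_Iic.prod measurableSet_Iic)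
  have iK := kb_int hp hq hm hA hB hm' (E p x) (E q y) h M
  have e1 : J q h M Θ (kb m (E p x) (E q y)) - m u * J q h M Θ R =
      ((h:ℂ)⁻¹) ^ 2 * ∫ z in sq h M, (K q h Θ z.1 z.2 * kb m (E p x) (E q y) z - m u * (K q h Θ z.1 z.2 * R z)) := by
    rw [integral_sub (Kint hp hq hh.le M Θ iK) ((Kint hp hq hh.le M Θ iR).const_mul _), integral_const_mul]
    unfold J; ring
  rw [e1, J, norm_mul, norm_mul, mul_left_comm]
  refine mul_le_mul_of_nonneg_left ?_ (norm_nonneg _)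
  have e2 : ∀ z : ℝ × ℝ, K q h Θ z.1 z.2 * R z = (‖K q h Θ z.1 z.2 * R z‖ : ℝ) := by
    intro z
    obtain ⟨r, hr, hK, -⟩ := K_theta (q := q) hΘ hh.le z.1 z.2
    rw [hK, hR]
    by_cases hz : z ∈ Iic x ×ˢ Iic y
    · rw [indicator_of_mem hz, mul_one, Complex.norm_real, Real.norm_of_nonneg hr]
    · rw [indicator_of_notMem hz, mul_zero, norm_zero, Complex.ofReal_zero]
  have e3 : ‖∫ z in sq h M, K q h Θ z.1 z.2 * R z‖ = ∫ z in sq h M, ‖K q h Θ z.1 z.2 * R z‖ := by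
    rw [integral_congr_ae (Eventually.of_forall e2), integral_complex_ofReal, Complex.norm_real, Real.norm_of_nonneg]
    exact integral_nonneg fun z => norm_nonneg _
  rw [e3, ← integral_const_mul]
  refine norm_integral_le_of_norm_le ((Kint hp hq hh.le M Θ iR).norm.const_mul ε) ?_
  filter_upwards [sq_ae (ae_fst (E_coe p x)), sq_ae (ae_snd (E_coe q y))] with z h1 h2
  have e4 : kb m (E p x) (E q y) z = m (z.1 + z.2) * R z := by
    rw [kb, h1, h2, hR]
    by_cases h3 : z.1 ∈ Iic x <;> by_cases h4 : z.2 ∈ Iic y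
    · rw [indicator_of_mem h3, indicator_of_mem h4, indicator_of_mem (show z ∈ Iic x ×ˢ Iic y from ⟨h3, h4⟩), one_mul]
    · rw [indicator_of_notMem h4, indicator_of_notMem (fun hz : z ∈ Iic x ×ˢ Iic y => h4 hz.2), mul_zero]
    · rw [indicator_of_notMem h3, indicator_of_notMem (fun hz : z ∈ Iic x ×ˢ Iic y => h3 hz.1), zero_mul]
    · rw [indicator_of_notMem h3, indicator_of_notMem (fun hz : z ∈ Iic x ×ˢ Iic y => h3 hz.1), zero_mul]
  rw [e4, show K q h Θ z.1 z.2 * (m (z.1 + z.2) * R z) - m u * (K q h Θ z.1 z.2 * R z) =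
    (m (z.1 + z.2) - m u) * (K q h Θ z.1 z.2 * R z) by ring, norm_mul]
  by_cases hK0 : K q h Θ z.1 z.2 = 0
  · rw [hK0]; simp
  · refine mul_le_mul_of_nonneg_right (hmε _ ?_) (norm_nonneg _)
    obtain ⟨r, hr, hK, hr'⟩ := K_theta (q := q) hΘ hh.le z.1 z.2
    refine hr' fun hr0 => hK0 ?_
    rw [hK, hr0, Complex.ofReal_zero]

lemma hyper_le : (hyperfilter ℕ : Filter ℕ) ≤ atTop := by
  rw [← Nat.cofinite_eq_atTop]; exact hyperfilter_le_cofinite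

theorem clause3 (hp : p ≠ ∞) (hq : q ≠ ∞) (hm : ContinuousOn m (Ioi 0))
    (hA : ∀ᵐ s ∂muplus, ‖α s‖ ≤ A) (hB : ∀ᵐ t ∂muplus, ‖β t‖ ≤ B)
    (hm' : ∀ᵐ z ∂(muplus.prod muplus), m (z.1 + z.2) = ∫ ω, α z.1 ω * β z.2 ω ∂μ)
    {u : ℝ} (hu : 0 < u) {Θ : Lp ℂ p muplus →L[ℂ] Lp ℂ p muplus}
    (hΘ : ∀ f : Lp ℂ p muplus, (Θ f : ℝ → ℂ) =ᵐ[muplus] fun t => if t < u then (f : ℝ → ℂ) (u - t) else 0)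
    (W : Lp ℂ p muplus →L[ℂ] Lp ℂ p muplus)
    (hW : ∀ (f : Lp ℂ p muplus) (g : Lp ℂ q muplus), Tendsto (fun n => J q (hn n) (Mn n) Θ (kb m f g))
      (hyperfilter ℕ : Filter ℕ) (𝓝 (pr muplus p q (W f) g))) : W = m u • Θ := by
  have h0 : ∀ x y, pr muplus p q ((W - m u • Θ) (E p x)) (E q y) = 0 := by
    intro x y
    have hr := (J_rect_tendsto (q := q) hp hq Θ x y).mono_left hyper_le
    have hk := ((hW (E p x) (E q y)).sub (hr.const_mul (m u))).norm
    have key : ∀ ε : ℝ, 0 < ε → ‖pr muplus p q (W (E p x)) (E q y) - m u * pr muplus p q (Θ (E p x)) (E q y)‖ ≤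
        ε * ‖pr muplus p q (Θ (E p x)) (E q y)‖ := by
      intro ε hε
      refine le_of_tendsto_of_tendsto hk (hr.norm.const_mul ε) ?_
      have hc : ContinuousAt m u := hm.continuousAt (Ioi_mem_nhds hu)
      obtain ⟨δ, hδ, hδ'⟩ := Metric.continuousAt_iff.1 hc ε hε
      have h1 : ∀ᶠ n in atTop, hn n < δ / 2 :=
        (tendsto_nhdsWithin_iff.1 hn_tendsto).1.eventually_lt_const (by positivity)
      filter_upwards [hyper_le h1] with n hn1
      have hn1 : hn n < δ / 2 := hn1
      refine J_sub_le hp hq hm hA hB hm' hΘ (hn_pos n) (Mn n) x y hε.le fun r hr => ?_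
      rw [← dist_eq_norm]
      refine (hδ' ?_).le
      rw [Real.dist_eq]; linarith
    have : ‖pr muplus p q (W (E p x)) (E q y) - m u * pr muplus p q (Θ (E p x)) (E q y)‖ ≤ 0 := by
      set D := ‖pr muplus p q (Θ (E p x)) (E q y)‖
      have h2 : Tendsto (fun ε : ℝ => ε * D) (𝓝[>] 0) (𝓝 (0 * D)) :=
        (tendsto_id.mul_const D).mono_left nhdsWithin_le_nhds
      rw [zero_mul] at h2
      exact ge_of_tendsto h2 (eventually_mem_nhdsWithin.mono fun ε hε => key ε hε)
    have := norm_le_zero_iff.1 this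
    rw [← this]
    simp
  have h1 : ∀ f y, pr muplus p q ((W - m u • Θ) f) (E q y) = 0 := by
    intro f y
    let ℓ : Lp ℂ p muplus →L[ℂ] ℂ := ((pr muplus p q).flip (E q y)).comp (W - m u • Θ)
    exact dense1 hp (LinearMap.ker ℓ.toLinearMap) ℓ.isClosed_ker (fun x => h0 x y) f
  rw [← sub_eq_zero]
  ext1 f
  refine pr_sep muplus p q _ fun g => ?_
  let ℓ : Lp ℂ q muplus →L[ℂ] ℂ := pr muplus p q ((W - m u • Θ) f)
  exact dense1 hq (LinearMap.ker ℓ.toLinearMap) ℓ.isClosed_ker (fun y => h1 f y) g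

end C3
end HankMult

namespace HankMult
open Filter Topology Set
set_option linter.unusedSectionVars false

section C4
variable {p q : ℝ≥0∞} [Fact (1 ≤ p)] [Fact (1 ≤ q)] [ENNReal.HolderConjugate p q]

lemma e_shift {h v s : ℝ} (hh : 0 ≤ h) (hs : 0 ≤ s) :
    (e p h (s + v) : ℝ → ℂ) =ᵐ[muplus] shiftR v (e p h s : ℝ → ℂ) := by
  filter_upwards [e_coe p hh (s + v), shift_ae (e_coe p hh s) v] with t h1 h2
  rw [h1, shiftR]
  by_cases hv : v < t
  · rw [if_pos hv, h2 hv]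
    by_cases h3 : t ∈ Ioc (s + v) (s + v + h)
    · rw [indicator_of_mem h3, indicator_of_mem]
      exact ⟨by linarith [h3.1], by linarith [h3.2]⟩
    · rw [indicator_of_notMem h3, indicator_of_notMem]
      exact fun h4 => h3 ⟨by linarith [h4.1], by linarith [h4.2]⟩
  · rw [if_neg hv, indicator_of_notMem]
    exact fun h4 => hv (by linarith [h4.1])

lemma K_hank {T : Lp ℂ p muplus →L[ℂ] Lp ℂ p muplus} (hT : IsHankelianLp p q T) {h v s t : ℝ} (hh : 0 ≤ h)
    (hv : 0 < v) (hs : 0 ≤ s) (ht : 0 ≤ t) : K q h T (s + v) t = K q h T s (t + v) := by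
  rw [K, K, pr_eq, pr_eq]
  exact hT v hv _ _ _ _ (e_shift hh hs) (e_shift hh ht)

lemma J_hank {T : Lp ℂ p muplus →L[ℂ] Lp ℂ p muplus} (hT : IsHankelianLp p q T) {h v : ℝ} (hh : 0 ≤ h)
    (hv : 0 < v) (m f g : ℝ → ℂ) (M : ℕ) :
    J q h M T (kb m (shiftR v f) ((Iic (M * h - v)).indicator g)) =
      J q h M T (kb m ((Iic (M * h - v)).indicator f) (shiftR v g)) := by
  unfold J
  congr 1
  rw [← integral_indicator (sq_meas h M), ← integral_indicator (sq_meas h M), Measure.volume_eq_prod,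
    ← integral_add_right_eq_self _ ((v, 0) : ℝ × ℝ),
    ← integral_add_right_eq_self ((sq h M).indicator fun z => K q h T z.1 z.2 * kb m ((Iic (M * h - v)).indicator f) (shiftR v g) z)
      ((0, v) : ℝ × ℝ)]
  refine integral_congr_ae (Eventually.of_forall fun z => ?_)
  obtain ⟨s, t⟩ := z
  simp only [Prod.mk_add_mk, add_zero]
  set N : ℝ := M * h with hN
  by_cases hst : (0 < s ∧ s ≤ N - v) ∧ (0 < t ∧ t ≤ N - v)
  · obtain ⟨⟨h1, h2⟩, h3, h4⟩ := hst
    rw [indicator_of_mem (show (s + v, t) ∈ sq h M from ⟨⟨by dsimp only; linarith, by dsimp only; linarith⟩, ⟨h3, by dsimp only; linarith⟩⟩),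
      indicator_of_mem (show (s, t + v) ∈ sq h M from ⟨⟨h1, by dsimp only; linarith⟩, ⟨by dsimp only; linarith, by dsimp only; linarith⟩⟩)]
    simp only [kb]
    rw [indicator_of_mem (show t ∈ Iic (N - v) from h4), indicator_of_mem (show s ∈ Iic (N - v) from h2), shiftR, shiftR,
      if_pos (by linarith), if_pos (by linarith), K_hank hT hh hv h1.le h3.le, add_sub_cancel_right, add_sub_cancel_right,
      show s + v + t = s + (t + v) by ring]
  · have z1 : (sq h M).indicator (fun z => K q h T z.1 z.2 * kb m (shiftR v f) ((Iic (N - v)).indicator g) z) (s + v, t) = 0 := by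
      rw [indicator_apply_eq_zero]
      rintro ⟨⟨h1, h2⟩, h3, h4⟩
      dsimp only at h1 h2 h3 h4
      simp only [kb]
      by_cases hs : 0 < s
      · have : t ∉ Iic (N - v) := fun ht => hst ⟨⟨hs, by linarith⟩, h3, ht⟩
        rw [indicator_of_notMem this]; simp
      · rw [shiftR, if_neg (by linarith)]; simp
    have z2 : (sq h M).indicator (fun z => K q h T z.1 z.2 * kb m ((Iic (N - v)).indicator f) (shiftR v g) z) (s, t + v) = 0 := by
      rw [indicator_apply_eq_zero]
      rintro ⟨⟨h1, h2⟩, h3, h4⟩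
      dsimp only at h1 h2 h3 h4
      simp only [kb]
      by_cases ht : 0 < t
      · have : s ∉ Iic (N - v) := fun hs => hst ⟨⟨h1, hs⟩, ht, by linarith⟩
        rw [indicator_of_notMem this]; simp
      · rw [shiftR, if_neg (by linarith)]; simp
    rw [z1, z2]

variable {Ω : Type*} [MeasurableSpace Ω] {μ : Measure Ω} [SigmaFinite μ]
  {m : ℝ → ℂ} {α : ℝ → Lp ℂ p μ} {β : ℝ → Lp ℂ q μ} {A B : ℝ}

lemma trunc_tendsto {r : ℝ≥0∞} [Fact (1 ≤ r)] (hr : r ≠ ∞) (v : ℝ) (g : Lp ℂ r muplus) :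
    Tendsto (fun n : ℕ => ind (Iic ((Mn n : ℝ) * hn n - v)) measurableSet_Iic g) atTop (𝓝 g) := by
  have := ind_tendsto (μ := muplus) hr (l := atTop) (S := fun n : ℕ => Iic ((Mn n : ℝ) * hn n - v)) (S' := univ)
    (fun n => measurableSet_Iic) MeasurableSet.univ g (fun x => by
      filter_upwards [eventually_ge_atTop ⌈x + v⌉₊] with n hn1
      have : x + v ≤ (n:ℝ) := Nat.ceil_le.1 hn1
      rw [MnN, mem_Iic]
      simp only [mem_univ, iff_true]
      linarith)
  rwa [ind_univ] at this

theorem clause4 (hp1 : 1 < p) (hp : p ≠ ∞) (hq : q ≠ ∞) (hm : ContinuousOn m (Ioi 0))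
    (hA : ∀ᵐ s ∂muplus, ‖α s‖ ≤ A) (hB : ∀ᵐ t ∂muplus, ‖β t‖ ≤ B)
    (hm' : ∀ᵐ z ∂(muplus.prod muplus), m (z.1 + z.2) = ∫ ω, α z.1 ω * β z.2 ω ∂μ)
    {T : Lp ℂ p muplus →L[ℂ] Lp ℂ p muplus} (hT : IsHankelianLp p q T)
    (W : Lp ℂ p muplus →L[ℂ] Lp ℂ p muplus)
    (hW : ∀ (f : Lp ℂ p muplus) (g : Lp ℂ q muplus), Tendsto (fun n => J q (hn n) (Mn n) T (kb m f g))
      (hyperfilter ℕ : Filter ℕ) (𝓝 (pr muplus p q (W f) g))) : IsHankelianLp p q W := by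
  intro v hv f fv g gv hf hg
  rw [← pr_eq, ← pr_eq]
  have hint := fun f g n => kb_int hp hq hm hA hB hm' f g (hn n) (Mn n)
  have hbd := fun f g n => Jkb_le hp1 hp hq hm hA hB hm' T f g (hn_pos n) (Mn n)
  let gn : ℕ → Lp ℂ q muplus := fun n => ind (Iic ((Mn n : ℝ) * hn n - v)) measurableSet_Iic g
  let fn : ℕ → Lp ℂ p muplus := fun n => ind (Iic ((Mn n : ℝ) * hn n - v)) measurableSet_Iic f
  have h1 : Tendsto (fun n => J q (hn n) (Mn n) T (kb m fv (g - gn n : Lp ℂ q muplus))) (hyperfilter ℕ : Filter ℕ) (𝓝 0) := by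
    have a1 : Tendsto (fun n => g - gn n) atTop (𝓝 0) := by
      simpa using (trunc_tendsto hq v g).const_sub g
    have a2 := (a1.norm.const_mul (A * B * ‖T‖ * ‖fv‖)).mono_left hyper_le
    rw [norm_zero, mul_zero] at a2
    exact squeeze_zero_norm (fun n => hbd fv _ n) a2
  have h2 : Tendsto (fun n => J q (hn n) (Mn n) T (kb m (f - fn n : Lp ℂ p muplus) gv)) (hyperfilter ℕ : Filter ℕ) (𝓝 0) := by
    have a1 : Tendsto (fun n => f - fn n) atTop (𝓝 0) := by
      simpa using (trunc_tendsto hp v f).const_sub f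
    have a2 := ((a1.norm.const_mul (A * B * ‖T‖)).mul_const ‖gv‖).mono_left hyper_le
    rw [norm_zero, mul_zero, zero_mul] at a2
    exact squeeze_zero_norm (fun n => hbd _ gv n) a2
  have h3 := (hW fv g).sub h1
  have h4 := (hW f gv).sub h2
  rw [sub_zero] at h3 h4
  refine tendsto_nhds_unique h3 (h4.congr fun n => ?_)
  have e1 : J q (hn n) (Mn n) T (kb m fv g) = J q (hn n) (Mn n) T (kb m fv (gn n)) +
      J q (hn n) (Mn n) T (kb m fv (g - gn n : Lp ℂ q muplus)) := by
    rw [← J_add hp hq (hn_pos n).le (hint _ _ _) (hint _ _ _), ← J_congr (kb_add_right fv (gn n) (g - gn n)),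
      add_sub_cancel]
  have e2 : J q (hn n) (Mn n) T (kb m f gv) = J q (hn n) (Mn n) T (kb m (fn n) gv) +
      J q (hn n) (Mn n) T (kb m (f - fn n : Lp ℂ p muplus) gv) := by
    rw [← J_add hp hq (hn_pos n).le (hint _ _ _) (hint _ _ _), ← J_congr (kb_add_left (fn n) (f - fn n) gv),
      add_sub_cancel]
  rw [e1, e2, add_sub_cancel_right, add_sub_cancel_right,
    J_congr (kb_congr m hf (ind_coe _ measurableSet_Iic g)), J_congr (kb_congr m (ind_coe _ measurableSet_Iic f) hg)]
  exact (J_hank hT (hn_pos n).le hv m f g (Mn n)).symm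

end C4
end HankMult

/-- given a continuous `m : (0,∞) → ℂ` admitting the factorization
`m(s+t) = ⟨α(s), β(t)⟩` a.e. with `α`, `β` essentially bounded (`‖α‖_∞ ≤ A`, `‖β‖_∞ ≤ B`),
there is a bounded linear map `w` on `B(L^p(ℝ₊))` with `‖w(T)‖ ≤ A B ‖T‖`, given by
`⟨w(T) f, g⟩ = ⟨(T ⊗̄ I)(f·α), g·β⟩`, satisfying `w(θ_u) = m(u) θ_u` for all `u > 0` and
mapping Hankelian operators to Hankelian operators; in particular `m` is the symbol of a
bounded multiplier on `Hank_p(ℝ₊)` of norm at most `‖α‖_∞‖β‖_∞`. -/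
theorem multiplier_from_factorization (p q : ℝ≥0∞) [Fact (1 ≤ p)] [Fact (1 ≤ q)]
    (hp : 1 < p) (hp' : p ≠ ∞) (hpq : p⁻¹ + q⁻¹ = 1)
    (m : ℝ → ℂ) (hm : ContinuousOn m (Set.Ioi 0))
    {Ω : Type} [MeasurableSpace Ω] (μΩ : Measure Ω) [SigmaFinite μΩ]
    (α : ℝ → Lp ℂ p μΩ) (β : ℝ → Lp ℂ q μΩ) (A B : ℝ)
    (hA : ∀ᵐ s ∂muplus, ‖α s‖ ≤ A) (hB : ∀ᵐ t ∂muplus, ‖β t‖ ≤ B)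
    (hm' : ∀ᵐ z ∂(muplus.prod muplus),
      m (z.1 + z.2) = ∫ ω, (α z.1 : Ω → ℂ) ω * (β z.2 : Ω → ℂ) ω ∂μΩ) :
    ∃ w : (Lp ℂ p muplus →L[ℂ] Lp ℂ p muplus) →ₗ[ℂ] (Lp ℂ p muplus →L[ℂ] Lp ℂ p muplus),
      (∀ T, ‖w T‖ ≤ A * B * ‖T‖) ∧
      (∀ (T : Lp ℂ p muplus →L[ℂ] Lp ℂ p muplus)
          (S : Lp ℂ p (muplus.prod μΩ) →L[ℂ] Lp ℂ p (muplus.prod μΩ)),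
        (∀ (f' : Lp ℂ p muplus) (g' : Lp ℂ p μΩ) (h : Lp ℂ p (muplus.prod μΩ)),
          ((h : ℝ × Ω → ℂ) =ᵐ[muplus.prod μΩ]
              fun z => (f' : ℝ → ℂ) z.1 * (g' : Ω → ℂ) z.2) →
          ((S h : ℝ × Ω → ℂ) =ᵐ[muplus.prod μΩ]
              fun z => (T f' : ℝ → ℂ) z.1 * (g' : Ω → ℂ) z.2)) →
        ∀ (f : Lp ℂ p muplus) (g : Lp ℂ q muplus)
            (fα : Lp ℂ p (muplus.prod μΩ)) (gβ : Lp ℂ q (muplus.prod μΩ)),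
          ((fα : ℝ × Ω → ℂ) =ᵐ[muplus.prod μΩ]
              fun z => (f : ℝ → ℂ) z.1 * (α z.1 : Ω → ℂ) z.2) →
          ((gβ : ℝ × Ω → ℂ) =ᵐ[muplus.prod μΩ]
              fun z => (g : ℝ → ℂ) z.1 * (β z.1 : Ω → ℂ) z.2) →
          ∫ t, (w T f : ℝ → ℂ) t * (g : ℝ → ℂ) t ∂muplus
            = ∫ z, (S fα : ℝ × Ω → ℂ) z * (gβ : ℝ × Ω → ℂ) z ∂(muplus.prod μΩ)) ∧
      (∀ u : ℝ, 0 < u → ∀ Θ : Lp ℂ p muplus →L[ℂ] Lp ℂ p muplus,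
        (∀ f : Lp ℂ p muplus,
          (Θ f : ℝ → ℂ) =ᵐ[muplus] fun t => if t < u then (f : ℝ → ℂ) (u - t) else 0) →
        w Θ = m u • Θ) ∧
      (∀ T, IsHankelianLp p q T → IsHankelianLp p q (w T)) := by
  haveI : ENNReal.HolderConjugate p q := ENNReal.holderConjugate_iff.2 hpq
  have hq : q ≠ ∞ := by
    rintro rfl
    rw [ENNReal.inv_top, add_zero] at hpq
    exact hp.ne' (ENNReal.inv_eq_one.1 hpq)
  obtain ⟨w, hw1, hw2⟩ := HankMult.main_w hp hp' hq hm hA hB hm'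
  refine ⟨w, hw1, ?_, ?_, ?_⟩
  · intro T S hS f g fα gβ hf hg
    rw [← HankMult.pr_eq, ← HankMult.pr_eq]
    exact tendsto_nhds_unique (hw2 T f g)
      ((HankMult.clause2 hp hp' hq hm' T S hS f g fα gβ hf hg).mono_left HankMult.hyper_le)
  · intro u hu Θ hΘ
    exact HankMult.clause3 hp' hq hm hA hB hm' hu hΘ (w Θ) (hw2 Θ)
  · intro T hT
    exact HankMult.clause4 hp hp' hq hm hA hB hm' hT (w T) (hw2 T)
end

section
/- Let 1 < p < ∞ with conjugate exponent p'. If F and G belong to A_p(ℝ₊), then the pointwise product F·G belongs to A_p(ℝ₊) and ‖F·G‖_{A_p} ≤ ‖F‖_{A_p} ‖G‖_{A_p}; that is, A_p(ℝ₊) is a Banach algebra for the pointwise product. -/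
open scoped ENNReal
open MeasureTheory

/-- `(f, g)` is an `A_p(ℝ₊)`-representation of `F`: `F = Σ_n f_n ∗ g_n` on `(0,∞)` with
`Σ_n ‖f_n‖_p ‖g_n‖_{p'} < ∞`. -/
def ApRep (p q : ℝ≥0∞) [Fact (1 ≤ p)] [Fact (1 ≤ q)] (F : ℝ → ℂ)
    (f : ℕ → Lp ℂ p muplus) (g : ℕ → Lp ℂ q muplus) : Prop :=
  (Summable fun n => ‖f n‖ * ‖g n‖) ∧
  ∀ u : ℝ, 0 < u →
    F u = ∑' n : ℕ, ∫ t in Set.Ioo 0 u, (f n : ℝ → ℂ) (u - t) * (g n : ℝ → ℂ) t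

/-- The set of sums `Σ_n ‖f_n‖_p‖g_n‖_{p'}` over all `A_p`-representations of `F`;
its infimum is the `A_p`-norm of `F`. -/
def ApNormSet (p q : ℝ≥0∞) [Fact (1 ≤ p)] [Fact (1 ≤ q)] (F : ℝ → ℂ) : Set ℝ :=
  {c : ℝ | ∃ f g, ApRep p q F f g ∧ c = ∑' n : ℕ, ‖f n‖ * ‖g n‖}


namespace ApAux

/-- extension by zero to the whole line -/
noncomputable def ext0 (f : ℝ → ℂ) : ℝ → ℂ := (Set.Ioi (0:ℝ)).indicator f

lemma ext0_memLp {p : ℝ≥0∞} {f : ℝ → ℂ} (hf : MemLp f p muplus) : MemLp (ext0 f) p volume :=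
  (memLp_indicator_iff_restrict measurableSet_Ioi).2 hf

lemma ext0_eLpNorm (p : ℝ≥0∞) (f : ℝ → ℂ) : eLpNorm (ext0 f) p volume = eLpNorm f p muplus :=
  eLpNorm_indicator_eq_eLpNorm_restrict measurableSet_Ioi

lemma ext0_congr {f g : ℝ → ℂ} (h : f =ᵐ[muplus] g) : ext0 f =ᵐ[volume] ext0 g := by
  have h' := (ae_restrict_iff' (measurableSet_Ioi (a := (0:ℝ)))).1 h
  filter_upwards [h'] with x hx
  by_cases hx0 : x ∈ Set.Ioi (0:ℝ)
  · simp [ext0, hx0, hx hx0]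
  · simp [ext0, hx0]

/-- convolution on the half line -/
noncomputable def cv (f g : ℝ → ℂ) (u : ℝ) : ℂ := ∫ t, ext0 f (u - t) * ext0 g t

lemma cv_eq (f g : ℝ → ℂ) (u : ℝ) :
    ∫ t in Set.Ioo 0 u, f (u - t) * g t = cv f g u := by
  rw [cv, ← integral_indicator measurableSet_Ioo]
  congr 1
  ext t
  by_cases h1 : 0 < t <;> by_cases h2 : t < u <;> simp [ext0, Set.indicator, h1, h2]

lemma cv_congr {f f' g g' : ℝ → ℂ} (hf : f =ᵐ[muplus] f') (hg : g =ᵐ[muplus] g') (u : ℝ) :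
    cv f g u = cv f' g' u := by
  apply integral_congr_ae
  have h1 := (Measure.measurePreserving_sub_left (volume : Measure ℝ) u).quasiMeasurePreserving.ae_eq_comp
    (ext0_congr hf)
  filter_upwards [h1, ext0_congr hg] with t ht1 ht2
  simp only [Function.comp] at ht1
  rw [ht1, ht2]

lemma cv_integrable {p q : ℝ≥0∞} [hpq : ENNReal.HolderConjugate p q] {f g : ℝ → ℂ}
    (hf : MemLp f p muplus) (hg : MemLp g q muplus) (u : ℝ) :
    Integrable (fun t => ext0 f (u - t) * ext0 g t) volume := by
  have h1 := (ext0_memLp hf).comp_measurePreserving (Measure.measurePreserving_sub_left (volume : Measure ℝ) u)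
  have := h1.integrable_mul (ext0_memLp hg)
  exact this

lemma cv_norm_le {p q : ℝ≥0∞} [hpq : ENNReal.HolderConjugate p q] {f g : ℝ → ℂ}
    (hf : MemLp f p muplus) (hg : MemLp g q muplus) (u : ℝ) :
    ‖cv f g u‖ ≤ (eLpNorm f p muplus).toReal * (eLpNorm g q muplus).toReal := by
  have h1 := (ext0_memLp hf).comp_measurePreserving (Measure.measurePreserving_sub_left (volume : Measure ℝ) u)
  have h2 := ext0_memLp hg
  have h3 : eLpNorm (ext0 f ∘ fun t => u - t) p volume = eLpNorm f p muplus := by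
    rw [eLpNorm_comp_measurePreserving (ext0_memLp hf).1 (Measure.measurePreserving_sub_left (volume : Measure ℝ) u),
      ext0_eLpNorm]
  have h4 : eLpNorm (fun t => ext0 f (u - t) * ext0 g t) 1 volume ≤
      eLpNorm f p muplus * eLpNorm g q muplus := by
    have := eLpNorm_smul_le_mul_eLpNorm (r := 1) (p := p) (q := q) h2.1 h1.1
    rw [h3, ext0_eLpNorm] at this
    exact this
  rw [← ENNReal.toReal_mul]
  calc ‖cv f g u‖ ≤ (eLpNorm (fun t => ext0 f (u - t) * ext0 g t) 1 volume).toReal := by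
        rw [eLpNorm_one_eq_lintegral_enorm]
        have := norm_integral_le_lintegral_norm (μ := volume) (fun t => ext0 f (u - t) * ext0 g t)
        simpa only [ofReal_norm, cv] using this
    _ ≤ _ := ENNReal.toReal_mono (ENNReal.mul_ne_top hf.2.ne hg.2.ne) h4

lemma ext0_add (f g : ℝ → ℂ) : ext0 (f + g) = ext0 f + ext0 g := Set.indicator_add _ _ _

lemma ext0_smul (c : ℂ) (f : ℝ → ℂ) : ext0 (c • f) = c • ext0 f := Set.indicator_const_smul _ c f

/-- convolution evaluated at `u` as a bounded bilinear map -/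
noncomputable def T (p q : ℝ≥0∞) [Fact (1 ≤ p)] [Fact (1 ≤ q)] [ENNReal.HolderConjugate p q] (u : ℝ) :
    Lp ℂ p muplus →L[ℂ] Lp ℂ q muplus →L[ℂ] ℂ :=
  LinearMap.mkContinuous₂
    (LinearMap.mk₂ ℂ (fun (f : Lp ℂ p muplus) (g : Lp ℂ q muplus) => cv f g u)
      (by
        intro f f' g
        rw [cv_congr (Lp.coeFn_add f f') (Filter.EventuallyEq.refl _ _), cv, cv, cv,
          ← integral_add (cv_integrable (Lp.memLp f) (Lp.memLp g) u)
            (cv_integrable (Lp.memLp f') (Lp.memLp g) u), ext0_add]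
        simp [add_mul])
      (by
        intro c f g
        rw [cv_congr (Lp.coeFn_smul c f) (Filter.EventuallyEq.refl _ _), cv, cv, ext0_smul,
          ← integral_smul]
        simp [mul_assoc])
      (by
        intro f g g'
        rw [cv_congr (Filter.EventuallyEq.refl _ _) (Lp.coeFn_add g g'), cv, cv, cv,
          ← integral_add (cv_integrable (Lp.memLp f) (Lp.memLp g) u)
            (cv_integrable (Lp.memLp f) (Lp.memLp g') u), ext0_add]
        simp [mul_add])
      (by
        intro c f g
        rw [cv_congr (Filter.EventuallyEq.refl _ _) (Lp.coeFn_smul c g), cv, cv, ext0_smul,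
          ← integral_smul]
        congr 1; ext t; simp; ring)) 1
    (by
      intro f g
      simpa [Lp.norm_def] using cv_norm_le (Lp.memLp f) (Lp.memLp g) u)

lemma T_apply (p q : ℝ≥0∞) [Fact (1 ≤ p)] [Fact (1 ≤ q)] [ENNReal.HolderConjugate p q] (u : ℝ)
    (f : Lp ℂ p muplus) (g : Lp ℂ q muplus) : T p q u f g = cv f g u := rfl

lemma T_norm_le (p q : ℝ≥0∞) [Fact (1 ≤ p)] [Fact (1 ≤ q)] [ENNReal.HolderConjugate p q] (u : ℝ)
    (f : Lp ℂ p muplus) (g : Lp ℂ q muplus) : ‖T p q u f g‖ ≤ ‖f‖ * ‖g‖ :=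
  cv_norm_le (Lp.memLp f) (Lp.memLp g) u

section Has
variable {p q : ℝ≥0∞} [Fact (1 ≤ p)] [Fact (1 ≤ q)] [ENNReal.HolderConjugate p q]

/-- `F` has a representation of total mass at most `c` -/
def Has (p q : ℝ≥0∞) [Fact (1 ≤ p)] [Fact (1 ≤ q)] (F : ℝ → ℂ) (c : ℝ) : Prop :=
  ∃ f g, ApRep p q F f g ∧ ∑' n : ℕ, ‖f n‖ * ‖g n‖ ≤ c

lemma ApRep_iff (F : ℝ → ℂ) (f : ℕ → Lp ℂ p muplus) (g : ℕ → Lp ℂ q muplus) :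
    ApRep p q F f g ↔ (Summable fun n => ‖f n‖ * ‖g n‖) ∧
      ∀ u : ℝ, 0 < u → F u = ∑' n, T p q u (f n) (g n) := by
  simp only [ApRep, cv_eq, T_apply]

lemma has_of_countable {ι : Type*} [Countable ι] (F : ℝ → ℂ) (c : ℝ)
    (f : ι → Lp ℂ p muplus) (g : ι → Lp ℂ q muplus) (hs : Summable fun n => ‖f n‖ * ‖g n‖)
    (hc : ∑' n, ‖f n‖ * ‖g n‖ ≤ c)
    (h : ∀ u : ℝ, 0 < u → F u = ∑' n, T p q u (f n) (g n)) : Has p q F c := by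
  obtain ⟨e, he⟩ := exists_injective_nat ι
  have key : (fun n => ‖Function.extend e f 0 n‖ * ‖Function.extend e g 0 n‖) =
      Function.extend e (fun n => ‖f n‖ * ‖g n‖) 0 := by
    ext n
    by_cases hn : ∃ i, e i = n
    · obtain ⟨i, rfl⟩ := hn
      simp [he.extend_apply]
    · simp [Function.extend_apply' _ _ _ hn]
  refine ⟨Function.extend e f 0, Function.extend e g 0, (ApRep_iff _ _ _).2 ⟨?_, ?_⟩, ?_⟩
  · rw [key]
    exact (summable_extend_zero he).2 hs
  · intro u hu
    rw [h u hu, ← tsum_extend_zero he]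
    congr 1
    ext n
    by_cases hn : ∃ i, e i = n
    · obtain ⟨i, rfl⟩ := hn
      simp [he.extend_apply]
    · simp [Function.extend_apply' _ _ _ hn]
  · rw [key, tsum_extend_zero he]
    exact hc

lemma has_sum {ι : Type*} [Countable ι] (F : ℝ → ℂ) (Fi : ι → ℝ → ℂ) (c : ι → ℝ)
    (hs : Summable c) (hF : ∀ i, Has p q (Fi i) (c i))
    (h : ∀ u : ℝ, 0 < u → F u = ∑' i, Fi i u) : Has p q F (∑' i, c i) := by
  choose f g hfg hc using hF
  have hS : Summable fun x : ι × ℕ => ‖f x.1 x.2‖ * ‖g x.1 x.2‖ := by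
    rw [summable_prod_of_nonneg (fun x => by positivity)]
    refine ⟨fun i => (hfg i).1, ?_⟩
    exact Summable.of_nonneg_of_le (fun i => tsum_nonneg fun n => by positivity) hc hs
  refine has_of_countable (ι := ι × ℕ) F _ (fun x => f x.1 x.2) (fun x => g x.1 x.2) hS ?_ ?_
  · rw [hS.tsum_prod]
    refine Summable.tsum_le_tsum hc ?_ hs
    exact Summable.of_nonneg_of_le (fun i => tsum_nonneg fun n => by positivity) hc hs
  · intro u hu
    have hT : Summable fun x : ι × ℕ => T p q u (f x.1 x.2) (g x.1 x.2) :=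
      Summable.of_norm_bounded hS fun x => T_norm_le p q u _ _
    rw [hT.tsum_prod, h u hu]
    exact tsum_congr fun i => ((ApRep_iff _ _ _).1 (hfg i)).2 u hu

lemma Has.mono {F : ℝ → ℂ} {c d : ℝ} (h : Has p q F c) (hcd : c ≤ d) : Has p q F d := by
  obtain ⟨f, g, h1, h2⟩ := h
  exact ⟨f, g, h1, h2.trans hcd⟩

end Has

section Approx

/-- the dense subspace of simple functions gives absolutely convergent expansions -/
lemma exists_simple_sum {X : Type*} [NormedAddCommGroup X] [CompleteSpace X] {p : ℝ≥0∞} [Fact (1 ≤ p)] (hp : p ≠ ∞)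
    (φ : Lp X p (volume : Measure ℝ)) {ε : ℝ} (hε : 0 < ε) :
    ∃ s : ℕ → Lp X p (volume : Measure ℝ), (∀ n, s n ∈ Lp.simpleFunc X p (volume : Measure ℝ)) ∧
      Summable (fun n => ‖s n‖) ∧ ∑' n, ‖s n‖ ≤ ‖φ‖ + ε ∧ HasSum s φ := by
  have hd : φ ∈ closure ((Lp.simpleFunc X p (volume : Measure ℝ) : AddSubgroup _) : Set (Lp X p (volume : Measure ℝ))) :=
    (Lp.simpleFunc.dense hp) φ
  obtain ⟨v, hv1, hv2, hv3, hv4⟩ := controlled_sum_of_mem_closure hd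
    (b := fun n => ε / 2 / 2 ^ n) (fun n => by positivity)
  have hgeo : HasSum (fun n : ℕ => ε / 2 / 2 ^ n) ε := by
    exact hasSum_geometric_two' ε
  have hb : ∀ n, ‖v n‖ ≤ (if n = 0 then ‖φ‖ else 0) + ε / 2 / 2 ^ n := by
    intro n
    rcases Nat.eq_zero_or_pos n with rfl | hn
    · have : ‖v 0‖ ≤ ‖v 0 - φ‖ + ‖φ‖ := by
        simpa using norm_add_le (v 0 - φ) φ
      have h5 : ‖v 0 - φ‖ = ‖-v 0 + φ‖ := by rw [← norm_neg]; congr 1; abel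
      simp only [if_true]
      linarith
    · simpa [hn.ne'] using (hv4 n hn).le
  have hB : HasSum (fun n : ℕ => (if n = 0 then ‖φ‖ else 0) + ε / 2 / 2 ^ n) (‖φ‖ + ε) :=
    (hasSum_ite_eq 0 ‖φ‖).add hgeo
  have hS : Summable (fun n => ‖v n‖) :=
    Summable.of_nonneg_of_le (fun n => norm_nonneg _) hb hB.summable
  refine ⟨v, hv2, hS, ?_, ?_⟩
  · rw [← hB.tsum_eq]
    exact hS.tsum_le_tsum hb hB.summable
  · have h1 := hS.of_norm.hasSum
    have h2 := (Filter.tendsto_add_atTop_iff_nat 1).2 h1.tendsto_sum_nat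
    rwa [tendsto_nhds_unique h2 hv1] at h1

variable {p q : ℝ≥0∞} [Fact (1 ≤ p)] [Fact (1 ≤ q)] [ENNReal.HolderConjugate p q]

lemma holder_norm {X Y : Type*} [NormedAddCommGroup X] [NormedAddCommGroup Y]
    (φ : Lp X p (volume : Measure ℝ)) (ψ : Lp Y q (volume : Measure ℝ)) :
    ∫ r, ‖φ r‖ * ‖ψ r‖ ≤ ‖φ‖ * ‖ψ‖ := by
  have h1 := (Lp.memLp φ).norm
  have h2 := (Lp.memLp ψ).norm
  have h4 := eLpNorm_smul_le_mul_eLpNorm (r := 1) (p := p) (q := q) h2.1 h1.1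
  rw [eLpNorm_norm, eLpNorm_norm] at h4
  rw [Lp.norm_def, Lp.norm_def, ← ENNReal.toReal_mul]
  refine le_trans ?_ (ENNReal.toReal_mono (ENNReal.mul_ne_top (Lp.memLp φ).2.ne (Lp.memLp ψ).2.ne) h4)
  rw [eLpNorm_one_eq_lintegral_enorm]
  have := norm_integral_le_lintegral_norm (μ := volume) (fun r => ‖φ r‖ * ‖ψ r‖)
  simp only [ofReal_norm] at this
  exact (le_abs_self _).trans this

lemma has_simple (hp : p ≠ ∞) (hq : q ≠ ∞)
    (φ : Lp (Lp ℂ p muplus) p (volume : Measure ℝ)) (ψ : Lp (Lp ℂ q muplus) q (volume : Measure ℝ))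
    (hφ : φ ∈ Lp.simpleFunc (Lp ℂ p muplus) p (volume : Measure ℝ))
    (hψ : ψ ∈ Lp.simpleFunc (Lp ℂ q muplus) q (volume : Measure ℝ)) :
    Has p q (fun u => (T p q u).lpPairing (volume : Measure ℝ) p q φ ψ) (‖φ‖ * ‖ψ‖) := by
  have hp0 : p ≠ 0 := (zero_lt_one.trans_le (Fact.out : 1 ≤ p)).ne'
  have hq0 : q ≠ 0 := (zero_lt_one.trans_le (Fact.out : 1 ≤ q)).ne'
  set S := Lp.simpleFunc.toSimpleFunc ⟨φ, hφ⟩ with hS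
  set R := Lp.simpleFunc.toSimpleFunc ⟨ψ, hψ⟩ with hR
  have hSφ : S =ᵐ[volume] φ := Lp.simpleFunc.toSimpleFunc_eq_toFun ⟨φ, hφ⟩
  have hRψ : R =ᵐ[volume] ψ := Lp.simpleFunc.toSimpleFunc_eq_toFun ⟨ψ, hψ⟩
  have hSi : Integrable S volume := SimpleFunc.integrable_iff_finMeasSupp.2
    ((SimpleFunc.memLp_iff_finMeasSupp hp0 hp).1 (Lp.simpleFunc.memLp ⟨φ, hφ⟩))
  have hRi : Integrable R volume := SimpleFunc.integrable_iff_finMeasSupp.2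
    ((SimpleFunc.memLp_iff_finMeasSupp hq0 hq).1 (Lp.simpleFunc.memLp ⟨ψ, hψ⟩))
  have hPi : Integrable (S.pair R) volume := SimpleFunc.integrable_pair hSi hRi
  have key : ∀ {E : Type} [NormedAddCommGroup E] [NormedSpace ℝ E] [CompleteSpace E]
      (b : Lp ℂ p muplus × Lp ℂ q muplus → E), b 0 = 0 →
      ∫ r, b (φ r, ψ r) = ∑ x ∈ (S.pair R).range, (volume.real ((S.pair R) ⁻¹' {x})) • b x := by
    intro E _ _ _ b hb
    rw [← SimpleFunc.map_integral (S.pair R) b hPi hb,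
      SimpleFunc.integral_eq_integral ((S.pair R).map b)
        (SimpleFunc.integrable_iff_finMeasSupp.2
          ((SimpleFunc.integrable_iff_finMeasSupp.1 hPi).map hb))]
    apply integral_congr_ae
    filter_upwards [hSφ, hRψ] with r h1 h2
    simp [h1, h2]
  refine has_of_countable (ι := (S.pair R).range) _ _
    (fun x => ((volume.real ((S.pair R) ⁻¹' {x.1}) : ℝ) : ℂ) • x.1.1) (fun x => x.1.2)
    (Summable.of_finite) ?_ ?_
  · rw [tsum_fintype]
    have := key (E := ℝ) (fun x => ‖x.1‖ * ‖x.2‖) (by simp)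
    refine le_trans (le_of_eq ?_) (holder_norm φ ψ)
    rw [this, ← Finset.sum_coe_sort (S.pair R).range]
    refine Finset.sum_congr rfl fun x _ => ?_
    rw [norm_smul]
    simp [mul_assoc, abs_of_nonneg]
  · intro u _
    rw [tsum_fintype, ContinuousLinearMap.lpPairing_eq_integral]
    have := key (fun x => T p q u x.1 x.2) (by simp)
    rw [this, ← Finset.sum_coe_sort (S.pair R).range]
    refine Finset.sum_congr rfl fun x _ => ?_
    rw [map_smul]
    simp

lemma has_general (hp : p ≠ ∞) (hq : q ≠ ∞)
    (φ : Lp (Lp ℂ p muplus) p (volume : Measure ℝ)) (ψ : Lp (Lp ℂ q muplus) q (volume : Measure ℝ))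
    {ε : ℝ} (hε : 0 < ε) :
    Has p q (fun u => (T p q u).lpPairing (volume : Measure ℝ) p q φ ψ) ((‖φ‖ + ε) * (‖ψ‖ + ε)) := by
  obtain ⟨s, hs, hsS, hsn, hsφ⟩ := exists_simple_sum hp φ hε
  obtain ⟨t, ht, htS, htn, htψ⟩ := exists_simple_sum hq ψ hε
  have hS : Summable fun x : ℕ × ℕ => ‖s x.1‖ * ‖t x.2‖ :=
    hsS.mul_of_nonneg htS (fun _ => norm_nonneg _) (fun _ => norm_nonneg _)
  refine Has.mono (c := ∑' x : ℕ × ℕ, ‖s x.1‖ * ‖t x.2‖) ?_ ?_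
  · refine has_sum _ (fun (x : ℕ × ℕ) u => (T p q u).lpPairing (volume : Measure ℝ) p q (s x.1) (t x.2)) _ hS
      (fun x => has_simple hp hq _ _ (hs _) (ht _)) ?_
    intro u _
    set B := (T p q u).lpPairing (volume : Measure ℝ) p q
    have hB : Summable fun x : ℕ × ℕ => B (s x.1) (t x.2) := by
      refine Summable.of_norm_bounded (hS.mul_left ‖B‖) fun x => ?_
      rw [← mul_assoc]
      exact B.le_opNorm₂ _ _
    rw [hB.tsum_prod]
    have h1 : ∀ i, ∑' j, B (s i) (t j) = B (s i) ψ := fun i =>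
      (htψ.mapL (B (s i))).tsum_eq
    simp only [h1]
    exact ((hsφ.mapL (B.flip ψ)).tsum_eq).symm
  · have : ∑' x : ℕ × ℕ, ‖s x.1‖ * ‖t x.2‖ = (∑' n, ‖s n‖) * ∑' n, ‖t n‖ :=
      (hsS.tsum_mul_tsum htS hS).symm
    rw [this]
    gcongr

end Approx

section Lift

lemma measurable_of_edist {α Z : Type*} [MeasurableSpace α] [PseudoEMetricSpace Z]
    [SecondCountableTopology Z] [MeasurableSpace Z] [BorelSpace Z] (f : α → Z)
    (h : ∀ z, Measurable fun a => edist (f a) z) : Measurable f := by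
  refine measurable_of_isOpen fun U hU => ?_
  have h1 : ∀ z : U, ∃ ε > 0, Metric.eball (z : Z) ε ⊆ U := fun z => EMetric.isOpen_iff.1 hU z z.2
  choose ε hε hb using h1
  obtain ⟨I, hI, hIU⟩ := TopologicalSpace.isOpen_iUnion_countable
    (fun z : U => Metric.eball (z : Z) (ε z)) (fun z => Metric.isOpen_eball)
  have hUU : U = ⋃ z ∈ I, Metric.eball (z : Z) (ε z) := by
    rw [hIU]
    apply Set.Subset.antisymm
    · intro z hz
      exact Set.mem_iUnion.2 ⟨⟨z, hz⟩, Metric.mem_eball_self (hε ⟨z, hz⟩)⟩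
    · exact Set.iUnion_subset hb
  rw [hUU, Set.preimage_iUnion₂]
  refine MeasurableSet.biUnion hI fun z _ => ?_
  exact measurableSet_lt (h z) measurable_const

instance : SFinite muplus := by unfold muplus; infer_instance
instance : SigmaFinite muplus := by unfold muplus; infer_instance

lemma exists_lift {p : ℝ≥0∞} [Fact (1 ≤ p)] (hp : p ≠ ∞) (h : ℝ → ℝ → ℂ)
    (hm : Measurable (Function.uncurry h)) {C : ℝ≥0∞} (hC : C ≠ ∞)
    (hfin : ∫⁻ r, ∫⁻ x, ‖h r x‖ₑ ^ p.toReal ∂muplus ≤ C ^ p.toReal) :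
    ∃ φ : Lp (Lp ℂ p muplus) p (volume : Measure ℝ),
      (∀ᵐ r, φ r =ᵐ[muplus] h r) ∧ ‖φ‖ ≤ C.toReal := by
  classical
  have hp0 : p ≠ 0 := (zero_lt_one.trans_le (Fact.out : 1 ≤ p)).ne'
  have hpp : 0 < p.toReal := ENNReal.toReal_pos hp0 hp
  have : Fact (p ≠ ∞) := ⟨hp⟩
  have hmr : ∀ r, Measurable (h r) := fun r => hm.comp measurable_prodMk_left
  have hpow : ∀ r, eLpNorm (h r) p muplus ^ p.toReal = ∫⁻ x, ‖h r x‖ₑ ^ p.toReal ∂muplus := by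
    intro r
    rw [eLpNorm_eq_lintegral_rpow_enorm_toReal hp0 hp, ← ENNReal.rpow_mul, one_div,
      inv_mul_cancel₀ hpp.ne', ENNReal.rpow_one]
  have hmeas : ∀ c : ℝ → ℂ, Measurable c → Measurable fun r => eLpNorm (h r - c) p muplus := by
    intro c hc
    simp only [eLpNorm_eq_lintegral_rpow_enorm_toReal hp0 hp]
    refine Measurable.pow_const ?_ _
    refine Measurable.lintegral_prod_right' (ν := muplus)
      (f := fun z : ℝ × ℝ => ‖(h z.1 - c) z.2‖ₑ ^ p.toReal) ?_
    have h1 : Measurable fun z : ℝ × ℝ => (h z.1 - c) z.2 := hm.sub (hc.comp measurable_snd)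
    exact h1.enorm.pow_const _
  have hmeas0 : Measurable fun r => eLpNorm (h r) p muplus := by
    simpa using hmeas 0 measurable_zero
  have hA : MeasurableSet {r | eLpNorm (h r) p muplus < ∞} :=
    measurableSet_lt hmeas0 measurable_const
  have hae : ∀ᵐ r, eLpNorm (h r) p muplus < ∞ := by
    have h1 : ∫⁻ r, eLpNorm (h r) p muplus ^ p.toReal ≠ ∞ := by
      simp only [hpow]
      exact (hfin.trans_lt (ENNReal.rpow_lt_top_of_nonneg hpp.le hC)).ne
    filter_upwards [ae_lt_top (hmeas0.pow_const _) h1] with r hr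
    exact (ENNReal.rpow_lt_top_iff_of_pos hpp).1 hr
  let Φ : ℝ → Lp ℂ p muplus := fun r =>
    if hr : eLpNorm (h r) p muplus < ∞ then MemLp.toLp (h r) ⟨(hmr r).aestronglyMeasurable, hr⟩ else 0
  have hΦ1 : ∀ r, eLpNorm (h r) p muplus < ∞ → Φ r =ᵐ[muplus] h r := by
    intro r hr
    simp only [Φ, dif_pos hr]
    exact MemLp.coeFn_toLp _
  let _ : MeasurableSpace (Lp ℂ p muplus) := borel _
  have : BorelSpace (Lp ℂ p muplus) := ⟨rfl⟩
  have hΦm : Measurable Φ := by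
    refine measurable_of_edist Φ fun c => ?_
    have : (fun r => edist (Φ r) c) = fun r => if eLpNorm (h r) p muplus < ∞ then
        eLpNorm (h r - (c : ℝ → ℂ)) p muplus else edist 0 c := by
      ext r
      split_ifs with hr
      · rw [Lp.edist_def]
        apply eLpNorm_congr_ae
        filter_upwards [hΦ1 r hr] with x hx
        simp [hx]
      · simp only [Φ, dif_neg hr]
    rw [this]
    exact Measurable.ite hA (hmeas c (Lp.stronglyMeasurable c).measurable) measurable_const
  have hΦn : ∀ r, eLpNorm (h r) p muplus < ∞ → ‖Φ r‖ₑ = eLpNorm (h r) p muplus := by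
    intro r hr
    rw [Lp.enorm_def]
    exact eLpNorm_congr_ae (hΦ1 r hr)
  have hΦL : eLpNorm Φ p volume ≤ C := by
    rw [eLpNorm_eq_lintegral_rpow_enorm_toReal hp0 hp]
    have : ∫⁻ r, ‖Φ r‖ₑ ^ p.toReal = ∫⁻ r, ∫⁻ x, ‖h r x‖ₑ ^ p.toReal ∂muplus := by
      apply lintegral_congr_ae
      filter_upwards [hae] with r hr
      rw [hΦn r hr, hpow]
    rw [this, one_div, ENNReal.rpow_inv_le_iff hpp]
    exact hfin
  have hΦmem : MemLp Φ p volume := ⟨hΦm.aestronglyMeasurable, hΦL.trans_lt hC.lt_top⟩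
  refine ⟨hΦmem.toLp Φ, ?_, ?_⟩
  · filter_upwards [hae, hΦmem.coeFn_toLp] with r hr h2
    rw [h2]
    exact hΦ1 r hr
  · rw [Lp.norm_toLp]
    exact ENNReal.toReal_mono hC hΦL

end Lift

section Prod

lemma exists_lift_shear {p : ℝ≥0∞} [Fact (1 ≤ p)] (hp : p ≠ ∞) (f1 f2 : Lp ℂ p muplus)
    (sh : ℝ → ℝ → ℝ) (hsh : Measurable (Function.uncurry sh))
    (hinv : ∀ w : ℝ → ℝ≥0∞, ∀ x, ∫⁻ r, w (sh r x) = ∫⁻ r, w r) :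
    ∃ φ : Lp (Lp ℂ p muplus) p (volume : Measure ℝ),
      (∀ᵐ r, φ r =ᵐ[muplus] fun x => ext0 f1 x * ext0 f2 (sh r x)) ∧ ‖φ‖ ≤ ‖f1‖ * ‖f2‖ := by
  have hp0 : p ≠ 0 := (zero_lt_one.trans_le (Fact.out : 1 ≤ p)).ne'
  have hpp : 0 < p.toReal := ENNReal.toReal_pos hp0 hp
  have m1 : Measurable (ext0 f1) := (Lp.stronglyMeasurable f1).measurable.indicator measurableSet_Ioi
  have m2 : Measurable (ext0 f2) := (Lp.stronglyMeasurable f2).measurable.indicator measurableSet_Ioi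
  have hpow : ∀ f : ℝ → ℂ, ∫⁻ x, ‖ext0 f x‖ₑ ^ p.toReal = eLpNorm f p muplus ^ p.toReal := by
    intro f
    rw [← ext0_eLpNorm, eLpNorm_eq_lintegral_rpow_enorm_toReal hp0 hp, ← ENNReal.rpow_mul, one_div,
      inv_mul_cancel₀ hpp.ne', ENNReal.rpow_one]
  have hm : Measurable (Function.uncurry fun r x => ext0 f1 x * ext0 f2 (sh r x)) :=
    (m1.comp measurable_snd).mul (m2.comp hsh)
  obtain ⟨φ, h1, h2⟩ := exists_lift (p := p) hp (fun r x => ext0 f1 x * ext0 f2 (sh r x)) hm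
    (C := eLpNorm f1 p muplus * eLpNorm f2 p muplus)
    (ENNReal.mul_ne_top (Lp.memLp f1).2.ne (Lp.memLp f2).2.ne) (by
      rw [lintegral_lintegral_swap (hm.enorm.pow_const _).aemeasurable]
      calc ∫⁻ x, ∫⁻ r, ‖ext0 f1 x * ext0 f2 (sh r x)‖ₑ ^ p.toReal ∂volume ∂muplus
          = ∫⁻ x, ‖ext0 f1 x‖ₑ ^ p.toReal * eLpNorm f2 p muplus ^ p.toReal ∂muplus := by
            congr 1; ext x
            rw [← hpow f2, ← hinv (fun y => ‖ext0 f2 y‖ₑ ^ p.toReal) x, ← lintegral_const_mul']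
            · simp only [enorm_mul, ENNReal.mul_rpow_of_nonneg _ _ hpp.le]
            · exact ENNReal.rpow_ne_top_of_nonneg hpp.le enorm_ne_top
        _ = (∫⁻ x, ‖ext0 f1 x‖ₑ ^ p.toReal ∂muplus) * eLpNorm f2 p muplus ^ p.toReal :=
            lintegral_mul_const _ (m1.enorm.pow_const _)
        _ ≤ eLpNorm f1 p muplus ^ p.toReal * eLpNorm f2 p muplus ^ p.toReal := by
            rw [← hpow f1]
            gcongr
            exact Measure.restrict_le_self
        _ = _ := (ENNReal.mul_rpow_of_nonneg _ _ hpp.le).symm)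
  refine ⟨φ, h1, ?_⟩
  rwa [ENNReal.toReal_mul, ← Lp.norm_def, ← Lp.norm_def] at h2

variable {p q : ℝ≥0∞} [Fact (1 ≤ p)] [Fact (1 ≤ q)] [ENNReal.HolderConjugate p q]

lemma has_prod (hp : p ≠ ∞) (hq : q ≠ ∞) (f1 f2 : Lp ℂ p muplus) (g1 g2 : Lp ℂ q muplus)
    {ε : ℝ} (hε : 0 < ε) :
    Has p q (fun u => T p q u f1 g1 * T p q u f2 g2) (‖f1‖ * ‖g1‖ * (‖f2‖ * ‖g2‖) + ε) := by
  obtain ⟨φ, hφ, hφn⟩ := exists_lift_shear hp f1 f2 (fun r x => x - r)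
    (measurable_snd.sub measurable_fst) (fun w x => lintegral_sub_left_eq_self w x)
  obtain ⟨ψ, hψ, hψn⟩ := exists_lift_shear hq g1 g2 (fun r x => x + r)
    (measurable_snd.add measurable_fst) (fun w x => lintegral_add_left_eq_self w x)
  have key : ∀ u, T p q u f1 g1 * T p q u f2 g2 = (T p q u).lpPairing (volume : Measure ℝ) p q φ ψ := by
    intro u
    set A : ℝ → ℂ := fun t => ext0 f1 (u - t) * ext0 g1 t with hA
    set B : ℝ → ℂ := fun t => ext0 f2 (u - t) * ext0 g2 t with hB
    have iA : Integrable A volume := cv_integrable (Lp.memLp f1) (Lp.memLp g1) u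
    have iB : Integrable B volume := cv_integrable (Lp.memLp f2) (Lp.memLp g2) u
    have iAB : Integrable (Function.uncurry fun t r => A t * B (t + r)) (volume.prod volume) :=
      (measurePreserving_prod_add (volume : Measure ℝ) (volume : Measure ℝ)).integrable_comp_of_integrable
        (iA.mul_prod iB)
    rw [ContinuousLinearMap.lpPairing_eq_integral, T_apply, T_apply]
    change (∫ t, A t) * (∫ t, B t) = _
    calc (∫ t, A t) * (∫ t, B t) = ∫ t, A t * ∫ s, B s := (integral_mul_const _ _).symm
      _ = ∫ t, ∫ r, A t * B (t + r) := by
          congr 1; ext t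
          rw [integral_const_mul, integral_add_left_eq_self B t]
      _ = ∫ r, ∫ t, A t * B (t + r) := integral_integral_swap iAB
      _ = _ := by
          apply integral_congr_ae
          filter_upwards [hφ, hψ] with r h1 h2
          rw [T_apply, cv_congr h1 h2, cv]
          congr 1; ext t
          have e1 : ∀ (f f' : ℝ → ℂ) (r x : ℝ), ext0 (fun x => ext0 f x * ext0 f' (x + r)) x =
              ext0 f x * ext0 f' (x + r) := by
            intro f f' r x
            by_cases hx : 0 < x <;> simp [ext0, hx]
          have e2 := e1 f1 f2 (-r) (u - t)
          simp only [← sub_eq_add_neg] at e2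
          rw [e1, e2]
          simp only [hA, hB]
          rw [show u - (t + r) = u - t - r by ring]
          ring
  simp only [key]
  have hlim : Filter.Tendsto (fun δ : ℝ => (‖φ‖ + δ) * (‖ψ‖ + δ)) (nhdsWithin 0 (Set.Ioi 0))
      (nhds (‖φ‖ * ‖ψ‖)) := by
    have : Continuous (fun δ : ℝ => (‖φ‖ + δ) * (‖ψ‖ + δ)) := by fun_prop
    have h := this.tendsto 0
    simp only [add_zero] at h
    exact h.mono_left nhdsWithin_le_nhds
  have hlt : ‖φ‖ * ‖ψ‖ < ‖φ‖ * ‖ψ‖ + ε := by linarith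
  obtain ⟨δ, hδ, hδ0⟩ := ((hlim.eventually (gt_mem_nhds hlt)).and self_mem_nhdsWithin).exists
  refine (has_general hp hq φ ψ hδ0).mono ?_
  have : ‖φ‖ * ‖ψ‖ ≤ (‖f1‖ * ‖f2‖) * (‖g1‖ * ‖g2‖) := by gcongr
  nlinarith

lemma has_mul (hp : p ≠ ∞) (hq : q ≠ ∞) {F G : ℝ → ℂ} {f1 f2 : ℕ → Lp ℂ p muplus}
    {g1 g2 : ℕ → Lp ℂ q muplus} (hF : ApRep p q F f1 g1) (hG : ApRep p q G f2 g2)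
    {ε : ℝ} (hε : 0 < ε) :
    Has p q (fun u => F u * G u)
      ((∑' n, ‖f1 n‖ * ‖g1 n‖) * (∑' n, ‖f2 n‖ * ‖g2 n‖) + ε) := by
  rw [ApRep_iff] at hF hG
  obtain ⟨δ, hδ, c, hδc, hcε⟩ := posSumOfEncodable hε (ℕ × ℕ)
  have hS : Summable fun x : ℕ × ℕ => ‖f1 x.1‖ * ‖g1 x.1‖ * (‖f2 x.2‖ * ‖g2 x.2‖) :=
    hF.1.mul_of_nonneg hG.1 (fun _ => by positivity) (fun _ => by positivity)
  have h := has_sum (fun u => F u * G u)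
    (fun (x : ℕ × ℕ) u => T p q u (f1 x.1) (g1 x.1) * T p q u (f2 x.2) (g2 x.2)) _
    (hS.add hδc.summable)
    (fun x => has_prod hp hq (f1 x.1) (f2 x.2) (g1 x.1) (g2 x.2) (hδ x)) (by
      intro u hu
      rw [hF.2 u hu, hG.2 u hu]
      refine tsum_mul_tsum_of_summable_norm ?_ ?_
      · exact Summable.of_nonneg_of_le (fun _ => norm_nonneg _) (fun n => T_norm_le p q u _ _) hF.1
      · exact Summable.of_nonneg_of_le (fun _ => norm_nonneg _) (fun n => T_norm_le p q u _ _) hG.1)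
  refine h.mono ?_
  rw [hS.tsum_add hδc.summable, ← hF.1.tsum_mul_tsum hG.1 hS, hδc.tsum_eq]
  gcongr

end Prod

end ApAux

/-- if `F, G ∈ A_p(ℝ₊)` then the pointwise product `F·G ∈ A_p(ℝ₊)` and
`‖F·G‖_{A_p} ≤ ‖F‖_{A_p} ‖G‖_{A_p}`; i.e. `A_p(ℝ₊)` is a Banach algebra for the
pointwise product. -/
theorem Ap_banach_algebra (p q : ℝ≥0∞) [Fact (1 ≤ p)] [Fact (1 ≤ q)]
    (hp : 1 < p) (hp' : p ≠ ∞) (hpq : p⁻¹ + q⁻¹ = 1) (F G : ℝ → ℂ)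
    (hF : ∃ f g, ApRep p q F f g) (hG : ∃ f g, ApRep p q G f g) :
    (∃ f g, ApRep p q (fun u => F u * G u) f g) ∧
    sInf (ApNormSet p q (fun u => F u * G u))
      ≤ sInf (ApNormSet p q F) * sInf (ApNormSet p q G) := by
  have hHC : ENNReal.HolderConjugate p q := ENNReal.holderConjugate_iff.2 hpq
  have hq : q ≠ ∞ := by
    rintro rfl
    simp at hpq
    exact hp.ne' hpq
  obtain ⟨f1, g1, h1⟩ := hF
  obtain ⟨f2, g2, h2⟩ := hG
  refine ⟨?_, ?_⟩
  · obtain ⟨f, g, h, _⟩ := ApAux.has_mul hp' hq h1 h2 one_pos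
    exact ⟨f, g, h⟩
  have hn : ∀ F : ℝ → ℂ, ∀ c ∈ ApNormSet p q F, 0 ≤ c := by
    rintro F c ⟨f, g, _, rfl⟩
    exact tsum_nonneg fun n => by positivity
  have hbdd : BddBelow (ApNormSet p q (fun u => F u * G u)) := ⟨0, fun c hc => hn _ c hc⟩
  have key : ∀ a ∈ ApNormSet p q F, ∀ b ∈ ApNormSet p q G,
      sInf (ApNormSet p q (fun u => F u * G u)) ≤ a * b := by
    rintro a ⟨f, g, h, rfl⟩ b ⟨f', g', h', rfl⟩
    refine le_of_forall_pos_le_add fun ε hε => ?_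
    obtain ⟨f'', g'', h'', hle⟩ := ApAux.has_mul hp' hq h h' hε
    exact (csInf_le hbdd ⟨f'', g'', h'', rfl⟩).trans hle
  have neF : (ApNormSet p q F).Nonempty := ⟨_, f1, g1, h1, rfl⟩
  have neG : (ApNormSet p q G).Nonempty := ⟨_, f2, g2, h2, rfl⟩
  have cF : sInf (ApNormSet p q F) ∈ closure (ApNormSet p q F) :=
    csInf_mem_closure neF ⟨0, fun c hc => hn _ c hc⟩
  have cG : sInf (ApNormSet p q G) ∈ closure (ApNormSet p q G) :=
    csInf_mem_closure neG ⟨0, fun c hc => hn _ c hc⟩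
  have step : ∀ a ∈ ApNormSet p q F, sInf (ApNormSet p q (fun u => F u * G u)) ≤
      a * sInf (ApNormSet p q G) := fun a ha =>
    closure_minimal (s := ApNormSet p q G)
      (t := {b | sInf (ApNormSet p q (fun u => F u * G u)) ≤ a * b}) (key a ha)
      (isClosed_le continuous_const (by fun_prop)) cG
  exact closure_minimal (s := ApNormSet p q F)
      (t := {a | sInf (ApNormSet p q (fun u => F u * G u)) ≤ a * sInf (ApNormSet p q G)}) step
      (isClosed_le continuous_const (by fun_prop)) cF
end
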